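/- (Wulff shape in probability for reachable sets of the G-equation.) Assume the G-equation hypotheses on (c,v) over a probability space (Ω,F,P), assume measurability in ω of all travel times and of the relevant events, and assume only lim_{s→∞} φ_H(s) = 0 for H := (c,v). Then there exist M ≥ 1 and a convex bounded open set S ⊆ ℝ^d with B_{1/M}(0) ⊆ S ⊆ B_M(0), such that for every R > 0 and δ ∈ (0,1): lim_{t→∞} P[ (1−δ)sS ⊆ Γ(s,·; 0, x_0) − x_0 ⊆ (1+δ)sS for all s ∈ [t/R, Rt] and all x_0 ∈ B_{Rt}(0) ] = 1. -/

import Mathlib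

open MeasureTheory Filter Metric

noncomputable section

/-- `ℝ^d` with the Euclidean norm. -/
abbrev Euc (d : ℕ) : Type := EuclideanSpace ℝ (Fin d)

/-- `(t₁, x₁)` is reachable from `(t₀, x₀)`: there is an absolutely continuous path
`γ : [t₀,t₁] → ℝ^d` (given by the integral of its a.e. derivative `g`) with `γ(t₀) = x₀`,
`γ(t₁) = x₁`, and `|γ'(t) − v(t,γ(t))| ≤ c(t,γ(t))` for a.e. `t ∈ [t₀,t₁]`. -/
def Reachable {d : ℕ} (c : ℝ → Euc d → ℝ) (v : ℝ → Euc d → Euc d)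
    (t0 : ℝ) (x0 : Euc d) (t1 : ℝ) (x1 : Euc d) : Prop :=
  t0 ≤ t1 ∧ ∃ γ g : ℝ → Euc d,
    IntervalIntegrable g volume t0 t1 ∧
    (∀ t ∈ Set.Icc t0 t1, γ t = x0 + ∫ s in t0..t, g s) ∧
    γ t1 = x1 ∧
    ∀ᵐ s ∂(volume.restrict (Set.Icc t0 t1)), ‖g s - v s (γ s)‖ ≤ c s (γ s)

/-- The reachable set `Γ(t; t₀, x₀)`. -/
def reachSet {d : ℕ} (c : ℝ → Euc d → ℝ) (v : ℝ → Euc d → Euc d)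
    (t t0 : ℝ) (x0 : Euc d) : Set (Euc d) :=
  {x | Reachable c v t0 x0 (t0 + t) x}

/-- The travel time `τ^{t₀}(x₀, x) = inf { t ≥ 0 : x ∈ Γ(t; t₀, x₀) }`. -/
def travelTime {d : ℕ} (c : ℝ → Euc d → ℝ) (v : ℝ → Euc d → Euc d)
    (t0 : ℝ) (x0 x : Euc d) : ℝ :=
  sInf {t | 0 ≤ t ∧ x ∈ reachSet c v t t0 x0}

/-- The σ-algebra `F_t^+(H)` generated by `H(s,x,·) = (c(s,x,·), v(s,x,·))` for `s ≥ t`. -/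
def sigmaPlus {d : ℕ} {Ω : Type*} [MeasurableSpace Ω]
    (c : ℝ → Euc d → Ω → ℝ) (v : ℝ → Euc d → Ω → Euc d) (t : ℝ) : MeasurableSpace Ω :=
  ⨆ (s : ℝ) (_ : t ≤ s) (x : Euc d),
    MeasurableSpace.comap (fun ω => (c s x ω, v s x ω)) inferInstance

/-- The σ-algebra `F_t^-(H)` generated by `H(s,x,·) = (c(s,x,·), v(s,x,·))` for `s ≤ t`. -/
def sigmaMinus {d : ℕ} {Ω : Type*} [MeasurableSpace Ω]
    (c : ℝ → Euc d → Ω → ℝ) (v : ℝ → Euc d → Ω → Euc d) (t : ℝ) : MeasurableSpace Ω :=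
  ⨆ (s : ℝ) (_ : s ≤ t) (x : Euc d),
    MeasurableSpace.comap (fun ω => (c s x ω, v s x ω)) inferInstance

/-- The mixing coefficient `φ_H(s)` of `H = (c,v)`. -/
def phiH {d : ℕ} {Ω : Type*} [MeasurableSpace Ω] (P : Measure Ω)
    (c : ℝ → Euc d → Ω → ℝ) (v : ℝ → Euc d → Ω → Euc d) (s : ℝ) : ℝ :=
  sSup {r | ∃ t : ℝ, ∃ Ev Fv : Set Ω,
    MeasurableSet[sigmaMinus c v t] Ev ∧ MeasurableSet[sigmaPlus c v (t + s)] Fv ∧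
    0 < P Ev ∧ r = |(P (Fv ∩ Ev)).toReal / (P Ev).toReal - (P Fv).toReal|}


/-- Admissible weights: positive, integrable, at most one, log-Lipschitz. -/
structure Wt {d : ℕ} (κ : ℝ) (ψ : Euc d → ℝ) : Prop where
  pos : ∀ x, 0 < ψ x
  le_one : ∀ x, ψ x ≤ 1
  integ : Integrable ψ
  star : ∀ x y, ψ x ≤ Real.exp (κ * ‖x - y‖) * ψ y

theorem meas_fderiv_apply {d : ℕ} (g : Euc d → ℝ) {v : Euc d → Euc d} (hv : Measurable v) :
    Measurable fun x => fderiv ℝ g x (v x) := by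
  have h1 : Measurable (fderiv ℝ g) := measurable_fderiv ℝ g
  have h2 : Measurable fun p : (Euc d →L[ℝ] ℝ) × Euc d => p.1 p.2 :=
    isBoundedBilinearMap_apply.continuous.measurable
  exact h2.comp (h1.prodMk hv)

namespace Wt
variable {d : ℕ} {κ : ℝ} {ψ : Euc d → ℝ}

theorem abs_sub_le (h : Wt κ ψ) (hκ : 0 ≤ κ) (x y : Euc d) :
    |ψ x - ψ y| ≤ (Real.exp (κ * ‖x - y‖) - 1) * ψ y := by
  have h1 := h.star x y
  have h2 := h.star y x
  rw [norm_sub_rev] at h2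
  set e := Real.exp (κ * ‖x - y‖) with he
  have he1 : 1 ≤ e := Real.one_le_exp (by positivity)
  have hy := h.pos y
  have hx := h.pos x
  rw [abs_le]
  constructor
  · by_cases hxy : ψ y ≤ ψ x
    · nlinarith
    · push Not at hxy
      nlinarith [mul_le_mul_of_nonneg_left hxy.le (sub_nonneg.2 he1)]
  · nlinarith

theorem meas_of_cont (h : Wt κ ψ) : AEStronglyMeasurable ψ volume := h.integ.1

theorem lip (h : Wt κ ψ) (hκ : 0 ≤ κ) : LipschitzWith κ.toNNReal ψ := by
  refine LipschitzWith.of_dist_le_mul fun x y => ?_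
  rw [Real.dist_eq, Real.coe_toNNReal _ hκ, dist_eq_norm]
  have key : ∀ x y : Euc d, ψ x - ψ y ≤ κ * ‖x - y‖ := by
    intro x y
    have h2 := h.star y x
    rw [norm_sub_rev] at h2
    have h3 : 1 - κ * ‖x - y‖ ≤ Real.exp (-(κ * ‖x - y‖)) := by
      have := Real.add_one_le_exp (-(κ * ‖x - y‖)); linarith
    have h4 : Real.exp (-(κ * ‖x - y‖)) * ψ x ≥ 0 := by have := h.pos x; positivity
    have h1 := h.star x y
    have h5 : Real.exp (-(κ * ‖x - y‖)) * ψ x ≤ ψ y := by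
      rw [Real.exp_neg]
      rw [inv_mul_le_iff₀ (Real.exp_pos _)]; exact h1
    have h6 : (1 - κ * ‖x - y‖) * ψ x ≤ ψ y :=
      (mul_le_mul_of_nonneg_right h3 (h.pos x).le).trans h5
    have h7 : κ * ‖x - y‖ * ψ x ≤ κ * ‖x - y‖ :=
      mul_le_of_le_one_right (by positivity) (h.le_one x)
    nlinarith
  rw [abs_le]
  refine ⟨?_, key x y⟩
  have := key y x
  rw [norm_sub_rev] at this; linarith

theorem fderiv_le (h : Wt κ ψ) (hκ : 0 ≤ κ) (x : Euc d) : ‖fderiv ℝ ψ x‖ ≤ κ * ψ x := by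
  have hx := h.pos x
  refine le_of_forall_gt_imp_ge_of_dense fun C hC => ?_
  have hC0 : 0 ≤ C := le_trans (by positivity) hC.le
  apply norm_fderiv_le_of_lip' ℝ hC0
  -- near x, (exp(κ r) - 1) ψ x ≤ C r
  have hd : HasDerivAt (fun r : ℝ => Real.exp (κ * r) * ψ x) (κ * ψ x) 0 := by
    have h1 : HasDerivAt (fun r : ℝ => Real.exp (κ * r)) (Real.exp (κ * 0) * (κ * 1)) 0 :=
      ((hasDerivAt_id (0:ℝ)).const_mul κ).exp
    have := h1.mul_const (ψ x)
    simpa using this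
  have h2 := (hasDerivAt_iff_tendsto_slope.1 hd).eventually (gt_mem_nhds hC)
  rw [eventually_nhdsWithin_iff] at h2
  have h3 : Tendsto (fun y : Euc d => ‖y - x‖) (nhds x) (nhds 0) := by
    have : Continuous fun y : Euc d => ‖y - x‖ := by fun_prop
    simpa using this.tendsto x
  filter_upwards [h3.eventually h2] with y hy
  have h4 := h.abs_sub_le hκ y x
  rw [Real.norm_eq_abs]
  refine h4.trans ?_
  rcases eq_or_ne y x with rfl | hne
  · simp
  · have hpos : 0 < ‖y - x‖ := norm_pos_iff.2 (sub_ne_zero.2 hne)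
    have h5 := hy hpos.ne'
    rw [slope_def_field, div_lt_iff₀ (by simpa using hpos)] at h5
    simp at h5
    nlinarith

theorem int_mul (h : Wt κ ψ) {f : Euc d → ℝ} (hf : AEStronglyMeasurable f volume) {C : ℝ}
    (hb : ∀ x, |f x| ≤ C) : Integrable fun x => ψ x * f x :=
  h.integ.mul_bdd hf (Eventually.of_forall hb)

end Wt

/-- Integration by parts. -/
theorem ibp_bound {d : ℕ} {κ : ℝ} (hκ : 0 ≤ κ) {ψ : Euc d → ℝ} (hψ : Wt κ ψ)
    {v : Euc d → Euc d} {Lv : NNReal} (hv : LipschitzWith Lv v) {K : ℝ} (hK : ∀ x, ‖v x‖ ≤ K)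
    (hdiv : ∀ᵐ x ∂(volume : Measure (Euc d)),
      LinearMap.trace ℝ (Euc d) (fderiv ℝ v x).toLinearMap = 0)
    {g : Euc d → ℝ} {Lg : NNReal} (hg : LipschitzWith Lg g) (hgc : HasCompactSupport g) :
    |∫ x, ψ x * fderiv ℝ g x (v x)| ≤ K * κ * ∫ x, ψ x * |g x| := by
  have hK0 : 0 ≤ K := (norm_nonneg _).trans (hK 0)
  let e : Fin d → Euc d := fun i => EuclideanSpace.single i 1
  have hψl := hψ.lip hκ
  have hvi : ∀ i, LipschitzWith Lv (fun x => v x i) := fun i => by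
    refine LipschitzWith.of_dist_le_mul fun x y => ?_
    rw [Real.dist_eq]
    calc |v x i - v y i| = ‖(v x - v y) i‖ := by simp
      _ ≤ ‖v x - v y‖ := PiLp.norm_apply_le _ _
      _ ≤ _ := by rw [← dist_eq_norm]; exact hv.dist_le_mul x y
  have hviK : ∀ i x, |v x i| ≤ K := fun i x => (PiLp.norm_apply_le (v x) i).trans (hK x)
  have hfl : ∀ i, LipschitzWith (κ.toNNReal * K.toNNReal + Lv) (fun x => ψ x * v x i) := fun i => by
    refine LipschitzWith.of_dist_le_mul fun x y => ?_
    have h1 := hψl.dist_le_mul x y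
    have h2 := (hvi i).dist_le_mul x y
    rw [Real.dist_eq] at *
    push_cast
    rw [Real.coe_toNNReal _ hκ, Real.coe_toNNReal _ hK0] at *
    have h3 : ψ x * v x i - ψ y * v y i = (ψ x - ψ y) * v x i + ψ y * (v x i - v y i) := by ring
    rw [h3]
    refine (abs_add_le _ _).trans ?_
    rw [abs_mul, abs_mul, abs_of_pos (hψ.pos y), add_mul]
    refine add_le_add ?_ ?_
    · calc _ ≤ (κ * dist x y) * K := mul_le_mul h1 (hviK i x) (abs_nonneg _) (by positivity)
        _ = _ := by ring
    · calc _ ≤ 1 * (Lv * dist x y) := mul_le_mul (hψ.le_one y) h2 (abs_nonneg _) (by positivity)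
        _ = _ := by ring
  have hcoord : ∀ w : Euc d, w = ∑ i, w i • e i := fun w => by
    have := (EuclideanSpace.basisFun (Fin d) ℝ).sum_repr w
    simpa [e] using this.symm
  have hI : ∀ i, ∫ x, lineDeriv ℝ (fun x => ψ x * v x i) x (e i) * g x
      = ∫ x, lineDeriv ℝ g x (-(e i)) * (ψ x * v x i) := fun i =>
    LipschitzWith.integral_lineDeriv_mul_eq (hfl i) hg hgc (e i)
  have hgb : ∃ C, ∀ x, |g x| ≤ C := by
    obtain ⟨C, hC⟩ := hgc.exists_bound_of_continuous hg.continuous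
    exact ⟨C, hC⟩
  obtain ⟨Cg, hCg⟩ := hgb
  have hgint : Integrable g := hg.continuous.integrable_of_hasCompactSupport hgc
  have hvm : Measurable v := hv.continuous.measurable
  have hint1 : ∀ i, Integrable fun x => lineDeriv ℝ (fun x => ψ x * v x i) x (e i) * g x := fun i => by
    refine hgint.bdd_mul (c := (κ.toNNReal * K.toNNReal + Lv : NNReal) * ‖e i‖)
      (measurable_lineDeriv (hfl i).continuous).aestronglyMeasurable
      (Eventually.of_forall fun x => norm_lineDeriv_le_of_lipschitz ℝ (hfl i))
  have hint2 : ∀ i, Integrable fun x => lineDeriv ℝ g x (-(e i)) * (ψ x * v x i) := fun i => by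
    have h0 : Integrable fun x => ψ x * v x i :=
      hψ.int_mul (hvi i).continuous.aestronglyMeasurable (hviK i)
    exact h0.bdd_mul (c := Lg * ‖-(e i)‖) (measurable_lineDeriv hg.continuous).aestronglyMeasurable
      (Eventually.of_forall fun x => norm_lineDeriv_le_of_lipschitz ℝ hg)
  have hsum : ∫ x, ∑ i, lineDeriv ℝ (fun x => ψ x * v x i) x (e i) * g x
      = ∫ x, ∑ i, lineDeriv ℝ g x (-(e i)) * (ψ x * v x i) := by
    rw [integral_finsetSum _ fun i _ => hint1 i, integral_finsetSum _ fun i _ => hint2 i]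
    exact Finset.sum_congr rfl fun i _ => hI i
  have hR : ∫ x, ∑ i, lineDeriv ℝ g x (-(e i)) * (ψ x * v x i)
      = - ∫ x, ψ x * fderiv ℝ g x (v x) := by
    rw [← integral_neg]
    refine integral_congr_ae ?_
    filter_upwards [hg.ae_differentiableAt] with x hx
    conv_rhs => rw [hcoord (v x)]
    rw [map_sum, Finset.mul_sum, ← Finset.sum_neg_distrib]
    refine Finset.sum_congr rfl fun i _ => ?_
    rw [hx.lineDeriv_eq_fderiv]
    simp
    ring
  have hL : ∫ x, ∑ i, lineDeriv ℝ (fun x => ψ x * v x i) x (e i) * g x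
      = ∫ x, fderiv ℝ ψ x (v x) * g x := by
    refine integral_congr_ae ?_
    filter_upwards [hψl.ae_differentiableAt, hv.ae_differentiableAt, hdiv] with x h1 h2 h3
    rw [← Finset.sum_mul]
    congr 1
    have h4 : ∀ i, HasFDerivAt (fun x => v x i)
        ((EuclideanSpace.proj i).comp (fderiv ℝ v x)) x := fun i =>
      (EuclideanSpace.proj (𝕜 := ℝ) i).hasFDerivAt.comp x h2.hasFDerivAt
    have h5 : ∀ i, lineDeriv ℝ (fun x => ψ x * v x i) x (e i)
        = v x i * fderiv ℝ ψ x (e i) + ψ x * (fderiv ℝ v x (e i)) i := fun i => by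
      have : HasFDerivAt (fun x => ψ x * v x i) _ x := h1.hasFDerivAt.mul (h4 i)
      rw [(this.hasLineDerivAt (e i)).lineDeriv]
      simp
      ring
    simp_rw [h5]
    rw [Finset.sum_add_distrib]
    have h6 : ∑ i, ψ x * (fderiv ℝ v x (e i)) i = 0 := by
      rw [← Finset.mul_sum]
      rw [LinearMap.trace_eq_sum_inner _ (EuclideanSpace.basisFun (Fin d) ℝ)] at h3
      have h7 : ∑ i, (fderiv ℝ v x (e i)) i = 0 := by
        rw [← h3]
        refine Finset.sum_congr rfl fun i _ => ?_
        simp [e, EuclideanSpace.inner_single_left]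
      rw [h7, mul_zero]
    rw [h6, add_zero]
    conv_rhs => rw [hcoord (v x)]
    rw [map_sum]
    simp
  have hfin : ∫ x, ψ x * fderiv ℝ g x (v x) = - ∫ x, fderiv ℝ ψ x (v x) * g x := by
    rw [← hL, hsum, hR, neg_neg]
  rw [hfin, abs_neg, ← Real.norm_eq_abs]
  calc _ ≤ ∫ x, ‖fderiv ℝ ψ x (v x) * g x‖ := norm_integral_le_integral_norm _
    _ ≤ ∫ x, K * κ * (ψ x * |g x|) := by
        refine integral_mono_of_nonneg (Eventually.of_forall fun x => norm_nonneg _)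
          ((hψ.int_mul hg.continuous.abs.aestronglyMeasurable (C := Cg)
            (fun x => by rw [abs_abs]; exact hCg x)).const_mul _)
          (Eventually.of_forall fun x => ?_)
        simp only [norm_mul]
        calc _ ≤ (κ * ψ x * K) * |g x| := by
              refine mul_le_mul_of_nonneg_right ?_ (abs_nonneg _)
              refine ((fderiv ℝ ψ x).le_opNorm _).trans ?_
              exact mul_le_mul (hψ.fderiv_le hκ x) (hK x) (norm_nonneg _)
                (by have := hψ.pos x; positivity)
          _ = _ := by ring
    _ = _ := by rw [integral_const_mul]

theorem norm_fderiv_meas {d : ℕ} (g : Euc d → ℝ) : Measurable fun x => ‖fderiv ℝ g x‖ :=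
  (measurable_fderiv ℝ g).norm

theorem Wt.int_fd {d : ℕ} {κ : ℝ} {ψ : Euc d → ℝ} (hψ : Wt κ ψ)
    {g : Euc d → ℝ} {Lg : NNReal} (hg : LipschitzWith Lg g) :
    Integrable fun x => ψ x * ‖fderiv ℝ g x‖ :=
  hψ.int_mul (norm_fderiv_meas g).aestronglyMeasurable (C := Lg) fun x => by
    rw [abs_of_nonneg (norm_nonneg _)]
    exact norm_fderiv_le_of_lipschitz ℝ hg

/-- L2, `ℝ≥0∞` version. -/
theorem shift_le_lintegral {d : ℕ} {κ : ℝ} (hκ : 0 ≤ κ) {ψ : Euc d → ℝ} (hψ : Wt κ ψ)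
    {g : Euc d → ℝ} {Lg : NNReal} (hg : LipschitzWith Lg g) (y : Euc d) :
    ∫⁻ x, ENNReal.ofReal (ψ x * |g x - g (x - y)|)
      ≤ ENNReal.ofReal (‖y‖ * Real.exp (κ * ‖y‖) * ∫ x, ψ x * ‖fderiv ℝ g x‖) := by
  have hψm : Measurable ψ := (hψ.lip hκ).continuous.measurable
  have hlm : Measurable fun x => lineDeriv ℝ g x (-y) := measurable_lineDeriv hg.continuous
  set e := Real.exp (κ * ‖y‖) with he
  have he0 : 0 < e := Real.exp_pos _
  let G : Euc d → ENNReal := fun x => ENNReal.ofReal (e * (ψ x * |lineDeriv ℝ g x (-y)|))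
  have hG : Measurable G := by fun_prop
  have hpt : ∀ x, ENNReal.ofReal (ψ x * |g x - g (x - y)|)
      ≤ ∫⁻ s in Set.Ioc (0:ℝ) 1, G (x - s • y) := by
    intro x
    let f : ℝ → ℝ := fun s => g (x - s • y)
    have hfl : LipschitzWith (Lg * ‖y‖₊) f := by
      refine LipschitzWith.of_dist_le_mul fun s t => ?_
      refine (hg.dist_le_mul _ _).trans ?_
      rw [dist_eq_norm, dist_eq_norm]
      have : x - s • y - (x - t • y) = -((s - t) • y) := by rw [sub_smul]; abel
      rw [this, norm_neg, norm_smul]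
      push_cast
      apply le_of_eq; ring
    have hac := (hfl.lipschitzOnWith (s := Set.uIcc (0:ℝ) 1)).absolutelyContinuousOnInterval
    have h1 := hac.integral_deriv_eq_sub
    have hder : ∀ s, deriv f s = lineDeriv ℝ g (x - s • y) (-y) := by
      intro s
      rw [lineDeriv]
      have : (fun t : ℝ => g (x - s • y + t • (-y))) = fun t => f (s + t) := by
        funext t
        simp only [f]
        congr 1
        rw [add_smul, smul_neg]; abel
      rw [this, deriv_comp_const_add, add_zero]
    have h2 : |g x - g (x - y)| ≤ ∫ s in (0:ℝ)..1, |lineDeriv ℝ g (x - s • y) (-y)| := by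
      have : g (x - y) - g x = f 1 - f 0 := by simp [f]
      rw [abs_sub_comm, this, ← h1]
      refine (intervalIntegral.abs_integral_le_integral_abs zero_le_one).trans (le_of_eq ?_)
      simp_rw [hder]
    rw [intervalIntegral.integral_of_le zero_le_one] at h2
    have hmeas : Measurable fun s : ℝ => |lineDeriv ℝ g (x - s • y) (-y)| := by
      have : Measurable fun s : ℝ => x - s • y := by fun_prop
      exact (hlm.comp this).abs
    have hint : Integrable (fun s : ℝ => |lineDeriv ℝ g (x - s • y) (-y)|)
        (volume.restrict (Set.Ioc (0:ℝ) 1)) := by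
      refine Integrable.of_bound hmeas.aestronglyMeasurable (Lg * ‖-y‖) (Eventually.of_forall ?_)
      intro s
      rw [Real.norm_eq_abs, abs_abs]
      exact norm_lineDeriv_le_of_lipschitz ℝ hg
    calc ENNReal.ofReal (ψ x * |g x - g (x - y)|)
        ≤ ENNReal.ofReal (ψ x * ∫ s in Set.Ioc (0:ℝ) 1, |lineDeriv ℝ g (x - s • y) (-y)|) :=
          ENNReal.ofReal_le_ofReal (mul_le_mul_of_nonneg_left h2 (hψ.pos x).le)
      _ = ∫⁻ s in Set.Ioc (0:ℝ) 1, ENNReal.ofReal (ψ x * |lineDeriv ℝ g (x - s • y) (-y)|) := by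
          rw [← integral_const_mul, ofReal_integral_eq_lintegral_ofReal (hint.const_mul _)]
          exact Eventually.of_forall fun s => mul_nonneg (hψ.pos x).le (abs_nonneg _)
      _ ≤ _ := by
          refine setLIntegral_mono' measurableSet_Ioc fun s hs => ?_
          refine ENNReal.ofReal_le_ofReal ?_
          rw [← mul_assoc]
          refine mul_le_mul_of_nonneg_right ?_ (abs_nonneg _)
          refine (hψ.star x (x - s • y)).trans ?_
          refine mul_le_mul_of_nonneg_right ?_ (hψ.pos _).le
          refine Real.exp_le_exp.2 (mul_le_mul_of_nonneg_left ?_ hκ)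
          rw [sub_sub_cancel, norm_smul, Real.norm_eq_abs, abs_of_pos hs.1]
          exact mul_le_of_le_one_left (norm_nonneg _) hs.2
  calc _ ≤ ∫⁻ x, ∫⁻ s in Set.Ioc (0:ℝ) 1, G (x - s • y) := lintegral_mono hpt
    _ = ∫⁻ s in Set.Ioc (0:ℝ) 1, ∫⁻ x, G (x - s • y) := by
        refine lintegral_lintegral_swap ?_
        have : Measurable fun p : Euc d × ℝ => p.1 - p.2 • y := by fun_prop
        exact (hG.comp this).aemeasurable
    _ = ∫⁻ s in Set.Ioc (0:ℝ) 1, ∫⁻ x, G x := by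
        refine lintegral_congr fun s => ?_
        exact lintegral_sub_right_eq_self G (s • y)
    _ = ∫⁻ x, G x := by simp
    _ ≤ ∫⁻ x, ENNReal.ofReal (‖y‖ * e * (ψ x * ‖fderiv ℝ g x‖)) := by
        refine lintegral_mono_ae ?_
        filter_upwards [hg.ae_differentiableAt] with x hx
        refine ENNReal.ofReal_le_ofReal ?_
        rw [hx.lineDeriv_eq_fderiv]
        have h1 : |fderiv ℝ g x (-y)| ≤ ‖fderiv ℝ g x‖ * ‖y‖ := by
          have := (fderiv ℝ g x).le_opNorm (-y)
          rwa [norm_neg] at this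
        have h2 := mul_le_mul_of_nonneg_left h1 (mul_nonneg he0.le (hψ.pos x).le)
        nlinarith
    _ = _ := by
        rw [← ofReal_integral_eq_lintegral_ofReal ((hψ.int_fd hg).const_mul _), integral_const_mul]
        exact Eventually.of_forall fun x => by
          have := (hψ.pos x).le
          show 0 ≤ _
          positivity

/-- L2. -/
theorem shift_le {d : ℕ} {κ : ℝ} (hκ : 0 ≤ κ) {ψ : Euc d → ℝ} (hψ : Wt κ ψ)
    {g : Euc d → ℝ} {Lg : NNReal} (hg : LipschitzWith Lg g) (y : Euc d) :
    ∫ x, ψ x * |g x - g (x - y)| ≤ ‖y‖ * Real.exp (κ * ‖y‖) * ∫ x, ψ x * ‖fderiv ℝ g x‖ := by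
  have hI : 0 ≤ ∫ x, ψ x * ‖fderiv ℝ g x‖ :=
    integral_nonneg fun x => mul_nonneg (hψ.pos x).le (norm_nonneg _)
  have h0 : ∀ x, 0 ≤ ψ x * |g x - g (x - y)| := fun x => mul_nonneg (hψ.pos x).le (abs_nonneg _)
  have hc : Continuous fun x => ψ x * |g x - g (x - y)| := by
    have := (hψ.lip hκ).continuous
    have := hg.continuous
    fun_prop
  rw [integral_eq_lintegral_of_nonneg_ae (Eventually.of_forall h0) hc.aestronglyMeasurable]
  refine ENNReal.toReal_le_of_le_ofReal (by positivity) ?_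
  exact shift_le_lintegral hκ hψ hg y

/-- L4. -/
theorem poincare {d : ℕ} {κ : ℝ} (hκ : 0 ≤ κ) {ψ : Euc d → ℝ} (hψ : Wt κ ψ) (r : ℝ) (hr : 0 < r) :
    ∃ C : ℝ, 0 < C ∧ ∀ (W : Euc d → ℝ) (Lg : NNReal), LipschitzWith Lg W → ∀ S1 : Set (Euc d),
      MeasurableSet S1 → S1 ⊆ ball 0 r → (∀ x ∈ S1, W x = 1) → (∀ x, W x ≤ 1) →
      volume S1 * ∫⁻ z in ball 0 r, ENNReal.ofReal (1 - W z) ≤ ENNReal.ofReal (C * ∫ x, ψ x * ‖fderiv ℝ W x‖) := by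
  set m := Real.exp (-(κ * r)) * ψ 0 with hm
  have hm0 : 0 < m := mul_pos (Real.exp_pos _) (hψ.pos 0)
  set V := (volume (ball (0 : Euc d) (2 * r))).toReal with hV
  have hV0 : 0 < V := ENNReal.toReal_pos (measure_ball_pos _ _ (by positivity)).ne'
    measure_ball_lt_top.ne
  refine ⟨m⁻¹ * (V * (2 * r * Real.exp (κ * (2 * r)))), by positivity, ?_⟩
  intro W Lg hW S1 hS1 h1 hW1 hW0
  set S0 := ball (0 : Euc d) r with hS0d
  have hS0 : MeasurableSet S0 := measurableSet_ball
  have h0 : S0 ⊆ ball 0 r := subset_rfl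
  set J := ∫⁻ z in S0, ENNReal.ofReal (1 - W z) with hJ
  have hψm : Measurable ψ := (hψ.lip hκ).continuous.measurable
  have hWm : Measurable W := hW.continuous.measurable
  set I := ∫ x, ψ x * ‖fderiv ℝ W x‖ with hI
  have hI0 : 0 ≤ I := integral_nonneg fun x => mul_nonneg (hψ.pos x).le (norm_nonneg _)
  have key : ENNReal.ofReal m * (volume S1 * J)
      ≤ ENNReal.ofReal (V * (2 * r * Real.exp (κ * (2 * r))) * I) := by
    calc ENNReal.ofReal m * (volume S1 * J)
        = ∫⁻ x in S1, ∫⁻ z in S0, ENNReal.ofReal m * ENNReal.ofReal (1 - W z) := by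
          rw [lintegral_const, lintegral_const_mul _ (by fun_prop), Measure.restrict_apply_univ]
          ring
      _ ≤ ∫⁻ x in S1, ∫⁻ y in ball (0 : Euc d) (2 * r),
            ENNReal.ofReal (ψ x * |W x - W (x - y)|) := by
          refine setLIntegral_mono' hS1 fun x hx => ?_
          calc ∫⁻ z in S0, ENNReal.ofReal m * ENNReal.ofReal (1 - W z)
              ≤ ∫⁻ z in S0, ENNReal.ofReal (ψ x * |W x - W z|) := by
                refine setLIntegral_mono' hS0 fun z hz => ?_
                rw [← ENNReal.ofReal_mul hm0.le]
                refine ENNReal.ofReal_le_ofReal ?_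
                rw [hW1 x hx, abs_of_nonneg (sub_nonneg.2 (hW0 z))]
                refine mul_le_mul_of_nonneg_right ?_ (sub_nonneg.2 (hW0 z))
                have h2 := hψ.star 0 x
                have hx' : ‖(0 : Euc d) - x‖ ≤ r := by
                  have := h1 hx
                  rw [mem_ball_zero_iff] at this
                  rw [zero_sub, norm_neg]; exact this.le
                rw [hm, Real.exp_neg, inv_mul_le_iff₀ (Real.exp_pos _)]
                refine h2.trans (mul_le_mul_of_nonneg_right ?_ (hψ.pos x).le)
                exact Real.exp_le_exp.2 (mul_le_mul_of_nonneg_left hx' hκ)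
            _ = ∫⁻ z, S0.indicator (fun z => ENNReal.ofReal (ψ x * |W x - W z|)) z :=
                (lintegral_indicator hS0 _).symm
            _ = ∫⁻ y, S0.indicator (fun z => ENNReal.ofReal (ψ x * |W x - W z|)) (x - y) :=
                (lintegral_sub_left_eq_self _ x).symm
            _ ≤ ∫⁻ y, (ball (0 : Euc d) (2 * r)).indicator
                  (fun y => ENNReal.ofReal (ψ x * |W x - W (x - y)|)) y := by
                refine lintegral_mono fun y => ?_
                by_cases hy : x - y ∈ S0
                · have : y ∈ ball (0 : Euc d) (2 * r) := by
                    have a1 := h1 hx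
                    have a2 := h0 hy
                    rw [mem_ball_zero_iff] at *
                    have : y = x - (x - y) := by abel
                    rw [this]
                    have := norm_sub_le x (x - y)
                    linarith
                  simp [hy, this]
                · simp [hy]
            _ = _ := lintegral_indicator measurableSet_ball _
      _ ≤ ∫⁻ x, ∫⁻ y in ball (0 : Euc d) (2 * r), ENNReal.ofReal (ψ x * |W x - W (x - y)|) :=
          setLIntegral_le_lintegral _ _
      _ = ∫⁻ y in ball (0 : Euc d) (2 * r), ∫⁻ x, ENNReal.ofReal (ψ x * |W x - W (x - y)|) := by
          refine lintegral_lintegral_swap ?_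
          apply Measurable.aemeasurable
          simp only [Function.uncurry_def]
          fun_prop
      _ ≤ ∫⁻ y in ball (0 : Euc d) (2 * r), ENNReal.ofReal (2 * r * Real.exp (κ * (2 * r)) * I) := by
          refine setLIntegral_mono' measurableSet_ball fun y hy => ?_
          refine (shift_le_lintegral hκ hψ hW y).trans (ENNReal.ofReal_le_ofReal ?_)
          rw [mem_ball_zero_iff] at hy
          gcongr
      _ = _ := by
          rw [lintegral_const, Measure.restrict_apply_univ, mul_comm, mul_assoc V,
            ENNReal.ofReal_mul hV0.le, hV, ENNReal.ofReal_toReal measure_ball_lt_top.ne]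
  have h3 : volume S1 * J
      = ENNReal.ofReal m⁻¹ * (ENNReal.ofReal m * (volume S1 * J)) := by
    rw [← mul_assoc, ← ENNReal.ofReal_mul (by positivity), inv_mul_cancel₀ hm0.ne']
    simp
  rw [h3, mul_assoc, ENNReal.ofReal_mul (p := m⁻¹) (by positivity)]
  exact mul_le_mul_right key _

theorem box_volume (d : ℕ) (L : ℝ) (hL : 0 < L) :
    volume {y : Euc d | ∀ i, y i ∈ Set.Icc (0:ℝ) L} = ENNReal.ofReal (L ^ d) := by
  have h := (EuclideanSpace.volume_preserving_symm_measurableEquiv_toLp (Fin d)).symm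
  have h2 : {y : Euc d | ∀ i, y i ∈ Set.Icc (0:ℝ) L}
      = (MeasurableEquiv.toLp 2 (Fin d → ℝ)).symm ⁻¹' (Set.Icc (fun _ => 0) (fun _ => L)) := by
    ext y
    simp [Pi.le_def, forall_and]
  rw [h2, (EuclideanSpace.volume_preserving_symm_measurableEquiv_toLp (Fin d)).measure_preimage
    measurableSet_Icc.nullMeasurableSet, Real.volume_Icc_pi]
  simp [ENNReal.ofReal_pow hL.le]

theorem box_meas (d : ℕ) (L : ℝ) : MeasurableSet {y : Euc d | ∀ i, y i ∈ Set.Icc (0:ℝ) L} := by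
  rw [Set.ofPred_forall]
  refine MeasurableSet.iInter fun i => ?_
  have : Measurable fun y : Euc d => y i := by fun_prop
  exact this measurableSet_Icc

theorem box_norm {d : ℕ} {L : ℝ} (hL : 0 < L) {y : Euc d} (hy : ∀ i, y i ∈ Set.Icc (0:ℝ) L) :
    ‖y‖ ≤ Real.sqrt d * L := by
  rw [EuclideanSpace.norm_eq]
  have : Real.sqrt d * L = Real.sqrt (d * L ^ 2) := by
    rw [Real.sqrt_mul (by positivity), Real.sqrt_sq hL.le]
  rw [this]
  refine Real.sqrt_le_sqrt ?_
  calc ∑ i, ‖y i‖ ^ 2 ≤ ∑ _i : Fin d, L ^ 2 := by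
        refine Finset.sum_le_sum fun i _ => ?_
        rw [Real.norm_eq_abs, abs_of_nonneg (hy i).1]
        exact pow_le_pow_left₀ (hy i).1 (hy i).2 2
    _ = _ := by simp

theorem Wt.int_fdv {d : ℕ} {κ : ℝ} {ψ : Euc d → ℝ} (hψ : Wt κ ψ)
    {g : Euc d → ℝ} {Lg : NNReal} (hg : LipschitzWith Lg g) {v : Euc d → Euc d}
    (hv : Measurable v) {K : ℝ} (hK : ∀ x, ‖v x‖ ≤ K) :
    Integrable fun x => ψ x * fderiv ℝ g x (v x) :=
  hψ.int_mul (meas_fderiv_apply g hv).aestronglyMeasurable (C := Lg * K) fun x => by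
    refine ((fderiv ℝ g x).le_opNorm _).trans ?_
    exact mul_le_mul (norm_fderiv_le_of_lipschitz ℝ hg) (hK x) (norm_nonneg _) (by positivity)

/-- L3, per shift. -/
theorem flux_shift {d : ℕ} {κ : ℝ} (hκ : 0 ≤ κ) {ψ : Euc d → ℝ} (hψ : Wt κ ψ)
    {v : Euc d → Euc d} {Lv : NNReal} (hv : LipschitzWith Lv v) {K : ℝ} (hK : ∀ x, ‖v x‖ ≤ K)
    (hdiv : ∀ᵐ x ∂(volume : Measure (Euc d)),
      LinearMap.trace ℝ (Euc d) (fderiv ℝ v x).toLinearMap = 0)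
    {W : Euc d → ℝ} {Lg : NNReal} (hW : LipschitzWith Lg W) (hWc : HasCompactSupport W)
    {ρ : ℝ} {y : Euc d} (hy : ‖y‖ ≤ ρ) :
    ∫ x, ψ x * fderiv ℝ W x (v x) ≤ (∫ x, ψ x * fderiv ℝ W x (v (x + y)))
      + (K * κ * (ρ * Real.exp (κ * ρ)) + K * (Real.exp (κ * ρ) - 1))
        * ∫ x, ψ x * ‖fderiv ℝ W x‖ := by
  have hK0 : 0 ≤ K := (norm_nonneg _).trans (hK 0)
  have hρ : 0 ≤ ρ := (norm_nonneg _).trans hy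
  set I := ∫ x, ψ x * ‖fderiv ℝ W x‖ with hI
  have hI0 : 0 ≤ I := integral_nonneg fun x => mul_nonneg (hψ.pos x).le (norm_nonneg _)
  have hvm : Measurable v := hv.continuous.measurable
  let Wy : Euc d → ℝ := fun x => W (x - y)
  have hWy : LipschitzWith Lg Wy := by
    refine LipschitzWith.of_dist_le_mul fun a b => ?_
    have := hW.dist_le_mul (a - y) (b - y)
    simpa using this
  have hWyc : HasCompactSupport Wy := hWc.comp_homeomorph (Homeomorph.subRight y)
  have hfd : ∀ x, fderiv ℝ Wy x = fderiv ℝ W (x - y) := fun x => fderiv_comp_sub y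
  have hdiff : LipschitzWith (Lg + Lg) (fun x => W x - Wy x) := hW.sub hWy
  have hdc : HasCompactSupport (fun x => W x - Wy x) := hWc.sub hWyc
  have hshift : ∫ x, ψ x * fderiv ℝ W x (v (x + y)) = ∫ x, ψ (x - y) * fderiv ℝ Wy x (v x) := by
    rw [← integral_sub_right_eq_self (fun x => ψ x * fderiv ℝ W x (v (x + y))) y]
    simp [hfd]
  have h1 := ibp_bound hκ hψ hv hK hdiv hdiff hdc
  have h2 := shift_le hκ hψ hW y
  have h3 : ∫ x, ψ x * fderiv ℝ (fun x => W x - Wy x) x (v x)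
      = (∫ x, ψ x * fderiv ℝ W x (v x)) - ∫ x, ψ x * fderiv ℝ Wy x (v x) := by
    rw [← integral_sub (hψ.int_fdv hW hvm hK) (hψ.int_fdv hWy hvm hK)]
    refine integral_congr_ae ?_
    filter_upwards [hW.ae_differentiableAt, hWy.ae_differentiableAt] with x a1 a2
    rw [fderiv_fun_sub a1 a2]
    simp [mul_sub]
  have hψi : Integrable fun x => ψ (x - y) * fderiv ℝ Wy x (v x) := by
    have := (hψ.int_fdv hW (v := fun x => v (x + y)) (by fun_prop) (fun x => hK _)).comp_sub_right y
    simpa [hfd] using this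
  have hψn : Integrable fun x => ψ (x - y) * ‖fderiv ℝ Wy x‖ := by
    have := (hψ.int_fd hW).comp_sub_right y
    simpa [hfd] using this
  have h4 : (∫ x, ψ x * fderiv ℝ Wy x (v x)) - ∫ x, ψ (x - y) * fderiv ℝ Wy x (v x)
      ≤ K * (Real.exp (κ * ρ) - 1) * I := by
    rw [← integral_sub (hψ.int_fdv hWy hvm hK) hψi]
    have : I = ∫ x, ψ (x - y) * ‖fderiv ℝ Wy x‖ := by
      rw [hI, ← integral_sub_right_eq_self (fun x => ψ x * ‖fderiv ℝ W x‖) y]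
      simp [hfd]
    rw [this, ← integral_const_mul]
    refine integral_mono ((hψ.int_fdv hWy hvm hK).sub hψi) (hψn.const_mul _) fun x => ?_
    show ψ x * fderiv ℝ Wy x (v x) - ψ (x - y) * fderiv ℝ Wy x (v x) ≤ _
    rw [← sub_mul]
    have a1 := hψ.abs_sub_le hκ x (x - y)
    rw [sub_sub_cancel] at a1
    have a2 : |ψ x - ψ (x - y)| ≤ (Real.exp (κ * ρ) - 1) * ψ (x - y) := by
      refine a1.trans (mul_le_mul_of_nonneg_right ?_ (hψ.pos _).le)
      gcongr
    have a3 : |fderiv ℝ Wy x (v x)| ≤ ‖fderiv ℝ Wy x‖ * K :=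
      ((fderiv ℝ Wy x).le_opNorm _).trans (mul_le_mul_of_nonneg_left (hK x) (norm_nonneg _))
    refine (le_abs_self _).trans ?_
    rw [abs_mul]
    refine (mul_le_mul a2 a3 (abs_nonneg _) ((abs_nonneg _).trans a2)).trans (le_of_eq (by ring))
  have h5 : ∫ x, ψ x * |W x - Wy x| ≤ ρ * Real.exp (κ * ρ) * I := by
    refine h2.trans ?_
    gcongr
  have h6 := (le_abs_self _).trans (h1.trans (mul_le_mul_of_nonneg_left h5 (by positivity)))
  rw [h3] at h6
  rw [hshift]
  nlinarith

/-- L3. -/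
theorem flux_bound {d : ℕ} {κ : ℝ} (hκ : 0 ≤ κ) {ψ : Euc d → ℝ} (hψ : Wt κ ψ)
    {v : Euc d → Euc d} {Lv : NNReal} (hv : LipschitzWith Lv v) {K : ℝ} (hK : ∀ x, ‖v x‖ ≤ K)
    (hdiv : ∀ᵐ x ∂(volume : Measure (Euc d)),
      LinearMap.trace ℝ (Euc d) (fderiv ℝ v x).toLinearMap = 0)
    {L a : ℝ} (hL : 0 < L)
    (havg : ∀ x, ‖(L ^ d)⁻¹ • ∫ y in {y : Euc d | ∀ i, y i ∈ Set.Icc (0:ℝ) L}, v (x + y)‖ ≤ a)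
    {ρ : ℝ} (hρ : Real.sqrt d * L ≤ ρ)
    {W : Euc d → ℝ} {Lg : NNReal} (hW : LipschitzWith Lg W) (hWc : HasCompactSupport W) :
    ∫ x, ψ x * fderiv ℝ W x (v x) ≤
      (a + (K * κ * (ρ * Real.exp (κ * ρ)) + K * (Real.exp (κ * ρ) - 1)))
        * ∫ x, ψ x * ‖fderiv ℝ W x‖ := by
  set Bx := {y : Euc d | ∀ i, y i ∈ Set.Icc (0:ℝ) L} with hBx
  have hBm : MeasurableSet Bx := box_meas d L
  have hBv : volume Bx = ENNReal.ofReal (L ^ d) := box_volume d L hL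
  have hBr : volume.real Bx = L ^ d := by
    rw [Measure.real, hBv, ENNReal.toReal_ofReal (by positivity)]
  have hfin : IsFiniteMeasure (volume.restrict Bx) := ⟨by
    rw [Measure.restrict_apply_univ, hBv]; exact ENNReal.ofReal_lt_top⟩
  set θ := K * κ * (ρ * Real.exp (κ * ρ)) + K * (Real.exp (κ * ρ) - 1) with hθ
  set I := ∫ x, ψ x * ‖fderiv ℝ W x‖ with hI
  set A := ∫ x, ψ x * fderiv ℝ W x (v x) with hA
  have hvm : Measurable v := hv.continuous.measurable
  have hψm : Measurable ψ := (hψ.lip hκ).continuous.measurable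
  have hLd : 0 < L ^ d := by positivity
  have hint : Integrable (Function.uncurry fun (y x : Euc d) => ψ x * fderiv ℝ W x (v (x + y)))
      ((volume.restrict Bx).prod volume) := by
    have h0 : Integrable (fun p : Euc d × Euc d => (1:ℝ) * ψ p.2) ((volume.restrict Bx).prod volume) :=
      (integrable_const (1:ℝ)).mul_prod hψ.integ
    simp only [one_mul] at h0
    have hm : Measurable fun p : Euc d × Euc d => fderiv ℝ W p.2 (v (p.2 + p.1)) := by
      have h2 : Measurable fun p : (Euc d →L[ℝ] ℝ) × Euc d => p.1 p.2 :=
        isBoundedBilinearMap_apply.continuous.measurable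
      have h3 : Measurable fun p : Euc d × Euc d => v (p.2 + p.1) := by fun_prop
      exact h2.comp (((measurable_fderiv ℝ W).comp measurable_snd).prodMk h3)
    refine h0.mul_bdd (c := Lg * K) hm.aestronglyMeasurable (Eventually.of_forall fun p => ?_)
    refine ((fderiv ℝ W p.2).le_opNorm _).trans ?_
    exact mul_le_mul (norm_fderiv_le_of_lipschitz ℝ hW) (hK _) (norm_nonneg _) (by positivity)
  have hswap : ∫ y in Bx, ∫ x, ψ x * fderiv ℝ W x (v (x + y))
      = ∫ x, ∫ y in Bx, ψ x * fderiv ℝ W x (v (x + y)) := integral_integral_swap hint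
  have hin : ∀ x, ∫ y in Bx, ψ x * fderiv ℝ W x (v (x + y))
      = ψ x * fderiv ℝ W x (∫ y in Bx, v (x + y)) := fun x => by
    rw [integral_const_mul]
    congr 1
    refine ContinuousLinearMap.integral_comp_comm _ ?_
    have hm : Measurable fun y => v (x + y) := by fun_prop
    exact Integrable.of_bound hm.aestronglyMeasurable K (Eventually.of_forall fun y => hK _)
  have hup : ∫ y in Bx, ∫ x, ψ x * fderiv ℝ W x (v (x + y)) ≤ L ^ d * a * I := by
    have h0 : Integrable fun x => ∫ y in Bx, ψ x * fderiv ℝ W x (v (x + y)) :=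
      hint.integral_prod_right
    rw [hswap, hI, ← integral_const_mul]
    refine integral_mono h0 ((hψ.int_fd hW).const_mul _) fun x => ?_
    simp only [hin]
    have h1 : ‖∫ y in Bx, v (x + y)‖ ≤ L ^ d * a := by
      have := havg x
      rw [norm_smul, Real.norm_eq_abs, abs_of_pos (by positivity), inv_mul_le_iff₀ hLd] at this
      exact this
    have h2 : fderiv ℝ W x (∫ y in Bx, v (x + y)) ≤ ‖fderiv ℝ W x‖ * (L ^ d * a) :=
      (le_abs_self _).trans (((fderiv ℝ W x).le_opNorm _).trans
        (mul_le_mul_of_nonneg_left h1 (norm_nonneg _)))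
    refine (mul_le_mul_of_nonneg_left h2 (hψ.pos x).le).trans (le_of_eq (by ring))
  have hlow : L ^ d * (A - θ * I) ≤ ∫ y in Bx, ∫ x, ψ x * fderiv ℝ W x (v (x + y)) := by
    have : L ^ d * (A - θ * I) = ∫ y in Bx, (A - θ * I) := by
      rw [setIntegral_const, hBr, smul_eq_mul]
    rw [this]
    refine setIntegral_mono_on (integrable_const _) hint.integral_prod_left hBm fun y hy => ?_
    have := flux_shift hκ hψ hv hK hdiv hW hWc ((box_norm hL hy).trans hρ)
    linarith
  have := hlow.trans hup
  rw [mul_assoc] at this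
  have := le_of_mul_le_mul_left this hLd
  linarith

/-- Sup-convolution along the flow. -/
def Us {d : ℕ} (v : Euc d → Euc d) (b : ℝ) (w : Euc d → ℝ) (s : ℝ) (x : Euc d) : ℝ :=
  ⨆ e : closedBall (0 : Euc d) 1, w (x - s • (v x + b • (e : Euc d)))

section Us
variable {d : ℕ} {v : Euc d → Euc d} {b K : ℝ} {w : Euc d → ℝ} {Lv Lw : NNReal}

instance : Nonempty (closedBall (0 : Euc d) 1) := ⟨⟨0, by simp⟩⟩

theorem Us_bdd (h1 : ∀ x, w x ≤ 1) (s : ℝ) (x : Euc d) :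
    BddAbove (Set.range fun e : closedBall (0 : Euc d) 1 => w (x - s • (v x + b • (e : Euc d)))) :=
  ⟨1, by rintro _ ⟨e, rfl⟩; exact h1 _⟩

theorem le_Us (h1 : ∀ x, w x ≤ 1) (s : ℝ) (x e : Euc d) (he : ‖e‖ ≤ 1) :
    w (x - s • (v x + b • e)) ≤ Us v b w s x :=
  le_ciSup (Us_bdd h1 s x) ⟨e, by simpa using he⟩

theorem Us_le {s : ℝ} {x : Euc d} {r : ℝ} (h : ∀ e : Euc d, ‖e‖ ≤ 1 → w (x - s • (v x + b • e)) ≤ r) :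
    Us v b w s x ≤ r :=
  ciSup_le fun e => h e (mem_closedBall_zero_iff.1 e.2)

theorem Us_nonneg (h1 : ∀ x, w x ≤ 1) (h0 : ∀ x, 0 ≤ w x) (s : ℝ) (x : Euc d) :
    0 ≤ Us v b w s x := (h0 _).trans (le_Us h1 s x 0 (by simp))

theorem Us_le_one (h1 : ∀ x, w x ≤ 1) (s : ℝ) (x : Euc d) : Us v b w s x ≤ 1 :=
  Us_le fun _ _ => h1 _

theorem Us_zero (x : Euc d) : Us v b w 0 x = w x := by
  simp [Us]

theorem Us_lip_aux (hw : LipschitzWith Lw w) (x y : Euc d) : w x ≤ w y + Lw * ‖x - y‖ := by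
  have := hw.dist_le_mul x y
  rw [Real.dist_eq, dist_eq_norm] at this
  linarith [le_abs_self (w x - w y)]

theorem Us_lip (hw : LipschitzWith Lw w) (h1 : ∀ x, w x ≤ 1) (hv : LipschitzWith Lv v) {s : ℝ}
    (hs : 0 ≤ s) : LipschitzWith (Lw * (1 + s.toNNReal * Lv)) (Us v b w s) := by
  have key : ∀ x y, Us v b w s x ≤ Us v b w s y + Lw * (1 + s * Lv) * ‖x - y‖ := by
    intro x y
    refine Us_le fun e he => ?_
    have h2 := Us_lip_aux hw (x - s • (v x + b • e)) (y - s • (v y + b • e))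
    have h3 := le_Us (v := v) (b := b) h1 s y e he
    have h4 : ‖x - s • (v x + b • e) - (y - s • (v y + b • e))‖ ≤ (1 + s * Lv) * ‖x - y‖ := by
      have : x - s • (v x + b • e) - (y - s • (v y + b • e)) = (x - y) - s • (v x - v y) := by
        simp only [smul_add, smul_sub]; abel
      rw [this]
      refine (norm_sub_le _ _).trans ?_
      rw [norm_smul, Real.norm_eq_abs, abs_of_nonneg hs]
      have h5 := hv.dist_le_mul x y
      rw [dist_eq_norm, dist_eq_norm] at h5
      nlinarith [mul_le_mul_of_nonneg_left h5 hs]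
    have := mul_le_mul_of_nonneg_left h4 Lw.coe_nonneg
    linarith
  refine LipschitzWith.of_dist_le_mul fun x y => ?_
  rw [Real.dist_eq, dist_eq_norm]
  push_cast
  rw [Real.coe_toNNReal _ hs, abs_le]
  have a1 := key x y
  have a2 := key y x
  rw [norm_sub_rev] at a2
  constructor <;> linarith

theorem Us_time (hw : LipschitzWith Lw w) (h1 : ∀ x, w x ≤ 1) (hK : ∀ x, ‖v x‖ ≤ K) (hb : 0 ≤ b)
    (s s' : ℝ) (x : Euc d) : |Us v b w s x - Us v b w s' x| ≤ Lw * (K + b) * |s - s'| := by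
  have key : ∀ s s', Us v b w s x ≤ Us v b w s' x + Lw * (K + b) * |s - s'| := by
    intro s s'
    refine Us_le fun e he => ?_
    have h2 := Us_lip_aux hw (x - s • (v x + b • e)) (x - s' • (v x + b • e))
    have h3 := le_Us (v := v) (b := b) h1 s' x e he
    have h4 : ‖x - s • (v x + b • e) - (x - s' • (v x + b • e))‖ ≤ (K + b) * |s - s'| := by
      have : x - s • (v x + b • e) - (x - s' • (v x + b • e)) = -((s - s') • (v x + b • e)) := by
        rw [sub_smul]; abel
      rw [this, norm_neg, norm_smul, Real.norm_eq_abs, mul_comm]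
      refine mul_le_mul_of_nonneg_right ?_ (abs_nonneg _)
      refine (norm_add_le _ _).trans (add_le_add (hK x) ?_)
      rw [norm_smul, Real.norm_eq_abs, abs_of_nonneg hb]
      exact mul_le_of_le_one_right hb he
    have := mul_le_mul_of_nonneg_left h4 Lw.coe_nonneg
    linarith
  have a1 := key s s'
  have a2 := key s' s
  rw [abs_sub_comm] at a2
  rw [abs_le]
  constructor <;> linarith

theorem Us_supp (hw : HasCompactSupport w) (h1 : ∀ x, w x ≤ 1) (h0 : ∀ x, 0 ≤ w x)
    (hK : ∀ x, ‖v x‖ ≤ K) (hb : 0 ≤ b) {s : ℝ} (hs : 0 ≤ s) : HasCompactSupport (Us v b w s) := by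
  obtain ⟨R, hR⟩ := hw.isCompact.isBounded.subset_closedBall (0 : Euc d)
  refine HasCompactSupport.intro (isCompact_closedBall (0 : Euc d) (R + s * (K + b))) fun x hx => ?_
  refine le_antisymm (Us_le fun e he => ?_) (Us_nonneg h1 h0 s x)
  refine le_of_eq (image_eq_zero_of_notMem_tsupport fun hm => hx ?_)
  have := hR hm
  rw [mem_closedBall_zero_iff] at *
  have h2 : x = (x - s • (v x + b • e)) + s • (v x + b • e) := by abel
  rw [h2]
  refine (norm_add_le _ _).trans (add_le_add this ?_)
  rw [norm_smul, Real.norm_eq_abs, abs_of_nonneg hs]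
  refine mul_le_mul_of_nonneg_left ((norm_add_le _ _).trans (add_le_add (hK x) ?_)) hs
  rw [norm_smul, Real.norm_eq_abs, abs_of_nonneg hb]
  exact mul_le_of_le_one_right hb he

theorem Us_semi (h1 : ∀ x, w x ≤ 1) (hv : LipschitzWith Lv v) (hK : ∀ x, ‖v x‖ ≤ K)
    {b' : ℝ} (hb' : 0 ≤ b') (hb : 0 < b) {s r : ℝ} (hs : 0 ≤ s) (hr : 0 < r)
    (hsm : s * Lv * (K + b') ≤ b - b') (x e : Euc d) (he : ‖e‖ ≤ 1) :
    Us v b w s (x - r • (v x + b' • e)) ≤ Us v b w (s + r) x := by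
  refine Us_le fun e' he' => ?_
  set x' := x - r • (v x + b' • e) with hx'
  let q := r • b' • e + s • b • e' + s • (v x' - v x)
  have hq : ‖q‖ ≤ (s + r) * b := by
    have a1 : ‖r • b' • e‖ ≤ r * b' := by
      rw [norm_smul, norm_smul, Real.norm_eq_abs, Real.norm_eq_abs, abs_of_pos hr, abs_of_nonneg hb']
      exact mul_le_mul_of_nonneg_left (mul_le_of_le_one_right hb' he) hr.le
    have a2 : ‖s • b • e'‖ ≤ s * b := by
      rw [norm_smul, norm_smul, Real.norm_eq_abs, Real.norm_eq_abs, abs_of_nonneg hs, abs_of_pos hb]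
      exact mul_le_mul_of_nonneg_left (mul_le_of_le_one_right hb.le he') hs
    have a3 : ‖s • (v x' - v x)‖ ≤ s * (Lv * (r * (K + b'))) := by
      rw [norm_smul, Real.norm_eq_abs, abs_of_nonneg hs]
      refine mul_le_mul_of_nonneg_left ?_ hs
      have := hv.dist_le_mul x' x
      rw [dist_eq_norm, dist_eq_norm] at this
      refine this.trans (mul_le_mul_of_nonneg_left ?_ Lv.coe_nonneg)
      rw [hx', sub_sub_cancel_left, norm_neg, norm_smul, Real.norm_eq_abs, abs_of_pos hr]
      refine mul_le_mul_of_nonneg_left ((norm_add_le _ _).trans (add_le_add (hK x) ?_)) hr.le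
      rw [norm_smul, Real.norm_eq_abs, abs_of_nonneg hb']
      exact mul_le_of_le_one_right hb' he
    have a4 := norm_add₃_le (a := r • b' • e) (b := s • b • e') (c := s • (v x' - v x))
    have a5 := mul_le_mul_of_nonneg_left hsm hr.le
    show ‖r • b' • e + s • b • e' + s • (v x' - v x)‖ ≤ _
    nlinarith
  have hsr : 0 < s + r := by linarith
  have hpos : 0 < (s + r) * b := by positivity
  have h3 := le_Us (v := v) (b := b) h1 (s + r) x (((s + r) * b)⁻¹ • q) (by
    rw [norm_smul, Real.norm_eq_abs, abs_of_pos (by positivity), inv_mul_le_iff₀ hpos, mul_one]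
    exact hq)
  convert h3 using 2
  have h4 : (s + r) • (v x + b • ((s + r) * b)⁻¹ • q) = (s + r) • v x + q := by
    rw [smul_add, smul_smul, smul_smul, mul_inv_cancel₀ hpos.ne', one_smul]
  rw [h4]
  simp only [q]
  generalize v x' = vx
  rw [hx']
  simp only [smul_add, smul_sub, add_smul]
  abel

end Us

/-- Growth of `∫ ψ U_s` (L5). -/
theorem Us_growth {d : ℕ} {κ : ℝ} (hκ : 0 ≤ κ) {ψ : Euc d → ℝ} (hψ : Wt κ ψ)
    {v : Euc d → Euc d} {Lv : NNReal} (hv : LipschitzWith Lv v) {K : ℝ} (hK : ∀ x, ‖v x‖ ≤ K)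
    {w : Euc d → ℝ} {Lw : NNReal} (hw : LipschitzWith Lw w) (h1 : ∀ x, w x ≤ 1) (h0 : ∀ x, 0 ≤ w x)
    {b b' : ℝ} (hb' : 0 ≤ b') (hb : 0 < b) {h : ℝ}
    (hsm : h * Lv * (K + b') ≤ b - b') {m s0 : ℝ} (hs0 : 0 ≤ s0) (hsh : s0 ≤ h)
    (hm : ∀ s ∈ Set.Ico s0 h, m ≤ ∫ x, ψ x * (b' * ‖fderiv ℝ (Us v b w s) x‖
      - fderiv ℝ (Us v b w s) x (v x))) :
    (∫ x, ψ x * Us v b w s0 x) + m * (h - s0) ≤ ∫ x, ψ x * Us v b w h x := by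
  have hK0 : 0 ≤ K := (norm_nonneg _).trans (hK 0)
  have hvm : Measurable v := hv.continuous.measurable
  have hψm : Measurable ψ := (hψ.lip hκ).continuous.measurable
  set F : ℝ → ℝ := fun s => ∫ x, ψ x * Us v b w s x with hF
  have hUm : ∀ s, 0 ≤ s → Continuous (Us v b w s) := fun s hs => (Us_lip hw h1 hv hs).continuous
  have hUi : ∀ s, 0 ≤ s → Integrable fun x => ψ x * Us v b w s x := fun s hs =>
    hψ.int_mul (hUm s hs).aestronglyMeasurable (C := 1) fun x => by
      rw [abs_of_nonneg (Us_nonneg h1 h0 s x)]; exact Us_le_one h1 s x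
  have hFc : ContinuousOn F (Set.Icc s0 h) := by
    have : LipschitzOnWith (∫ x, ψ x * (Lw * (K + b))).toNNReal F (Set.Icc s0 h) := by
      refine LipschitzOnWith.of_dist_le_mul fun s hs s' hs' => ?_
      have hs := hs0.trans hs.1
      have hs' := hs0.trans hs'.1
      rw [Real.coe_toNNReal _ (integral_nonneg fun x => by
        have := (hψ.pos x).le; show 0 ≤ _; positivity), Real.dist_eq, Real.dist_eq, hF]
      simp only
      rw [← integral_sub (hUi s hs) (hUi s' hs'), ← integral_mul_const, ← Real.norm_eq_abs]
      refine norm_integral_le_of_norm_le ((hψ.integ.mul_const _).mul_const _)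
        (Eventually.of_forall fun x => ?_)
      rw [← mul_sub, norm_mul, Real.norm_eq_abs, abs_of_pos (hψ.pos x), Real.norm_eq_abs, mul_assoc]
      exact mul_le_mul_of_nonneg_left (Us_time hw h1 hK hb.le s s' x) (hψ.pos x).le
    exact this.continuousOn
  have main := image_le_of_liminf_slope_right_le_deriv_boundary (f := fun s => - F s)
    (a := s0) (b := h) hFc.neg (B := fun s => - F s0 - m * (s - s0)) (B' := fun _ => -m)
    (by simp) (by fun_prop) (fun x _ => by
      have : HasDerivAt (fun s => - F s0 - m * (s - s0)) (-m) x := by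
        have := (((hasDerivAt_id x).sub_const s0).const_mul m).const_sub (-F s0)
        simpa using this
      exact this.hasDerivWithinAt) ?_
  · have := main (Set.right_mem_Icc.2 hsh)
    linarith
  intro s hs r hr
  have hs' : 0 ≤ s := hs0.trans hs.1
  have hsmall : s * Lv * (K + b') ≤ b - b' := by
    refine le_trans ?_ hsm
    have := hs.2.le
    gcongr
  set U := Us v b w s with hU
  have hUl := Us_lip (b := b) hw h1 hv hs'
  rw [← hU] at hUl
  set LU := (Lw * (1 + s.toNNReal * Lv)) with hLU
  -- measurable choice of direction
  let gr : Euc d → Euc d := fun x => (InnerProductSpace.toDual ℝ (Euc d)).symm (fderiv ℝ U x)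
  have hgrm : Measurable gr :=
    (InnerProductSpace.toDual ℝ (Euc d)).symm.continuous.measurable.comp (measurable_fderiv ℝ U)
  have hgr : ∀ x y, fderiv ℝ U x y = inner ℝ (gr x) y := fun x y =>
    (InnerProductSpace.toDual_symm_apply (x := y) (y := fderiv ℝ U x)).symm
  have hgrn : ∀ x, ‖gr x‖ = ‖fderiv ℝ U x‖ := fun x => LinearIsometryEquiv.norm_map _ _
  let e : Euc d → Euc d := fun x => -(‖gr x‖⁻¹ • gr x)
  have hem : Measurable e := by fun_prop
  have he1 : ∀ x, ‖e x‖ ≤ 1 := fun x => by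
    simp only [e, norm_neg, norm_smul, norm_inv, norm_norm]
    exact inv_mul_le_one
  have hee : ∀ x, fderiv ℝ U x (e x) = - ‖fderiv ℝ U x‖ := fun x => by
    rw [hgr, ← hgrn]
    simp only [e, inner_neg_right, inner_smul_right, real_inner_self_eq_norm_sq]
    rcases eq_or_ne ‖gr x‖ 0 with h | h
    · simp [h]
    · field_simp
  let u : Euc d → Euc d := fun x => -(v x + b' • e x)
  have hum : Measurable u := by fun_prop
  have hun : ∀ x, ‖u x‖ ≤ K + b' := fun x => by
    simp only [u, norm_neg]
    refine (norm_add_le _ _).trans (add_le_add (hK x) ?_)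
    rw [norm_smul, Real.norm_eq_abs, abs_of_nonneg hb']
    exact mul_le_of_le_one_right hb' (he1 x)
  have hbd : ∀ (δ : ℝ) x, |δ⁻¹ • (U (x + δ • u x) - U x)| ≤ LU * (K + b') := by
    intro δ x
    rw [smul_eq_mul, abs_mul, abs_inv]
    have a1 := hUl.dist_le_mul (x + δ • u x) x
    rw [Real.dist_eq, dist_eq_norm, add_sub_cancel_left, norm_smul, Real.norm_eq_abs] at a1
    rcases eq_or_ne δ 0 with h | h
    · simp [h]; positivity
    · rw [inv_mul_le_iff₀ (abs_pos.2 h)]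
      refine a1.trans ?_
      have := mul_le_mul_of_nonneg_left (hun x) (abs_nonneg δ)
      have := mul_le_mul_of_nonneg_left this LU.coe_nonneg
      nlinarith
  have hqm : ∀ δ : ℝ, AEStronglyMeasurable (fun x => δ⁻¹ • (U (x + δ • u x) - U x)) volume := by
    intro δ
    have : Measurable U := hUl.continuous.measurable
    have h2 : Measurable fun x => x + δ • u x := by fun_prop
    have h4 : Measurable fun x => U (x + δ • u x) := this.comp h2
    have h3 : Measurable fun x => δ⁻¹ • (U (x + δ • u x) - U x) := by fun_prop
    exact h3.aestronglyMeasurable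
  have hlim : Tendsto (fun δ : ℝ => ∫ x, ψ x * (δ⁻¹ • (U (x + δ • u x) - U x))) (nhdsWithin 0 (Set.Ioi 0))
      (nhds (∫ x, ψ x * (b' * ‖fderiv ℝ U x‖ - fderiv ℝ U x (v x)))) := by
    refine tendsto_integral_filter_of_dominated_convergence (fun x => ψ x * (LU * (K + b')))
      (Eventually.of_forall fun δ => hψ.meas_of_cont.mul (hqm δ))
      (Eventually.of_forall fun δ => Eventually.of_forall fun x => ?_)
      (hψ.integ.mul_const _) ?_
    · rw [norm_mul, Real.norm_eq_abs, abs_of_pos (hψ.pos x)]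
      exact mul_le_mul_of_nonneg_left (hbd δ x) (hψ.pos x).le
    · filter_upwards [hUl.ae_differentiableAt] with x hx
      refine Tendsto.const_mul _ ?_
      have := (hx.hasFDerivAt.hasLineDerivAt (u x)).tendsto_slope_zero_right
      convert this using 2
      simp only [u, map_neg, map_add, map_smul, hee, smul_eq_mul]
      ring
  have hmr : -r < ∫ x, ψ x * (b' * ‖fderiv ℝ U x‖ - fderiv ℝ U x (v x)) := by
    have := hm s hs; linarith
  have hev := hlim.eventually (lt_mem_nhds hmr)
  have hmap : Tendsto (fun z => z - s) (nhdsWithin s (Set.Ioi s)) (nhdsWithin 0 (Set.Ioi 0)) := by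
    refine tendsto_nhdsWithin_iff.2 ⟨?_, ?_⟩
    · have : Continuous fun z : ℝ => z - s := by fun_prop
      have := this.tendsto s
      rw [sub_self] at this
      exact this.mono_left nhdsWithin_le_nhds
    · filter_upwards [self_mem_nhdsWithin] with z hz
      exact Set.mem_Ioi.2 (sub_pos.2 (Set.mem_Ioi.1 hz))
  refine Eventually.frequently ?_
  filter_upwards [hmap.eventually hev, self_mem_nhdsWithin] with z hz hzs
  have hδ : 0 < z - s := sub_pos.2 (Set.mem_Ioi.1 hzs)
  set δ := z - s with hδd
  have hz' : z = s + δ := by rw [hδd]; ring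
  rw [slope_def_field, ← hδd, div_lt_iff₀ hδ]
  have hle : ∫ x, ψ x * (δ⁻¹ • (U (x + δ • u x) - U x)) ≤ δ⁻¹ * (F z - F s) := by
    rw [hF]
    simp only
    rw [← integral_sub (hUi z (hz' ▸ by positivity)) (hUi s hs'), ← integral_const_mul]
    refine integral_mono (hψ.int_mul (hqm δ) (hbd δ))
      (((hUi z (hz' ▸ by positivity)).sub (hUi s hs')).const_mul _) fun x => ?_
    show ψ x * (δ⁻¹ • (U (x + δ • u x) - U x)) ≤ δ⁻¹ * (ψ x * Us v b w z x - ψ x * U x)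
    have a1 := Us_semi (w := w) h1 hv hK hb' hb hs' hδ hsmall x (e x) (he1 x)
    have a2 : x - δ • (v x + b' • e x) = x + δ • u x := by simp only [u, smul_neg]; abel
    rw [a2, ← hz', ← hU] at a1
    rw [smul_eq_mul, ← mul_sub, ← mul_assoc, ← mul_assoc, mul_comm (ψ x)]
    exact mul_le_mul_of_nonneg_left (by linarith) (mul_nonneg (by positivity) (hψ.pos x).le)
  have := hz.trans_le hle
  rw [lt_inv_mul_iff₀ hδ] at this
  linarith

/-- One step of the frozen control flow. -/
def TT {d : ℕ} (v : Euc d → Euc d) (b s : ℝ) (A : Set (Euc d)) : Set (Euc d) :=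
  {x | ∃ e : Euc d, ‖e‖ ≤ 1 ∧ x - s • (v x + b • e) ∈ A}

theorem TT_open {d : ℕ} {v : Euc d → Euc d} (hv : Continuous v) (b s : ℝ) {A : Set (Euc d)}
    (hA : IsOpen A) : IsOpen (TT v b s A) := by
  have : TT v b s A = ⋃ e : Euc d, ⋃ _ : ‖e‖ ≤ 1, (fun x => x - s • (v x + b • e)) ⁻¹' A := by
    ext x; simp [TT]
  rw [this]
  refine isOpen_iUnion fun e => isOpen_iUnion fun _ => hA.preimage (by fun_prop)

theorem TT_bdd {d : ℕ} {v : Euc d → Euc d} {K : ℝ} (hK : ∀ x, ‖v x‖ ≤ K) {b s : ℝ}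
    {A : Set (Euc d)} (hA : Bornology.IsBounded A) : Bornology.IsBounded (TT v b s A) := by
  obtain ⟨R, hR⟩ := hA.subset_closedBall (0 : Euc d)
  refine (isBounded_closedBall (x := (0 : Euc d)) (r := R + |s| * (K + |b|))).subset ?_
  rintro x ⟨e, he, hx⟩
  have := hR hx
  rw [mem_closedBall_zero_iff] at *
  have h2 : x = (x - s • (v x + b • e)) + s • (v x + b • e) := by abel
  rw [h2]
  refine (norm_add_le _ _).trans (add_le_add this ?_)
  rw [norm_smul, Real.norm_eq_abs]
  refine mul_le_mul_of_nonneg_left ((norm_add_le _ _).trans (add_le_add (hK x) ?_)) (abs_nonneg _)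
  rw [norm_smul, Real.norm_eq_abs]
  exact mul_le_of_le_one_right (abs_nonneg _) he

/-- The `ψ`-mass. -/
def mu {d : ℕ} (ψ : Euc d → ℝ) (A : Set (Euc d)) : ℝ := ∫ x in A, ψ x

theorem mu_mono {d : ℕ} {κ : ℝ} {ψ : Euc d → ℝ} (hψ : Wt κ ψ) {A B : Set (Euc d)} (h : A ⊆ B) :
    mu ψ A ≤ mu ψ B :=
  setIntegral_mono_set hψ.integ.integrableOn (Eventually.of_forall fun x => (hψ.pos x).le)
    (Eventually.of_forall h)

theorem mu_eq {d : ℕ} {ψ : Euc d → ℝ} {A : Set (Euc d)} (hA : MeasurableSet A) :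
    mu ψ A = ∫ x, ψ x * A.indicator (fun _ => (1:ℝ)) x := by
  rw [mu, ← integral_indicator hA]
  congr 1; funext x
  by_cases hx : x ∈ A <;> simp [hx]

/-- inner approximations -/
def inr {d : ℕ} (A : Set (Euc d)) (n : ℕ) : Set (Euc d) := {x | 1 / ((n:ℝ) + 1) < infDist x Aᶜ}

theorem inr_open {d : ℕ} (A : Set (Euc d)) (n : ℕ) : IsOpen (inr A n) :=
  isOpen_lt continuous_const (continuous_infDist_pt _)

theorem inr_sub {d : ℕ} (A : Set (Euc d)) (n : ℕ) : inr A n ⊆ A := by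
  intro x hx
  by_contra hc
  have : infDist x Aᶜ = 0 := infDist_zero_of_mem hc
  simp only [inr, Set.mem_ofPred_eq, this] at hx
  have : (0:ℝ) < 1 / ((n:ℝ) + 1) := by positivity
  linarith

theorem inr_tendsto {d : ℕ} {κ : ℝ} {ψ : Euc d → ℝ} (hψ : Wt κ ψ) {A : Set (Euc d)}
    (hA : IsOpen A) (hne : Aᶜ.Nonempty) :
    Tendsto (fun n => mu ψ (inr A n)) atTop (nhds (mu ψ A)) := by
  have hU : ⋃ n, inr A n = A := by
    refine Set.Subset.antisymm (Set.iUnion_subset fun n => inr_sub A n) fun x hx => ?_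
    have hpos : 0 < infDist x Aᶜ := by
      rw [← hA.isClosed_compl.notMem_iff_infDist_pos hne]
      simpa using hx
    obtain ⟨n, hn⟩ := exists_nat_one_div_lt hpos
    exact Set.mem_iUnion.2 ⟨n, hn⟩
  have := tendsto_setIntegral_of_monotone (μ := volume) (f := ψ) (s := inr A)
    (fun n => (inr_open A n).measurableSet)
    (fun i j hij x hx => lt_of_le_of_lt (by
      have : (i:ℝ) ≤ j := by exact_mod_cast hij
      gcongr) (show 1 / ((i:ℝ) + 1) < infDist x Aᶜ from hx)) hψ.integ.integrableOn
  rwa [hU] at this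

/-- cutoff -/
def cut {d : ℕ} (A : Set (Euc d)) (n : ℕ) (x : Euc d) : ℝ := min 1 (((n:ℝ) + 1) * infDist x Aᶜ)

theorem cut_lip {d : ℕ} (A : Set (Euc d)) (n : ℕ) : LipschitzWith (n + 1) (cut A n) := by
  have h1 : LipschitzWith (n + 1) fun x : Euc d => ((n:ℝ) + 1) * infDist x Aᶜ := by
    refine LipschitzWith.of_dist_le_mul fun x y => ?_
    have := (lipschitz_infDist_pt Aᶜ).dist_le_mul x y
    rw [Real.dist_eq] at *
    rw [← mul_sub, abs_mul, abs_of_pos (by positivity)]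
    push_cast
    simp only [NNReal.coe_one, one_mul] at this
    gcongr
  exact h1.const_min 1

theorem cut_nonneg {d : ℕ} (A : Set (Euc d)) (n : ℕ) (x : Euc d) : 0 ≤ cut A n x :=
  le_min zero_le_one (mul_nonneg (by positivity) infDist_nonneg)

theorem cut_le_one {d : ℕ} (A : Set (Euc d)) (n : ℕ) (x : Euc d) : cut A n x ≤ 1 := min_le_left _ _

theorem cut_out {d : ℕ} {A : Set (Euc d)} (n : ℕ) {x : Euc d} (hx : x ∉ A) : cut A n x = 0 := by
  have : infDist x Aᶜ = 0 := infDist_zero_of_mem hx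
  simp [cut, this]

theorem cut_in {d : ℕ} {A : Set (Euc d)} (n : ℕ) {x : Euc d} (hx : x ∈ inr A n) : cut A n x = 1 := by
  refine min_eq_left ?_
  have h : 1 / ((n:ℝ) + 1) < infDist x Aᶜ := hx
  rw [div_lt_iff₀ (by positivity)] at h
  linarith

theorem cut_supp {d : ℕ} {A : Set (Euc d)} (hA : Bornology.IsBounded A) (n : ℕ) :
    HasCompactSupport (cut A n) := by
  obtain ⟨R, hR⟩ := hA.subset_closedBall (0 : Euc d)
  exact HasCompactSupport.intro (isCompact_closedBall (0 : Euc d) R) fun x hx =>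
    cut_out n fun h => hx (hR h)

section step
variable {d : ℕ} {κ : ℝ} {ψ : Euc d → ℝ} {v : Euc d → Euc d} {Lv : NNReal} {K b b' β h : ℝ}

theorem Us_le_mu (hψ : Wt κ ψ) (hv : LipschitzWith Lv v) (A : Set (Euc d)) (hA : IsOpen A)
    (n : ℕ) {s : ℝ} (hs : 0 ≤ s) (b : ℝ) :
    ∫ x, ψ x * Us v b (cut A n) s x ≤ mu ψ (TT v b s A) := by
  have hTm := (TT_open hv.continuous b s hA).measurableSet
  rw [mu_eq hTm]
  refine integral_mono (hψ.int_mul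
    (Us_lip (cut_lip A n) (cut_le_one A n) hv hs).continuous.aestronglyMeasurable (C := 1)
    fun x => ?_) (hψ.int_mul (measurable_const.indicator hTm).aestronglyMeasurable (C := 1)
      fun x => ?_) fun x => ?_
  · rw [abs_of_nonneg (Us_nonneg (cut_le_one A n) (cut_nonneg A n) s x)]
    exact Us_le_one (cut_le_one A n) s x
  · by_cases hx : x ∈ TT v b s A <;> simp [hx]
  · refine mul_le_mul_of_nonneg_left ?_ (hψ.pos x).le
    by_cases hx : x ∈ TT v b s A
    · simp only [hx, Set.indicator_of_mem]
      exact Us_le_one (cut_le_one A n) s x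
    · simp only [hx, not_false_eq_true, Set.indicator_of_notMem]
      exact Us_le fun e he => (cut_out n fun hc => hx ⟨e, he, hc⟩).le

theorem mu_le_cut (hψ : Wt κ ψ) (A : Set (Euc d)) (n : ℕ) :
    mu ψ (inr A n) ≤ ∫ x, ψ x * cut A n x := by
  have hTm := (inr_open A n).measurableSet
  rw [mu_eq hTm]
  refine integral_mono (hψ.int_mul (measurable_const.indicator hTm).aestronglyMeasurable (C := 1)
      fun x => ?_) (hψ.int_mul (cut_lip A n).continuous.aestronglyMeasurable (C := 1)
    fun x => ?_) fun x => ?_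
  · by_cases hx : x ∈ inr A n <;> simp [hx]
  · rw [abs_of_nonneg (cut_nonneg A n x)]
    exact cut_le_one A n x
  · refine mul_le_mul_of_nonneg_left ?_ (hψ.pos x).le
    by_cases hx : x ∈ inr A n
    · simp [hx, cut_in]
    · simp only [hx, not_false_eq_true, Set.indicator_of_notMem]
      exact cut_nonneg A n x

variable (hκ : 0 ≤ κ) (hψ : Wt κ ψ) (hv : LipschitzWith Lv v) (hK : ∀ x, ‖v x‖ ≤ K)
  (hb' : 0 ≤ b') (hb : 0 < b) (hβ : 0 ≤ β)
  (hflux : ∀ (W : Euc d → ℝ) (Lg : NNReal), LipschitzWith Lg W → HasCompactSupport W →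
    β * ∫ x, ψ x * ‖fderiv ℝ W x‖ ≤ ∫ x, ψ x * (b' * ‖fderiv ℝ W x‖ - fderiv ℝ W x (v x)))
  (hh : 0 ≤ h) (hsm : h * Lv * (K + b') ≤ b - b')
include hκ hψ hv hK hb' hb hβ hflux hh hsm

theorem step_aux (A : Set (Euc d)) (hAb : Bornology.IsBounded A) (n : ℕ) {s0 m : ℝ}
    (hs0 : 0 ≤ s0) (hs : s0 ≤ h)
    (hm : ∀ s ∈ Set.Ico s0 h, m ≤ β * ∫ x, ψ x * ‖fderiv ℝ (Us v b (cut A n) s) x‖) :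
    (∫ x, ψ x * Us v b (cut A n) s0 x) + m * (h - s0) ≤ ∫ x, ψ x * Us v b (cut A n) h x := by
  refine Us_growth hκ hψ hv hK (cut_lip A n) (cut_le_one A n) (cut_nonneg A n) hb' hb hsm hs0 hs
    fun s hs' => (hm s hs').trans ?_
  have h0 : 0 ≤ s := hs0.trans hs'.1
  exact hflux _ _ (Us_lip (cut_lip A n) (cut_le_one A n) hv h0)
    (Us_supp (cut_supp hAb n) (cut_le_one A n) (cut_nonneg A n) hK hb.le h0)

theorem step_mono (A : Set (Euc d)) (hA : IsOpen A) (hAb : Bornology.IsBounded A)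
    (hne : Aᶜ.Nonempty) : mu ψ A ≤ mu ψ (TT v b h A) := by
  refine le_of_tendsto' (inr_tendsto hψ hA hne) fun n => ?_
  refine (mu_le_cut hψ A n).trans (le_trans ?_ (Us_le_mu hψ hv A hA n hh b))
  have := step_aux hκ hψ hv hK hb' hb hβ hflux hh hsm A hAb n (s0 := 0) (m := 0) le_rfl hh
    fun s _ => mul_nonneg hβ
      (integral_nonneg fun x => mul_nonneg (hψ.pos x).le (norm_nonneg _))
  simpa [Us_zero] using this

theorem step_grow (A : Set (Euc d)) (hA : IsOpen A) (hAb : Bornology.IsBounded A)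
    (hne : ∀ B : Set (Euc d), Bornology.IsBounded B → Bᶜ.Nonempty)
    {C r σ : ℝ} (hC : 0 < C) (hP : ∀ (W : Euc d → ℝ) (Lg : NNReal), LipschitzWith Lg W →
      ∀ S1 : Set (Euc d), MeasurableSet S1 → S1 ⊆ ball 0 r → (∀ x ∈ S1, W x = 1) → (∀ x, W x ≤ 1) →
      volume S1 * ∫⁻ z in ball 0 r, ENNReal.ofReal (1 - W z)
        ≤ ENNReal.ofReal (C * ∫ x, ψ x * ‖fderiv ℝ W x‖))
    (hσ : mu ψ (ball 0 r)ᶜ = σ) (hσ1 : σ < mu ψ A) :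
    mu ψ A + h * (β / C) * ((mu ψ A - σ) * ((∫ x, ψ x) - σ - mu ψ (TT v b h A)))
      ≤ mu ψ (TT v b h A) := by
  set q := mu ψ (TT v b h A) with hq
  have hlim : Tendsto (fun n => mu ψ (inr A n) + h * (β / C) *
      ((mu ψ (inr A n) - σ) * ((∫ x, ψ x) - σ - q))) atTop
      (nhds (mu ψ A + h * (β / C) * ((mu ψ A - σ) * ((∫ x, ψ x) - σ - q)))) := by
    have := inr_tendsto hψ hA (hne A hAb)
    exact this.add (((this.sub_const σ).mul_const _).const_mul _)
  refine le_of_tendsto hlim ?_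
  filter_upwards [(inr_tendsto hψ hA (hne A hAb)).eventually (lt_mem_nhds hσ1)] with n hn
  set p := mu ψ (inr A n) with hp
  have hmono : ∀ s ∈ Set.Icc 0 h, ∫ x, ψ x * Us v b (cut A n) s x ≤ q := by
    intro s hs
    refine le_trans ?_ (Us_le_mu hψ hv A hA n hh b)
    have := step_aux hκ hψ hv hK hb' hb hβ hflux hh hsm A hAb n (s0 := s) (m := 0) hs.1 hs.2
      fun s _ => mul_nonneg hβ
        (integral_nonneg fun x => mul_nonneg (hψ.pos x).le (norm_nonneg _))
    simpa using this
  have key := step_aux hκ hψ hv hK hb' hb hβ hflux hh hsm A hAb n (s0 := 0)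
    (m := β * ((p - σ) * ((∫ x, ψ x) - σ - q) / C)) le_rfl hh ?_
  · simp only [Us_zero, sub_zero] at key
    have h1 := mu_le_cut hψ A n
    have h2 := hmono h ⟨hh, le_rfl⟩
    have h3 : β * ((p - σ) * ((∫ x, ψ x) - σ - q) / C) * h
      = h * (β / C) * ((p - σ) * ((∫ x, ψ x) - σ - q)) := by ring
    rw [h3] at key
    linarith
  intro s hs
  refine mul_le_mul_of_nonneg_left ?_ hβ
  set U := Us v b (cut A n) s with hU
  have hUl : LipschitzWith _ U := Us_lip (b := b) (cut_lip A n) (cut_le_one A n) hv hs.1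
  have hU1 : ∀ x, U x ≤ 1 := fun x => Us_le_one (cut_le_one A n) s x
  have hU0 : ∀ x, 0 ≤ U x := fun x => Us_nonneg (cut_le_one A n) (cut_nonneg A n) s x
  have hI0 : 0 ≤ ∫ x, ψ x * ‖fderiv ℝ U x‖ :=
    integral_nonneg fun x => mul_nonneg (hψ.pos x).le (norm_nonneg _)
  have hTo : IsOpen (TT v b s (inr A n)) := TT_open hv.continuous b s (inr_open A n)
  set S1 := TT v b s (inr A n) ∩ ball 0 r with hS1
  have hS1m : MeasurableSet S1 := hTo.measurableSet.inter measurableSet_ball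
  have hpo := hP U _ hUl S1 hS1m Set.inter_subset_right (by
    rintro x ⟨⟨e, he, hx⟩, -⟩
    refine le_antisymm (hU1 x) ?_
    have := le_Us (v := v) (b := b) (cut_le_one A n) s x e he
    rwa [cut_in n hx] at this) hU1
  have hψi := hψ.integ
  have hm1 : p - σ ≤ mu ψ S1 := by
    have a1 : p ≤ mu ψ (TT v b s (inr A n)) := by
      have hbd := hAb.subset (inr_sub A n)
      refine step_mono hκ hψ hv hK hb' hb hβ hflux hs.1 ?_ (inr A n) (inr_open A n) hbd
        (hne _ hbd)
      refine le_trans ?_ hsm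
      have : 0 ≤ K := (norm_nonneg _).trans (hK 0)
      have := hs.2.le
      gcongr
    have a2 : mu ψ (TT v b s (inr A n)) ≤ mu ψ S1 + mu ψ (ball 0 r)ᶜ := by
      have : TT v b s (inr A n) = S1 ∪ (TT v b s (inr A n) \ ball 0 r) := by
        rw [hS1, Set.inter_union_sdiff]
      have a3 : mu ψ (TT v b s (inr A n)) = mu ψ S1 + mu ψ (TT v b s (inr A n) \ ball 0 r) := by
        conv_lhs => rw [this]
        exact setIntegral_union (by
          rw [hS1]; exact Set.disjoint_left.2 fun x hx hx' => hx'.2 hx.2)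
          (hTo.measurableSet.diff measurableSet_ball) hψi.integrableOn hψi.integrableOn
      rw [a3]
      exact add_le_add_right (mu_mono hψ fun x hx => hx.2) _
    linarith
  have hv1 : ENNReal.ofReal (mu ψ S1) ≤ volume S1 := by
    rw [mu, ofReal_integral_eq_lintegral_ofReal hψi.integrableOn
      (Eventually.of_forall fun x => (hψ.pos x).le)]
    calc _ ≤ ∫⁻ x in S1, 1 := lintegral_mono fun x => by
            rw [← ENNReal.ofReal_one]; exact ENNReal.ofReal_le_ofReal (hψ.le_one x)
      _ = _ := by simp
  have hUm : Integrable fun x => ψ x * U x := hψ.int_mul hUl.continuous.aestronglyMeasurable (C := 1)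
      fun x => by rw [abs_of_nonneg (hU0 x)]; exact hU1 x
  have h1U : Integrable fun x => ψ x * (1 - U x) := by
    have := hψi.sub hUm
    refine this.congr (Eventually.of_forall fun x => ?_)
    show ψ x - ψ x * U x = _
    ring
  have hv2 : ENNReal.ofReal ((∫ x, ψ x) - σ - q) ≤ ∫⁻ z in ball 0 r, ENNReal.ofReal (1 - U z) := by
    have a1 : (∫ x, ψ x) - σ - q ≤ ∫ x in ball 0 r, ψ x * (1 - U x) := by
      have b1 : ∫ x, ψ x * (1 - U x) = (∫ x, ψ x) - ∫ x, ψ x * U x := by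
        rw [← integral_sub hψi hUm]
        congr 1; funext x; ring
      have b2 := integral_add_compl (measurableSet_ball (x := (0 : Euc d)) (ε := r)) h1U
      have b3 : ∫ x in (ball 0 r)ᶜ, ψ x * (1 - U x) ≤ σ := by
        rw [← hσ]
        refine setIntegral_mono h1U.integrableOn hψi.integrableOn fun x => ?_
        exact mul_le_of_le_one_right (hψ.pos x).le (by linarith [hU0 x])
      have b4 := hmono s ⟨hs.1, hs.2.le⟩
      linarith
    refine (ENNReal.ofReal_le_ofReal a1).trans ?_
    rw [ofReal_integral_eq_lintegral_ofReal h1U.integrableOn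
      (Eventually.of_forall fun x => mul_nonneg (hψ.pos x).le (sub_nonneg.2 (hU1 x)))]
    refine lintegral_mono fun x => ENNReal.ofReal_le_ofReal ?_
    exact mul_le_of_le_one_left (sub_nonneg.2 (hU1 x)) (hψ.le_one x)
  have hfin := (mul_le_mul' ((ENNReal.ofReal_le_ofReal hm1).trans hv1) hv2).trans hpo
  rw [← ENNReal.ofReal_mul (by linarith), ENNReal.ofReal_le_ofReal_iff (by positivity)] at hfin
  rw [div_le_iff₀ hC]
  linarith
end step

section basics
variable {d : ℕ} {c : ℝ → Euc d → ℝ} {v : ℝ → Euc d → Euc d}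

theorem Reachable.trans {t0 t1 t2 : ℝ} {x0 x1 x2 : Euc d} (h1 : Reachable c v t0 x0 t1 x1)
    (h2 : Reachable c v t1 x1 t2 x2) : Reachable c v t0 x0 t2 x2 := by
  obtain ⟨h01, γ, g, hg, hγ, hx1, hae⟩ := h1
  obtain ⟨h12, γ', g', hg', hγ', hx2, hae'⟩ := h2
  let G : ℝ → Euc d := fun s => if s ≤ t1 then g s else g' s
  let Γ : ℝ → Euc d := fun s => if s ≤ t1 then γ s else γ' s
  have hG1 : ∀ t ∈ Set.Icc t0 t1, Set.EqOn g G (Set.uIoc t0 t) := fun t ht s hs => by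
    rw [Set.uIoc_of_le ht.1] at hs
    simp [G, hs.2.trans ht.2]
  have hG2 : ∀ t ∈ Set.Icc t1 t2, Set.EqOn g' G (Set.uIoc t1 t) := fun t ht s hs => by
    rw [Set.uIoc_of_le ht.1] at hs
    simp [G, not_le.2 hs.1]
  have hi1 : IntervalIntegrable G volume t0 t1 := hg.congr (hG1 t1 ⟨h01, le_rfl⟩)
  have hi2 : IntervalIntegrable G volume t1 t2 := hg'.congr (hG2 t2 ⟨h12, le_rfl⟩)
  have hx1' : x1 = x0 + ∫ s in t0..t1, G s := by
    rw [← hx1, hγ t1 ⟨h01, le_rfl⟩]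
    congr 1
    exact intervalIntegral.integral_congr_ae (Eventually.of_forall fun s hs => hG1 t1 ⟨h01, le_rfl⟩ hs)
  have hΓ2 : ∀ t ∈ Set.Icc t1 t2, Γ t = γ' t := by
    intro t ht
    by_cases h : t ≤ t1
    · have : t = t1 := le_antisymm h ht.1
      subst this
      simp [Γ, hx1, hγ' t ⟨le_rfl, h12⟩]
    · simp [Γ, h]
  refine ⟨h01.trans h12, Γ, G, hi1.trans hi2, ?_, ?_, ?_⟩
  · intro t ht
    by_cases h : t ≤ t1
    · simp only [Γ, h, if_true]
      rw [hγ t ⟨ht.1, h⟩]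
      congr 1
      exact intervalIntegral.integral_congr_ae
        (Eventually.of_forall fun s hs => hG1 t ⟨ht.1, h⟩ hs)
    · push Not at h
      have ht' : t ∈ Set.Icc t1 t2 := ⟨h.le, ht.2⟩
      rw [hΓ2 t ht', hγ' t ht', hx1', add_assoc]
      congr 1
      have : IntervalIntegrable G volume t1 t :=
        hi2.mono_set (Set.uIcc_subset_uIcc_left (by rw [Set.uIcc_of_le h12]; exact ht'))
      rw [← intervalIntegral.integral_add_adjacent_intervals hi1 this]
      congr 1
      exact intervalIntegral.integral_congr_ae (Eventually.of_forall fun s hs => hG2 t ht' hs)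
  · rw [hΓ2 t2 ⟨h12, le_rfl⟩, hx2]
  · rw [ae_restrict_iff' measurableSet_Icc] at *
    filter_upwards [hae, hae'] with s hs hs' hm
    by_cases h : s ≤ t1
    · simp only [G, Γ, h, if_true]
      exact hs ⟨hm.1, h⟩
    · have := hs' ⟨(not_le.1 h).le, hm.2⟩
      simp only [G, Γ, h, if_false]
      exact this

theorem Reachable.line {t0 t1 : ℝ} (h : t0 ≤ t1) (x0 u : Euc d)
    (hu : ∀ s ∈ Set.Icc t0 t1, ‖u - v s (x0 + (s - t0) • u)‖ ≤ c s (x0 + (s - t0) • u)) :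
    Reachable c v t0 x0 t1 (x0 + (t1 - t0) • u) := by
  refine ⟨h, fun s => x0 + (s - t0) • u, fun _ => u, intervalIntegrable_const, ?_, rfl, ?_⟩
  · intro t _
    simp
  · rw [ae_restrict_iff' measurableSet_Icc]
    exact Eventually.of_forall hu

theorem Reachable.shift {t0 t1 s : ℝ} {x0 x1 y : Euc d}
    (h : Reachable (fun t x => c (t + s) (x + y)) (fun t x => v (t + s) (x + y)) t0 x0 t1 x1) :
    Reachable c v (t0 + s) (x0 + y) (t1 + s) (x1 + y) := by
  obtain ⟨h01, γ, g, hg, hγ, hx1, hae⟩ := h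
  refine ⟨by linarith, fun t => γ (t - s) + y, fun t => g (t - s), ?_, ?_, ?_, ?_⟩
  · exact hg.comp_sub_right s
  · intro t ht
    have : t - s ∈ Set.Icc t0 t1 := ⟨by linarith [ht.1], by linarith [ht.2]⟩
    simp only
    rw [hγ _ this, intervalIntegral.integral_comp_sub_right, add_sub_cancel_right]
    abel
  · simp [hx1]
  · rw [ae_restrict_iff' measurableSet_Icc] at *
    have := (measurePreserving_sub_right (volume : Measure ℝ) s).quasiMeasurePreserving.ae hae
    filter_upwards [this] with t ht hm
    have := ht ⟨by linarith [hm.1], by linarith [hm.2]⟩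
    simpa using this

theorem Reachable.refl (t0 : ℝ) (x0 : Euc d) : Reachable c v t0 x0 t0 x0 := by
  refine ⟨le_rfl, fun _ => x0, fun _ => 0, by simp, by
    intro t ht; have : t = t0 := le_antisymm ht.2 ht.1
    simp [this], rfl, ?_⟩
  simp

theorem Reachable.speed {K : ℝ} (hc : ∀ t x, c t x ≤ K) (hv : ∀ t x, ‖v t x‖ ≤ K)
    {t0 t1 : ℝ} {x0 x1 : Euc d} (h : Reachable c v t0 x0 t1 x1) :
    ‖x1 - x0‖ ≤ 2 * K * (t1 - t0) := by
  obtain ⟨h01, γ, g, hg, hγ, hx1, hae⟩ := h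
  rw [← hx1, hγ t1 ⟨h01, le_rfl⟩, add_sub_cancel_left]
  have := intervalIntegral.norm_integral_le_of_norm_le_const_ae (a := t0) (b := t1) (f := g)
    (C := 2 * K) ?_
  · rwa [abs_of_nonneg (by linarith)] at this
  rw [ae_restrict_iff' measurableSet_Icc] at hae
  filter_upwards [hae] with s hs hm
  rw [Set.uIoc_of_le h01] at hm
  have h1 := hs ⟨hm.1.le, hm.2⟩
  have h2 : g s = (g s - v s (γ s)) + v s (γ s) := by abel
  rw [h2]
  refine (norm_add_le _ _).trans ?_
  linarith [hc s (γ s), hv s (γ s)]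

end basics

theorem exists_wt (d : ℕ) {κ : ℝ} (hκ : 0 < κ) : ∃ ψ : Euc d → ℝ, Wt κ ψ := by
  set k := min 1 (κ / (d + 1)) with hk
  have hk0 : 0 < k := lt_min one_pos (by positivity)
  have hk1 : k ≤ 1 := min_le_left _ _
  have hkd : ((d:ℝ) + 1) * k ≤ κ := by
    have : k ≤ κ / (d + 1) := min_le_right _ _
    rw [le_div_iff₀ (by positivity)] at this
    linarith
  refine ⟨fun x => ((1 + k * ‖x‖) ^ (d + 1))⁻¹, fun x => by positivity, fun x => ?_, ?_, ?_⟩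
  · exact inv_le_one_of_one_le₀ (one_le_pow₀ (by have : 0 ≤ k * ‖x‖ := by positivity
                                                 linarith))
  · have h0 : Integrable (fun x : Euc d => (1 + ‖x‖) ^ (-((d:ℝ) + 1))) :=
      integrable_one_add_norm (by simp)
    refine (h0.const_mul ((k ^ (d + 1))⁻¹)).mono' ?_ (Eventually.of_forall fun x => ?_)
    · have : Continuous fun x : Euc d => ((1 + k * ‖x‖) ^ (d + 1))⁻¹ :=
        Continuous.inv₀ (by fun_prop) fun x => by positivity
      exact this.aestronglyMeasurable
    · rw [Real.norm_eq_abs, abs_of_pos (by positivity)]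
      rw [Real.rpow_neg (by positivity)]
      have : (1 + ‖x‖) ^ ((d:ℝ) + 1) = (1 + ‖x‖) ^ (d + 1) := by
        rw [← Real.rpow_natCast]; push_cast; rfl
      rw [this, ← mul_inv, ← mul_pow]
      refine inv_anti₀ (by positivity) (pow_le_pow_left₀ (by positivity) ?_ _)
      nlinarith [norm_nonneg x]
  · intro x y
    have h1 : 1 + k * ‖y‖ ≤ Real.exp (k * ‖x - y‖) * (1 + k * ‖x‖) := by
      have a1 : ‖y‖ ≤ ‖x‖ + ‖x - y‖ := by
        have : y = x - (x - y) := by abel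
        calc ‖y‖ = ‖x - (x - y)‖ := by rw [← this]
          _ ≤ _ := norm_sub_le _ _
      have a2 := Real.add_one_le_exp (k * ‖x - y‖)
      have a3 : 0 ≤ k * ‖x‖ := by positivity
      have a4 : 0 ≤ k * ‖x - y‖ := by positivity
      have a5 : k * ‖y‖ ≤ k * ‖x‖ + k * ‖x - y‖ := by nlinarith
      nlinarith [mul_le_mul_of_nonneg_right a2 (by linarith : 0 ≤ 1 + k * ‖x‖), mul_nonneg a3 a4]
    have h2 : (1 + k * ‖y‖) ^ (d + 1) ≤ Real.exp (κ * ‖x - y‖) * (1 + k * ‖x‖) ^ (d + 1) := by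
      refine (pow_le_pow_left₀ (by positivity) h1 _).trans ?_
      rw [mul_pow, ← Real.exp_nat_mul]
      refine mul_le_mul_of_nonneg_right (Real.exp_le_exp.2 ?_) (by positivity)
      push_cast
      rw [← mul_assoc]
      exact mul_le_mul_of_nonneg_right hkd (norm_nonneg _)
    show ((1 + k * ‖x‖) ^ (d + 1))⁻¹ ≤ Real.exp (κ * ‖x - y‖) * ((1 + k * ‖y‖) ^ (d + 1))⁻¹
    rw [← div_eq_mul_inv, le_div_iff₀ (by positivity), inv_mul_le_iff₀ (by positivity)]
    linarith

structure Fld {d : ℕ} (K : ℝ) (L : NNReal) (a b L0 δ0 : ℝ) (c : ℝ → Euc d → ℝ)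
    (v : ℝ → Euc d → Euc d) : Prop where
  hK : ∀ t x, ‖v t x‖ ≤ K
  ht : ∀ t t' x, |t - t'| ≤ δ0 → ‖v t x - v t' x‖ ≤ (b - a) / 6
  hL : ∀ t, LipschitzWith L (v t)
  hdiv : ∀ t, ∀ᵐ x ∂(volume : Measure (Euc d)),
      LinearMap.trace ℝ (Euc d) (fderiv ℝ (v t) x).toLinearMap = 0
  havg : ∀ t x, ‖(L0 ^ d)⁻¹ • ∫ y in {y : Euc d | ∀ i, y i ∈ Set.Icc (0:ℝ) L0}, v t (x + y)‖ ≤ a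
  hb : ∀ t x, b ≤ c t x

theorem Fld.shift {d : ℕ} {K : ℝ} {L : NNReal} {a b L0 δ0 : ℝ} {c : ℝ → Euc d → ℝ}
    {v : ℝ → Euc d → Euc d} (h : Fld K L a b L0 δ0 c v) (s : ℝ) (y : Euc d) :
    Fld K L a b L0 δ0 (fun t x => c (t + s) (x + y)) (fun t x => v (t + s) (x + y)) where
  hK t x := h.hK _ _
  ht t t' x ht := h.ht _ _ _ (by simpa using ht)
  hL t := by
    have := (h.hL (t + s)).comp (LipschitzWith.of_edist_le (f := fun x : Euc d => x + y)
      fun a b => by simp)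
    rwa [mul_one] at this
  hdiv t := by
    have := (measurePreserving_add_right (volume : Measure (Euc d)) y).quasiMeasurePreserving.ae
      (h.hdiv (t + s))
    filter_upwards [this] with x hx
    rwa [fderiv_comp_add_right]
  havg t x := by
    have := h.havg (t + s) (x + y)
    simpa only [add_right_comm x y] using this
  hb t x := h.hb _ _

theorem mass_ball {d : ℕ} {κ : ℝ} (hκ : 0 ≤ κ) {ψ : Euc d → ℝ} (hψ : Wt κ ψ) {r0 Z : ℝ}
    (hr : 0 < r0) : ∃ m0 : ℝ, 0 < m0 ∧ ∀ z : Euc d, ‖z‖ ≤ Z → ∀ r, r0 ≤ r → m0 ≤ mu ψ (ball z r) := by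
  set V := (volume (ball (0 : Euc d) r0)).toReal with hV
  have hV0 : 0 < V := ENNReal.toReal_pos (measure_ball_pos _ _ hr).ne' measure_ball_lt_top.ne
  refine ⟨V * (Real.exp (-(κ * (Z + r0))) * ψ 0), by have := hψ.pos 0; positivity, ?_⟩
  intro z hz r hrr
  refine le_trans ?_ (mu_mono hψ (ball_subset_ball hrr))
  have h1 : ∀ x ∈ ball z r0, Real.exp (-(κ * (Z + r0))) * ψ 0 ≤ ψ x := by
    intro x hx
    have h2 := hψ.star 0 x
    have h3 : ‖(0 : Euc d) - x‖ ≤ Z + r0 := by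
      rw [zero_sub, norm_neg]
      have : ‖x - z‖ < r0 := by simpa [dist_eq_norm] using hx
      have := norm_add_le z (x - z)
      rw [add_sub_cancel] at this
      linarith
    rw [Real.exp_neg, inv_mul_le_iff₀ (Real.exp_pos _)]
    refine h2.trans (mul_le_mul_of_nonneg_right (Real.exp_le_exp.2 ?_) (hψ.pos x).le)
    gcongr
  have := setIntegral_mono_on (μ := volume) (s := ball z r0)
    (f := fun _ => Real.exp (-(κ * (Z + r0))) * ψ 0) (g := ψ) (integrableOn_const measure_ball_lt_top.ne)
    hψ.integ.integrableOn measurableSet_ball h1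
  rw [setIntegral_const, smul_eq_mul] at this
  refine le_trans (le_of_eq ?_) this
  congr 1
  rw [hV, Measure.real, Measure.addHaar_ball_center volume z]

theorem mass_tail {d : ℕ} {κ : ℝ} {ψ : Euc d → ℝ} (hψ : Wt κ ψ) {τ : ℝ} (hτ : 0 < τ) :
    ∃ r : ℝ, 0 < r ∧ mu ψ (ball (0 : Euc d) r)ᶜ ≤ τ := by
  have h1 := tendsto_setIntegral_of_monotone (μ := volume) (f := ψ)
    (s := fun n : ℕ => ball (0 : Euc d) ((n:ℝ) + 1)) (fun _ => measurableSet_ball)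
    (fun m n hmn => ball_subset_ball (by gcongr)) hψ.integ.integrableOn
  have hU : ⋃ n : ℕ, ball (0 : Euc d) ((n:ℝ) + 1) = Set.univ := by
    refine Set.eq_univ_of_forall fun x => ?_
    obtain ⟨n, hn⟩ := exists_nat_gt ‖x‖
    exact Set.mem_iUnion.2 ⟨n, by simp; linarith⟩
  rw [hU, setIntegral_univ] at h1
  obtain ⟨n, hn⟩ := (h1.eventually (lt_mem_nhds (by linarith : (∫ x, ψ x) - τ < ∫ x, ψ x))).exists
  refine ⟨n + 1, by positivity, ?_⟩
  have := integral_add_compl (measurableSet_ball (x := (0 : Euc d)) (ε := (n:ℝ)+1)) hψ.integ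
  simp only [mu]
  linarith

theorem growth {d : ℕ} {κ : ℝ} {ψ : Euc d → ℝ} {Lv : NNReal} {K b b' β h : ℝ}
    (hκ : 0 ≤ κ) (hψ : Wt κ ψ) (hb' : 0 ≤ b') (hb : 0 < b) (hβ : 0 ≤ β) (hh : 0 ≤ h)
    (hsm : h * Lv * (K + b') ≤ b - b')
    (hne : ∀ B : Set (Euc d), Bornology.IsBounded B → Bᶜ.Nonempty)
    {C r : ℝ} (hC : 0 < C) (hP : ∀ (W : Euc d → ℝ) (Lg : NNReal), LipschitzWith Lg W →
      ∀ S1 : Set (Euc d), MeasurableSet S1 → S1 ⊆ ball 0 r → (∀ x ∈ S1, W x = 1) → (∀ x, W x ≤ 1) →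
      volume S1 * ∫⁻ z in ball 0 r, ENNReal.ofReal (1 - W z)
        ≤ ENNReal.ofReal (C * ∫ x, ψ x * ‖fderiv ℝ W x‖))
    {τ : ℝ} (hτ : 0 < τ) (hσ : mu ψ (ball 0 r)ᶜ ≤ τ)
    (w : ℕ → Euc d → Euc d) (hw : ∀ n, LipschitzWith Lv (w n)) (hwK : ∀ n x, ‖w n x‖ ≤ K)
    (hflux : ∀ n (W : Euc d → ℝ) (Lg : NNReal), LipschitzWith Lg W → HasCompactSupport W →
      β * ∫ x, ψ x * ‖fderiv ℝ W x‖ ≤ ∫ x, ψ x * (b' * ‖fderiv ℝ W x‖ - fderiv ℝ W x (w n x)))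
    (A : ℕ → Set (Euc d)) (hA0 : IsOpen (A 0)) (hAb : Bornology.IsBounded (A 0))
    (hm : 2 * τ ≤ mu ψ (A 0)) (hA : ∀ n, A (n + 1) = TT (w n) b h (A n)) (n : ℕ) :
    min ((∫ x, ψ x) - 2 * τ) (n * (h * (β / C) * τ ^ 2)) ≤ mu ψ (A n) := by
  have hop : ∀ n, IsOpen (A n) := by
    intro n
    induction n with
    | zero => exact hA0
    | succ n ih => rw [hA]; exact TT_open (hw n).continuous _ _ ih
  have hbd : ∀ n, Bornology.IsBounded (A n) := by
    intro n
    induction n with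
    | zero => exact hAb
    | succ n ih => rw [hA]; exact TT_bdd (hwK n) ih
  have hmono : ∀ n, mu ψ (A n) ≤ mu ψ (A (n + 1)) := by
    intro n
    rw [hA]
    exact step_mono hκ hψ (hw n) (hwK n) hb' hb hβ (hflux n) hh hsm _ (hop n) (hbd n)
      (hne _ (hbd n))
  have hge : ∀ n, 2 * τ ≤ mu ψ (A n) := by
    intro n
    induction n with
    | zero => exact hm
    | succ n ih => exact ih.trans (hmono n)
  induction n with
  | zero => exact (min_le_right _ _).trans (by have := hge 0; simp; linarith)
  | succ n ih =>
    by_cases hc : (∫ x, ψ x) - 2 * τ ≤ mu ψ (A (n + 1))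
    · exact (min_le_left _ _).trans hc
    push Not at hc
    have hg := step_grow hκ hψ (hw n) (hwK n) hb' hb hβ (hflux n) hh hsm _ (hop n) (hbd n) hne hC hP
      rfl (by linarith [hge n])
    rw [← hA n] at hg
    have h1 : mu ψ (A n) < (∫ x, ψ x) - 2 * τ := (hmono n).trans_lt hc
    have h2 : n * (h * (β / C) * τ ^ 2) ≤ mu ψ (A n) := by
      rcases min_le_iff.1 ih with h | h
      · linarith
      · exact h
    refine (min_le_right _ _).trans (le_trans ?_ hg)
    have h3 : τ ^ 2 ≤ (mu ψ (A n) - mu ψ (ball 0 r)ᶜ) *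
        ((∫ x, ψ x) - mu ψ (ball 0 r)ᶜ - mu ψ (A (n + 1))) := by
      rw [sq]
      exact mul_le_mul (by linarith [hge n]) (by linarith) hτ.le (by linarith [hge n])
    have h4 : h * (β / C) * τ ^ 2 ≤ _ := mul_le_mul_of_nonneg_left h3 (by positivity)
    push_cast
    linarith

theorem Fld.seg {d : ℕ} {K : ℝ} {L : NNReal} {a b L0 δ0 : ℝ} {c : ℝ → Euc d → ℝ}
    {v : ℝ → Euc d → Euc d} (hF : Fld K L a b L0 δ0 c v) {t h b1 : ℝ} (hh : 0 ≤ h) (hhδ : h ≤ δ0)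
    (hb1 : 0 ≤ b1) (hbb : b1 + (b - a) / 3 = b) (hsm : h * L * (K + b1) ≤ (b - a) / 6)
    {y p e : Euc d} (he : ‖e‖ ≤ 1) {θ : ℝ} (hθ : θ ∈ Set.Icc 0 h)
    (hp : p = y + θ • (v t p + b1 • e)) :
    Reachable c v t y (t + h) (y + h • (v t p + b1 • e)) := by
  have := Reachable.line (c := c) (v := v) (t0 := t) (t1 := t + h) (by linarith) y
    (v t p + b1 • e) ?_
  · simpa using this
  intro s hs
  set u := v t p + b1 • e with hu
  have hbe : ‖b1 • e‖ ≤ b1 := by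
    rw [norm_smul, Real.norm_eq_abs, abs_of_nonneg hb1]
    nlinarith
  have hun : ‖u‖ ≤ K + b1 := (norm_add_le _ _).trans (add_le_add (hF.hK _ _) hbe)
  refine le_trans ?_ (hF.hb _ _)
  have h1 : u - v s (y + (s - t) • u) = b1 • e + (v t p - v s p) + (v s p - v s (y + (s - t) • u)) := by
    rw [hu]; abel
  rw [h1]
  have h2 : ‖v t p - v s p‖ ≤ (b - a) / 6 := hF.ht _ _ _ (by
    rw [abs_le]; constructor <;> linarith [hs.1, hs.2])
  have h3 : ‖v s p - v s (y + (s - t) • u)‖ ≤ (b - a) / 6 := by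
    have := (hF.hL s).dist_le_mul p (y + (s - t) • u)
    rw [dist_eq_norm, dist_eq_norm] at this
    refine this.trans (le_trans ?_ hsm)
    have h4 : p - (y + (s - t) • u) = (θ - (s - t)) • u := by
      nth_rewrite 1 [hp]; rw [sub_smul θ]; abel
    rw [h4, norm_smul, mul_comm h, mul_assoc]
    refine mul_le_mul_of_nonneg_left ?_ L.2
    refine mul_le_mul ?_ hun (norm_nonneg _) hh
    rw [Real.norm_eq_abs, abs_le]; constructor <;> linarith [hs.1, hs.2, hθ.1, hθ.2]
  have := norm_add₃_le (a := b1 • e) (b := v t p - v s p) (c := v s p - v s (y + (s - t) • u))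
  linarith

theorem exists_kappa {K ρ ε : ℝ} (hε : 0 < ε) : ∃ κ : ℝ, 0 < κ ∧
    K * κ * (ρ * Real.exp (κ * ρ)) + K * (Real.exp (κ * ρ) - 1) ≤ ε := by
  have h1 : Continuous fun κ : ℝ =>
      K * κ * (ρ * Real.exp (κ * ρ)) + K * (Real.exp (κ * ρ) - 1) := by fun_prop
  have h2 := (h1.tendsto 0).eventually_lt_const (u := ε) (by simpa using hε)
  have h3 : ∀ᶠ κ : ℝ in nhdsWithin 0 (Set.Ioi 0), _ := h2.filter_mono nhdsWithin_le_nhds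
  obtain ⟨κ, hκ, hk⟩ := (h3.and self_mem_nhdsWithin).exists
  exact ⟨κ, hk, le_of_lt hκ⟩

def reachA {d : ℕ} (v : ℝ → Euc d → Euc d) (x0 : Euc d) (b1 h : ℝ) : ℕ → Set (Euc d)
  | 0 => ball (x0 + h • v 0 x0) (h * b1)
  | n + 1 => TT (v ((n + 1) * h)) b1 h (reachA v x0 b1 h n)

theorem ball_dir {d : ℕ} {z y : Euc d} {r : ℝ} (h : y ∈ ball z r) :
    ∃ e : Euc d, ‖e‖ ≤ 1 ∧ y = z + r • e := by
  have hr : 0 < r := pos_of_mem_ball h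
  refine ⟨r⁻¹ • (y - z), ?_, ?_⟩
  · rw [norm_smul, norm_inv, Real.norm_eq_abs, abs_of_pos hr, inv_mul_le_iff₀ hr, mul_one]
    have : ‖y - z‖ < r := by simpa [dist_eq_norm] using h
    exact this.le
  · rw [smul_inv_smul₀ hr.ne']; abel

set_option maxHeartbeats 800000 in
theorem fish_core {d : ℕ} (hd : 0 < d) {K : ℝ} (L : NNReal) {a b L0 δ0 : ℝ} (hK : 0 ≤ K)
    (ha : 0 ≤ a) (hab : a < b) (hL0 : 0 < L0) (hδ0 : 0 < δ0) :
    ∃ C1 : ℝ, 0 < C1 ∧ ∀ (c : ℝ → Euc d → ℝ) (v : ℝ → Euc d → Euc d), Fld K L a b L0 δ0 c v →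
      ∀ x0 : Euc d, ‖x0‖ ≤ 1 → ∀ T, C1 ≤ T → Reachable c v 0 x0 T 0 := by
  have hne : ∀ B : Set (Euc d), Bornology.IsBounded B → Bᶜ.Nonempty := by
    intro B hB
    have : Nonempty (Fin d) := ⟨⟨0, hd⟩⟩
    by_contra hc
    rw [Set.not_nonempty_iff_eq_empty, Set.compl_empty_iff] at hc
    rw [hc] at hB
    exact NormedSpace.unbounded_univ ℝ (Euc d) hB
  set g := b - a with hg
  have hg0 : 0 < g := by simp [hg, hab]
  obtain ⟨κ, hκ, hθ⟩ := exists_kappa (K := K) (ρ := Real.sqrt d * L0) (ε := g / 6) (by positivity)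
  obtain ⟨ψ, hψ⟩ := exists_wt d hκ
  set b1 := b - g / 3 with hb1
  set b2 := b - 2 * g / 3 with hb2
  have hb10 : 0 < b1 := by simp only [hb1, hg]; linarith
  have hb20 : 0 ≤ b2 := by simp only [hb2, hg]; linarith
  obtain ⟨h0, hh0, hh0δ, hh0s⟩ : ∃ h0 : ℝ, 0 < h0 ∧ h0 ≤ δ0 ∧ h0 * L * (K + b1) ≤ g / 6 := by
    have hL : (0:ℝ) ≤ L := L.2
    have hX : 0 < (L:ℝ) * (K + b1) + 1 := by positivity
    refine ⟨min δ0 (g / 6 / (L * (K + b1) + 1)), lt_min hδ0 (by positivity), min_le_left _ _, ?_⟩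
    have h1 : min δ0 (g / 6 / (L * (K + b1) + 1)) ≤ g / 6 / (L * (K + b1) + 1) := min_le_right _ _
    rw [le_div_iff₀ hX] at h1
    have h2 : 0 < min δ0 (g / 6 / (L * (K + b1) + 1)) := lt_min hδ0 (by positivity)
    rw [mul_assoc]
    linarith
  obtain ⟨m0, hm0, hmb⟩ := mass_ball hκ.le hψ (r0 := h0 * b1 / 2) (Z := 1 + h0 * K) (by positivity)
  obtain ⟨r, hr, hσ⟩ := mass_tail hψ (τ := m0 / 4) (by positivity)
  obtain ⟨C, hC, hP⟩ := poincare hκ.le hψ r hr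
  set m := ∫ x, ψ x with hm
  have hm' : 0 ≤ m := integral_nonneg fun x => (hψ.pos x).le
  set η := h0 / 2 * (g / 6 / C) * (m0 / 4) ^ 2 with hη
  have hη0 : 0 < η := by positivity
  refine ⟨h0 * (3 + m / η), by positivity, ?_⟩
  intro c v hF x0 hx0 T hT
  have hT1 : 3 + m / η ≤ T / h0 := by rw [le_div_iff₀ hh0]; linarith
  have hmη : 0 ≤ m / η := by positivity
  obtain ⟨n, hn⟩ : ∃ n : ℕ, ⌈T / h0⌉₊ = n + 2 := by
    have : (2:ℝ) < ⌈T / h0⌉₊ := lt_of_lt_of_le (by linarith) (Nat.le_ceil _)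
    have : 2 < ⌈T / h0⌉₊ := by exact_mod_cast this
    exact ⟨⌈T / h0⌉₊ - 2, by omega⟩
  have hn1 : T / h0 ≤ n + 2 := by
    have := Nat.le_ceil (T / h0); rw [hn] at this; exact_mod_cast this
  have hn2 : (n:ℝ) + 2 < T / h0 + 1 := by
    have := Nat.ceil_lt_add_one (show 0 ≤ T / h0 by linarith); rw [hn] at this; exact_mod_cast this
  have hnpos : (0:ℝ) < n + 2 := by positivity
  set h := T / (n + 2) with hh
  have hhT : (n + 2) * h = T := by rw [hh]; field_simp
  have hhle : h ≤ h0 := by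
    rw [hh, div_le_iff₀ hnpos]; rw [div_le_iff₀ hh0] at hn1; linarith
  have hhge : h0 / 2 ≤ h := by
    rw [hh, le_div_iff₀ hnpos]
    have : (n:ℝ) + 2 < 2 * (T / h0) := by linarith
    have h2 : h0 * (n + 2) ≤ h0 * (2 * (T / h0)) := by gcongr
    have h3 : h0 * (2 * (T / h0)) = 2 * T := by field_simp
    linarith
  have hhpos : 0 < h := by linarith
  have hr0 : h0 * b1 / 2 ≤ h * b1 := by
    have := mul_le_mul_of_nonneg_right hhge hb10.le
    linarith
  have hL : (0:ℝ) ≤ L := L.2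
  have hsm1 : h * L * (K + b1) ≤ g / 6 := le_trans (by gcongr) hh0s
  have hb21 : b2 ≤ b1 := by simp only [hb1, hb2]; linarith
  have hsm2 : h * L * (K + b2) ≤ b1 - b2 := by
    have : h * L * (K + b2) ≤ h * L * (K + b1) := by gcongr
    have : b1 - b2 = g / 3 := by simp only [hb1, hb2]; ring
    linarith
  have hflux : ∀ t (W : Euc d → ℝ) (Lg : NNReal), LipschitzWith Lg W → HasCompactSupport W →
      g / 6 * ∫ x, ψ x * ‖fderiv ℝ W x‖
        ≤ ∫ x, ψ x * (b2 * ‖fderiv ℝ W x‖ - fderiv ℝ W x (v t x)) := by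
    intro t W Lg hW hWc
    have h1 := flux_bound hκ.le hψ (hF.hL t) (hF.hK t) (hF.hdiv t) hL0 (hF.havg t) le_rfl hW hWc
    have h2 : ∫ x, ψ x * (b2 * ‖fderiv ℝ W x‖ - fderiv ℝ W x (v t x)) =
        b2 * (∫ x, ψ x * ‖fderiv ℝ W x‖) - ∫ x, ψ x * fderiv ℝ W x (v t x) := by
      rw [← integral_const_mul, ← integral_sub ((hψ.int_fd hW).const_mul _)
        (hψ.int_fdv hW (hF.hL t).continuous.measurable (hF.hK t))]
      congr 1; funext x; ring
    have hI : 0 ≤ ∫ x, ψ x * ‖fderiv ℝ W x‖ :=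
      integral_nonneg fun x => mul_nonneg (hψ.pos x).le (norm_nonneg _)
    rw [h2]
    have h3 : b2 = a + g / 3 := by simp only [hb2, hg]; ring
    rw [h3]
    have h4 := mul_le_mul_of_nonneg_right hθ hI
    rw [add_mul] at h1 ⊢
    linarith
  have hgr := growth hκ.le hψ hb20 hb10 (β := g / 6) (by positivity) hhpos.le hsm2 hne hC hP
    (by positivity) hσ (fun n => v ((n + 1) * h)) (fun n => hF.hL _) (fun n => hF.hK _)
    (fun n => hflux _) (reachA v x0 b1 h) isOpen_ball isBounded_ball
    (by
      have : m0 ≤ mu ψ (ball (x0 + h • v 0 x0) (h * b1)) := by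
        refine hmb _ ?_ _ hr0
        refine (norm_add_le _ _).trans (add_le_add hx0 ?_)
        rw [norm_smul, Real.norm_eq_abs, abs_of_pos hhpos]
        exact mul_le_mul hhle (hF.hK _ _) (norm_nonneg _) hh0.le
      show 2 * (m0 / 4) ≤ mu ψ (ball (x0 + h • v 0 x0) (h * b1))
      linarith)
    (fun n => rfl) n
  have hbb : b1 + (b - a) / 3 = b := by simp only [hb1, hg]; ring
  have hre : ∀ k : ℕ, ∀ x ∈ reachA v x0 b1 h k, Reachable c v 0 x0 ((k + 1) * h) x := by
    intro k
    induction k with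
    | zero =>
      intro x hx
      obtain ⟨e, he, rfl⟩ := ball_dir hx
      have := hF.seg (t := 0) hhpos.le (hhle.trans hh0δ) hb10.le hbb hsm1 (y := x0) (p := x0) he
        (θ := 0) ⟨le_rfl, hhpos.le⟩ (by simp)
      convert this using 1
      · simp
      · rw [smul_add, smul_smul, add_assoc]
    | succ k ih =>
      intro x hx
      obtain ⟨e, he, hxA⟩ := hx
      have h1 := ih _ hxA
      have := hF.seg (t := (k + 1) * h) hhpos.le (hhle.trans hh0δ) hb10.le hbb hsm1
        (y := x - h • (v ((k + 1) * h) x + b1 • e)) (p := x) he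
        (θ := h) ⟨hhpos.le, le_rfl⟩ (by simp)
      rw [sub_add_cancel] at this
      convert h1.trans this using 1
      push_cast; ring
  set t1 := ((n:ℝ) + 1) * h with ht1
  have hlast : m0 ≤ mu ψ (ball (-(h • v t1 0)) (h * b1)) := by
    refine hmb _ ?_ _ hr0
    rw [norm_neg, norm_smul, Real.norm_eq_abs, abs_of_pos hhpos]
    have : h * ‖v t1 0‖ ≤ h0 * K := mul_le_mul hhle (hF.hK _ _) (norm_nonneg _) hh0.le
    linarith
  have hAn : m - 2 * (m0 / 4) ≤ mu ψ (reachA v x0 b1 h n) := by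
    refine le_trans (le_min le_rfl ?_) hgr
    have h1 : m ≤ n * η := by
      rw [← div_le_iff₀ hη0]; linarith
    have h2 : n * η ≤ n * (h * (g / 6 / C) * (m0 / 4) ^ 2) := by
      rw [hη]; gcongr
    linarith
  have hint : ∃ y, y ∈ reachA v x0 b1 h n ∧ y ∈ ball (-(h • v t1 0)) (h * b1) := by
    by_contra hc
    push Not at hc
    have hdj : Disjoint (reachA v x0 b1 h n) (ball (-(h • v t1 0)) (h * b1)) :=
      Set.disjoint_left.2 hc
    have := setIntegral_union hdj measurableSet_ball hψ.integ.integrableOn hψ.integ.integrableOn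
    have h2 := mu_mono hψ (Set.subset_univ
      (reachA v x0 b1 h n ∪ ball (-(h • v t1 0)) (h * b1)))
    simp only [mu] at h2 hAn hlast
    rw [this, setIntegral_univ] at h2
    linarith
  obtain ⟨y, hyA, hyb⟩ := hint
  obtain ⟨e, he, hye⟩ := ball_dir hyb
  have h1 := hre n y hyA
  have h2 := hF.seg (t := t1) hhpos.le (hhle.trans hh0δ) hb10.le hbb hsm1 (y := y) (p := 0)
    (e := -e) (by simpa using he) (θ := h) ⟨hhpos.le, le_rfl⟩
    (by rw [hye, smul_add, smul_smul, smul_neg]; abel)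
  have h3 : y + h • (v t1 0 + b1 • -e) = 0 := by rw [hye, smul_add, smul_smul, smul_neg]; abel
  rw [h3] at h2
  convert h1.trans h2 using 1
  rw [← hhT, ht1]; ring

theorem Fld.dim0 {K : ℝ} {L : NNReal} {a b L0 δ0 : ℝ} {c : ℝ → Euc 0 → ℝ}
    {v : ℝ → Euc 0 → Euc 0} (hb : 0 ≤ b) (hF : Fld K L a b L0 δ0 c v) {t0 t1 : ℝ} (h : t0 ≤ t1)
    (x0 x1 : Euc 0) : Reachable c v t0 x0 t1 x1 := by
  have := Reachable.line (c := c) (v := v) h x0 0 (fun s _ => by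
    rw [Subsingleton.elim (0 - v s _) 0, norm_zero]; exact hb.trans (hF.hb _ _))
  convert this using 1
  exact Subsingleton.elim _ _

theorem fish {d : ℕ} {K : ℝ} (L : NNReal) {a b L0 δ0 : ℝ} (hK : 0 ≤ K)
    (ha : 0 ≤ a) (hab : a < b) (hL0 : 0 < L0) (hδ0 : 0 < δ0) :
    ∃ C0 : ℝ, 1 ≤ C0 ∧ ∀ (c : ℝ → Euc d → ℝ) (v : ℝ → Euc d → Euc d), Fld K L a b L0 δ0 c v →
      ∀ t0 t1 x0 x1, C0 * (1 + ‖x1 - x0‖) ≤ t1 - t0 → Reachable c v t0 x0 t1 x1 := by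
  rcases Nat.eq_zero_or_pos d with rfl | hd
  · refine ⟨1, le_rfl, fun c v hF t0 t1 x0 x1 h => hF.dim0 (ha.trans hab.le) ?_ _ _⟩
    have := norm_nonneg (x1 - x0)
    linarith
  obtain ⟨C1, hC1, hcore⟩ := fish_core hd L hK ha hab hL0 hδ0
  have hone : ∀ (c : ℝ → Euc d → ℝ) (v : ℝ → Euc d → Euc d), Fld K L a b L0 δ0 c v →
      ∀ t0 t1 x0 x1, ‖x0 - x1‖ ≤ 1 → C1 ≤ t1 - t0 → Reachable c v t0 x0 t1 x1 := by
    intro c v hF t0 t1 x0 x1 hx ht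
    have := (hcore _ _ (hF.shift t0 x1) (x0 - x1) hx (t1 - t0) ht).shift
    simpa using this
  refine ⟨max 1 (2 * C1), le_max_left _ _, ?_⟩
  intro c v hF t0 t1 x0 x1 h
  set D := ‖x1 - x0‖ with hD
  have hD0 : 0 ≤ D := norm_nonneg _
  set n := ⌈D⌉₊ + 1 with hn
  have hn1 : D ≤ n := by rw [hn]; push_cast; linarith [Nat.le_ceil D]
  have hn2 : (n:ℝ) ≤ 2 * (1 + D) := by rw [hn]; push_cast; linarith [Nat.ceil_lt_add_one hD0]
  have hn0 : (0:ℝ) < n := by rw [hn]; positivity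
  have hle : 2 * C1 * (1 + D) ≤ t1 - t0 :=
    le_trans (mul_le_mul_of_nonneg_right (le_max_right _ _) (by linarith)) h
  have hst : C1 ≤ (t1 - t0) / n := by
    rw [le_div_iff₀ hn0]; nlinarith
  have key : ∀ k : ℕ, Reachable c v t0 x0 (t0 + k * ((t1 - t0) / n)) (x0 + ((k:ℝ) / n) • (x1 - x0)) := by
    intro k
    induction k with
    | zero =>
      simp only [Nat.cast_zero, zero_mul, zero_div, zero_smul, add_zero]
      exact Reachable.refl t0 x0
    | succ k ih =>
      refine ih.trans (hone c v hF _ _ _ _ ?_ ?_)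
      · rw [add_sub_add_left_eq_sub, ← sub_smul, norm_smul, ← sub_div, Real.norm_eq_abs, abs_div,
          abs_of_pos hn0]
        push_cast
        rw [show (k:ℝ) - (k + 1) = -1 by ring, abs_neg, abs_one, one_div, inv_mul_le_iff₀ hn0, mul_one]
        exact hn1
      · push_cast; linarith
  have := key n
  rw [div_self hn0.ne', one_smul, mul_div_cancel₀ _ hn0.ne'] at this
  simpa using this

theorem lip_ftc {d : ℕ} {γ : ℝ → Euc d} {C : NNReal} (hγ : LipschitzWith C γ) (a b : ℝ) :
    IntervalIntegrable (deriv γ) volume a b ∧ ∫ s in a..b, deriv γ s = γ b - γ a := by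
  have hint : IntervalIntegrable (deriv γ) volume a b := by
    refine (intervalIntegrable_const (c := (C:ℝ))).mono_fun (measurable_deriv γ).aestronglyMeasurable
      (Eventually.of_forall fun s => ?_)
    refine (norm_deriv_le_of_lipschitz hγ).trans ?_
    simp
  refine ⟨hint, ?_⟩
  ext i
  have h1 : ∫ s in a..b, (deriv γ s) i = (∫ s in a..b, deriv γ s) i :=
    (EuclideanSpace.proj i : Euc d →L[ℝ] ℝ).intervalIntegral_comp_comm hint
  have h2 : LipschitzWith C fun s => γ s i := by
    refine LipschitzWith.of_dist_le_mul fun s t => ?_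
    refine le_trans ?_ (hγ.dist_le_mul s t)
    rw [dist_eq_norm, dist_eq_norm]
    exact PiLp.norm_apply_le (γ s - γ t) i
  have h3 := (h2.lipschitzOnWith (s := Set.uIcc a b)).absolutelyContinuousOnInterval.integral_deriv_eq_sub
  have h4 : ∫ s in a..b, deriv (fun s => γ s i) s = ∫ s in a..b, (deriv γ s) i := by
    refine intervalIntegral.integral_congr_ae ?_
    filter_upwards [hγ.ae_differentiableAt] with s hs _
    have := ((EuclideanSpace.proj i : Euc d →L[ℝ] ℝ).hasFDerivAt.comp_hasDerivAt s
      hs.hasDerivAt)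
    exact this.deriv
  rw [← h1, ← h4, h3]
  simp

structure Reg {d : ℕ} (K : ℝ) (L : ℝ) (c : ℝ → Euc d → ℝ) (v : ℝ → Euc d → Euc d) : Prop where
  K0 : 0 ≤ K
  L0 : 0 ≤ L
  c0 : ∀ t x, 0 < c t x
  cK : ∀ t x, c t x ≤ K
  vK : ∀ t x, ‖v t x‖ ≤ K
  cL : ∀ t x x', |c t x - c t x'| ≤ L * ‖x - x'‖
  vL : ∀ t x x', ‖v t x - v t x'‖ ≤ L * ‖x - x'‖
  uc : ∀ ε : ℝ, 0 < ε → ∃ δ : ℝ, 0 < δ ∧ ∀ t t' : ℝ, |t - t'| ≤ δ → ∀ x,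
      |c t x - c t' x| ≤ ε ∧ ‖v t x - v t' x‖ ≤ ε

theorem Reg.contv {d : ℕ} {K L : ℝ} {c : ℝ → Euc d → ℝ} {v : ℝ → Euc d → Euc d}
    (h : Reg K L c v) : Continuous (fun p : ℝ × Euc d => v p.1 p.2) ∧
      Continuous (fun p : ℝ × Euc d => c p.1 p.2) := by
  have key : ∀ p : ℝ × Euc d, ∀ ε > 0, ∃ δ > 0, ∀ q : ℝ × Euc d, dist q p < δ →
      ‖v q.1 q.2 - v p.1 p.2‖ < ε ∧ |c q.1 q.2 - c p.1 p.2| < ε := by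
    intro p ε hε
    obtain ⟨δ, hδ, hu⟩ := h.uc (ε / 4) (by positivity)
    have hL := h.L0
    refine ⟨min δ (ε / 4 / (L + 1)), lt_min hδ (by positivity), fun q hq => ?_⟩
    have h1 : |q.1 - p.1| ≤ δ := by
      have : dist q.1 p.1 ≤ dist q p := le_max_left _ _
      rw [Real.dist_eq] at this
      exact this.trans (hq.le.trans (min_le_left _ _))
    have h2 : L * ‖q.2 - p.2‖ ≤ ε / 4 := by
      have : dist q.2 p.2 ≤ dist q p := le_max_right _ _
      rw [dist_eq_norm] at this
      have h3 : ‖q.2 - p.2‖ ≤ ε / 4 / (L + 1) := this.trans (hq.le.trans (min_le_right _ _))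
      rw [le_div_iff₀ (by positivity)] at h3
      nlinarith [norm_nonneg (q.2 - p.2)]
    have h3 := hu _ _ h1 q.2
    have h4 := (h.vL p.1 q.2 p.2).trans h2
    have h5 := (h.cL p.1 q.2 p.2).trans h2
    constructor
    · have := norm_sub_le_norm_sub_add_norm_sub (v q.1 q.2) (v p.1 q.2) (v p.1 p.2)
      linarith [h3.2]
    · have := abs_sub_le (c q.1 q.2) (c p.1 q.2) (c p.1 p.2)
      linarith [h3.1]
  constructor
  · refine Metric.continuous_iff.2 fun p ε hε => ?_
    obtain ⟨δ, hδ, hh⟩ := key p ε hε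
    exact ⟨δ, hδ, fun q hq => by rw [dist_eq_norm]; exact (hh q hq).1⟩
  · refine Metric.continuous_iff.2 fun p ε hε => ?_
    obtain ⟨δ, hδ, hh⟩ := key p ε hε
    exact ⟨δ, hδ, fun q hq => by rw [Real.dist_eq]; exact (hh q hq).2⟩

/-- A Lipschitz limit path satisfying infinitesimal estimates is admissible. -/
theorem reach_of_path {d : ℕ} {c : ℝ → Euc d → ℝ} {v : ℝ → Euc d → Euc d}
    {t0 t1 : ℝ} (h01 : t0 ≤ t1) (γ : ℝ → Euc d)
    (hest : ∀ ε > 0, ∃ δ > 0, ∀ s ∈ Set.Icc t0 t1, ∀ r ∈ Set.Icc t0 t1, s ≤ r → r - s ≤ δ →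
      ‖γ r - γ s - (r - s) • v s (γ s)‖ ≤ (r - s) * (c s (γ s) + ε))
    {C : NNReal} (hγ : LipschitzOnWith C γ (Set.Icc t0 t1)) :
    Reachable c v t0 (γ t0) t1 (γ t1) := by
  set γ' : ℝ → Euc d := fun s => γ (Set.projIcc t0 t1 h01 s) with hγ'
  have hl : LipschitzWith C γ' := by
    have h1 : LipschitzWith C (Set.domRestrict (Set.Icc t0 t1) γ) := hγ.to_restrict
    have h2 := h1.comp (LipschitzWith.projIcc h01)
    rwa [mul_one] at h2
  have heq : ∀ s ∈ Set.Icc t0 t1, γ' s = γ s := fun s hs => by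
    simp [hγ', Set.projIcc_of_mem h01 hs]
  refine ⟨h01, γ', deriv γ', (lip_ftc hl _ _).1, ?_, heq _ ⟨h01, le_rfl⟩, ?_⟩
  · intro t ht
    rw [(lip_ftc hl _ _).2, heq t0 ⟨le_rfl, h01⟩]; abel
  · rw [ae_restrict_iff' measurableSet_Icc]
    have hne : ∀ᵐ s : ℝ, s ≠ t1 := by
      simp [ae_iff]
    filter_upwards [hl.ae_differentiableAt, hne] with s hd hst hs
    have hlt : s < t1 := lt_of_le_of_ne hs.2 hst
    refine le_of_forall_pos_le_add fun ε hε => ?_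
    obtain ⟨δ, hδ, hh⟩ := hest ε hε
    have hsl := (hasDerivAt_iff_tendsto_slope.1 hd.hasDerivAt).mono_left
      (nhdsWithin_mono s (fun y hy => ne_of_gt hy) : nhdsWithin s (Set.Ioi s) ≤ _)
    have hlim := (hsl.sub_const (v s (γ' s))).norm
    refine le_of_tendsto hlim ?_
    have hmem : Set.Ioo s (min t1 (s + δ)) ∈ nhdsWithin s (Set.Ioi s) :=
      Ioo_mem_nhdsGT (lt_min hlt (by linarith))
    filter_upwards [hmem] with r hr
    have hr1 : r ∈ Set.Icc t0 t1 := ⟨hs.1.trans hr.1.le, (hr.2.trans_le (min_le_left _ _)).le⟩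
    have hr2 : r - s ≤ δ := by linarith [hr.2.trans_le (min_le_right _ _)]
    have h3 := hh s hs r hr1 hr.1.le hr2
    have hrs : 0 < r - s := by linarith [hr.1]
    rw [heq s hs, slope_def_module, heq s hs, heq r hr1]
    have h4 : (r - s)⁻¹ • (γ r - γ s) - v s (γ s) = (r - s)⁻¹ • (γ r - γ s - (r - s) • v s (γ s)) := by
      rw [smul_sub (r - s)⁻¹ (γ r - γ s), smul_smul, inv_mul_cancel₀ hrs.ne', one_smul]
    rw [h4, norm_smul, norm_inv, Real.norm_eq_abs, abs_of_pos hrs, inv_mul_le_iff₀ hrs]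
    exact h3

section disc
variable {d : ℕ} {K L : ℝ} {c : ℝ → Euc d → ℝ} {v : ℝ → Euc d → Euc d}

theorem Reg.disc_lip (h : Reg K L c v) {t0 τ η : ℝ} (hτ : 0 ≤ τ) {p : ℕ → Euc d}
    {k m : ℕ} (hst : ∀ i, k ≤ i → i < k + m → ‖p (i + 1) - p i - τ • v (t0 + i * τ) (p i)‖
      ≤ τ * (c (t0 + i * τ) (p i) + η)) :
    ‖p (k + m) - p k‖ ≤ m * τ * (2 * K + η) := by
  induction m with
  | zero => simp
  | succ m ih =>
    have h1 := ih fun i hi hi' => hst i hi (by omega)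
    have h2 := hst (k + m) (by omega) (by omega)
    set i := k + m with hi
    have e : p (k + (m + 1)) - p k = (p i - p k) + ((p (i + 1) - p i - τ • v (t0 + i * τ) (p i))
        + τ • v (t0 + i * τ) (p i)) := by rw [hi, ← add_assoc]; abel
    rw [e]
    have h3 : ‖τ • v (t0 + i * τ) (p i)‖ ≤ τ * K := by
      rw [norm_smul, Real.norm_eq_abs, abs_of_nonneg hτ]
      exact mul_le_mul_of_nonneg_left (h.vK _ _) hτ
    have h4 := mul_le_mul_of_nonneg_left (h.cK (t0 + i * τ) (p i)) hτ
    refine (norm_add_le _ _).trans ((add_le_add h1 (norm_add_le _ _)).trans ?_)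
    push_cast
    nlinarith

theorem Reg.disc_est (h : Reg K L c v) {t0 τ η ε δ : ℝ} (hτ : 0 ≤ τ) (hη : 0 ≤ η) (hηε : η ≤ ε)
    (hδ : ∀ t t' : ℝ, |t - t'| ≤ δ → ∀ x, |c t x - c t' x| ≤ ε ∧ ‖v t x - v t' x‖ ≤ ε)
    (hδ2 : L * (δ * (2 * K + ε)) ≤ ε) {p : ℕ → Euc d}
    {k m : ℕ} (hst : ∀ i, k ≤ i → i < k + m → ‖p (i + 1) - p i - τ • v (t0 + i * τ) (p i)‖
      ≤ τ * (c (t0 + i * τ) (p i) + η)) (hm : m * τ ≤ δ) :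
    ‖p (k + m) - p k - (m * τ) • v (t0 + k * τ) (p k)‖
      ≤ m * τ * (c (t0 + k * τ) (p k) + 5 * ε) := by
  induction m with
  | zero => simp
  | succ m ih =>
    have hm' : m * τ ≤ δ := le_trans (by push_cast; nlinarith) hm
    have h1 := ih (fun i hi hi' => hst i hi (by omega)) hm'
    have h2 := hst (k + m) (by omega) (by omega)
    have h3 := h.disc_lip (t0 := t0) hτ (p := p) (k := k) (m := m) (η := η)
      (fun i hi hi' => hst i hi (by omega))
    have hK := h.K0
    have hL := h.L0
    have h4 : L * ‖p (k + m) - p k‖ ≤ ε := by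
      refine le_trans (mul_le_mul_of_nonneg_left (h3.trans ?_) hL) hδ2
      exact mul_le_mul hm' (by linarith) (by positivity) (le_trans (by positivity) hm')
    set i := k + m with hi
    have ht : |t0 + i * τ - (t0 + k * τ)| ≤ δ := by
      rw [hi]; push_cast
      rw [show t0 + (k + m) * τ - (t0 + k * τ) = m * τ by ring, abs_of_nonneg (by positivity)]
      exact hm'
    have h5 := hδ _ _ ht (p i)
    have h6 := (h.vL (t0 + k * τ) (p i) (p k)).trans h4
    have h7 := (h.cL (t0 + k * τ) (p i) (p k)).trans h4
    have h8 : ‖v (t0 + i * τ) (p i) - v (t0 + k * τ) (p k)‖ ≤ 2 * ε := by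
      have := norm_sub_le_norm_sub_add_norm_sub (v (t0 + i * τ) (p i)) (v (t0 + k * τ) (p i))
        (v (t0 + k * τ) (p k))
      linarith [h5.2]
    have h9 : c (t0 + i * τ) (p i) ≤ c (t0 + k * τ) (p k) + 2 * ε := by
      have a1 := (abs_le.1 h5.1).2
      have a2 := (abs_le.1 h7).2
      linarith
    have e : p (k + (m + 1)) - p k - ((↑(m + 1) : ℝ) * τ) • v (t0 + k * τ) (p k) =
        (p i - p k - (m * τ) • v (t0 + k * τ) (p k)) +
        ((p (i + 1) - p i - τ • v (t0 + i * τ) (p i)) +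
          τ • (v (t0 + i * τ) (p i) - v (t0 + k * τ) (p k))) := by
      rw [hi, ← add_assoc, smul_sub]; push_cast; rw [add_mul, one_mul, add_smul]; abel
    rw [e]
    refine (norm_add_le _ _).trans ((add_le_add h1 (norm_add_le _ _)).trans ?_)
    rw [norm_smul, Real.norm_eq_abs, abs_of_nonneg hτ]
    have b1 := mul_le_mul_of_nonneg_left h8 hτ
    have b2 := mul_le_mul_of_nonneg_left h9 hτ
    have b3 := mul_le_mul_of_nonneg_left hηε hτ
    push_cast
    nlinarith

end disc

theorem ultra_lim {X : Type*} [TopologicalSpace X] (U : Ultrafilter ℕ) {s : Set X}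
    (hs : IsCompact s) (f : ℕ → X) (hf : ∀ j, f j ∈ s) : ∃ x ∈ s, Tendsto f U (nhds x) := by
  obtain ⟨x, hx, h⟩ := hs.ultrafilter_le_nhds (U.map f) (by
    rw [le_principal_iff]
    exact Filter.mem_map.2 (Filter.univ_mem' hf))
  exact ⟨x, hx, h⟩

theorem Reg.hit_of_chains {d : ℕ} {K L : ℝ} {c : ℝ → Euc d → ℝ} {v : ℝ → Euc d → Euc d}
    (h : Reg K L c v) {t0 T : ℝ} {x0 x : Euc d}
    (hch : ∀ j : ℕ, ∃ n : ℕ, j + 1 ≤ n ∧ ∃ N : ℕ, (N:ℝ) ≤ T * n ∧ ∃ p : ℕ → Euc d,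
      ‖p 0 - x0‖ ≤ 1 / ((j:ℝ) + 1) ∧ ‖p N - x‖ ≤ 1 / ((j:ℝ) + 1) ∧
      ∀ k < N, ‖p (k + 1) - p k - (n:ℝ)⁻¹ • v (t0 + k * (n:ℝ)⁻¹) (p k)‖
        ≤ (n:ℝ)⁻¹ * (c (t0 + k * (n:ℝ)⁻¹) (p k) + 1 / ((j:ℝ) + 1))) :
    ∃ t ∈ Set.Icc 0 T, Reachable c v t0 x0 (t0 + t) x := by
  choose n hn N hN p hp0 hpN hst using hch
  have hK := h.K0
  set U : Ultrafilter ℕ := hyperfilter ℕ with hU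
  have hUle : (U : Filter ℕ) ≤ atTop := Nat.hyperfilter_le_atTop
  have hn0 : ∀ j, (0:ℝ) < n j := fun j => by
    have := hn j
    exact_mod_cast (by omega : 0 < n j)
  have hni : ∀ j, (0:ℝ) < (n j : ℝ)⁻¹ := fun j => inv_pos.2 (hn0 j)
  have hη : ∀ j : ℕ, 1 / ((j:ℝ) + 1) ≤ 1 := fun j => by
    rw [div_le_one (by positivity)]; linarith [(Nat.cast_nonneg j : (0:ℝ) ≤ j)]
  have hη0 : Tendsto (fun j : ℕ => 1 / ((j:ℝ) + 1)) U (nhds 0) :=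
    (tendsto_one_div_add_atTop_nhds_zero_nat (𝕜 := ℝ)).mono_left hUle
  have hNT : ∀ j, N j * (n j : ℝ)⁻¹ ≤ T := fun j => by
    rw [← div_eq_mul_inv, div_le_iff₀ (hn0 j)]; exact hN j
  obtain ⟨Ts, hTs, hTlim⟩ := ultra_lim U (isCompact_Icc (a := (0:ℝ)) (b := T))
    (fun j => N j * (n j : ℝ)⁻¹) (fun j => ⟨mul_nonneg (Nat.cast_nonneg _) (hni j).le, hNT j⟩)
  have hT0 : 0 ≤ T := hTs.1.trans hTs.2
  refine ⟨Ts, hTs, ?_⟩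
  let k : ℝ → ℕ → ℕ := fun s j => min ⌊(s - t0) * n j⌋₊ (N j)
  have hkN : ∀ s j, k s j ≤ N j := fun s j => min_le_right _ _
  have hlip : ∀ j a m, a + m ≤ N j →
      ‖p j (a + m) - p j a‖ ≤ m * (n j : ℝ)⁻¹ * (2 * K + 1) := by
    intro j a m ham
    refine (h.disc_lip (t0 := t0) (η := 1 / ((j:ℝ) + 1)) (hni j).le (p := p j) (k := a) (m := m)
      fun i hi hi' => hst j i (by omega)).trans ?_
    have := hη j
    have := hni j
    gcongr
  have hbd : ∀ s j, p j (k s j) ∈ closedBall x0 (1 + T * (2 * K + 1)) := by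
    intro s j
    rw [mem_closedBall, dist_eq_norm]
    have h1 := hlip j 0 (k s j) (by simpa using hkN s j)
    rw [zero_add] at h1
    have h2 : (k s j : ℝ) * (n j : ℝ)⁻¹ ≤ T := by
      refine le_trans ?_ (hNT j)
      exact mul_le_mul_of_nonneg_right (by exact_mod_cast hkN s j) (hni j).le
    have h3 : (k s j : ℝ) * (n j : ℝ)⁻¹ * (2 * K + 1) ≤ T * (2 * K + 1) := by gcongr
    have h4 := norm_sub_le_norm_sub_add_norm_sub (p j (k s j)) (p j 0) x0
    linarith [hp0 j, hη j]
  choose γ hγm hγ using fun s => ultra_lim U (isCompact_closedBall x0 (1 + T * (2 * K + 1)))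
    (fun j => p j (k s j)) (hbd s)
  have hntop : Tendsto (fun j => (n j : ℝ)) U atTop := by
    refine tendsto_natCast_atTop_atTop.comp (Tendsto.mono_left ?_ hUle)
    exact tendsto_atTop_mono (fun j => (by have := hn j; omega : j ≤ n j)) tendsto_id
  have hk : ∀ s ∈ Set.Icc t0 (t0 + Ts), Tendsto (fun j => (k s j : ℝ) * (n j : ℝ)⁻¹) U
      (nhds (s - t0)) := by
    intro s hs
    have h1 := (tendsto_nat_floor_mul_div_atTop (R := ℝ) (a := s - t0) (by linarith [hs.1])).comp hntop
    have h2 := h1.min hTlim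
    rw [min_eq_left (by linarith [hs.2])] at h2
    refine h2.congr fun j => ?_
    simp only [k, Function.comp, Nat.cast_min]
    rw [div_eq_mul_inv, min_mul_of_nonneg _ _ (hni j).le]
  have hmono : ∀ s r, s ≤ r → ∀ j, k s j ≤ k r j := by
    intro s r hsr j
    refine min_le_min (Nat.floor_mono ?_) le_rfl
    have := (hn0 j).le
    gcongr
  have hdiff : ∀ s ∈ Set.Icc t0 (t0 + Ts), ∀ r ∈ Set.Icc t0 (t0 + Ts), s ≤ r →
      Tendsto (fun j => ((k r j - k s j : ℕ) : ℝ) * (n j : ℝ)⁻¹) U (nhds (r - s)) := by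
    intro s hs r hr hsr
    have := (hk r hr).sub (hk s hs)
    rw [show r - t0 - (s - t0) = r - s by ring] at this
    refine this.congr fun j => ?_
    rw [Nat.cast_sub (hmono s r hsr j)]; ring
  have hx0 : γ t0 = x0 := by
    refine tendsto_nhds_unique (hγ t0) ?_
    have : ∀ j, k t0 j = 0 := fun j => by simp [k]
    simp only [this]
    rw [tendsto_iff_norm_sub_tendsto_zero]
    exact squeeze_zero (fun _ => norm_nonneg _) hp0 hη0
  have hx1 : γ (t0 + Ts) = x := by
    refine tendsto_nhds_unique (hγ _) ?_
    rw [tendsto_iff_norm_sub_tendsto_zero]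
    have hm : (t0 + Ts) ∈ Set.Icc t0 (t0 + Ts) := ⟨by linarith [hTs.1], le_rfl⟩
    have h1 := ((hTlim.sub (hk _ hm)).mul_const (2 * K + 1)).add hη0
    simp only [add_sub_cancel_left, sub_self, zero_mul, add_zero] at h1
    refine squeeze_zero (fun _ => norm_nonneg _) (fun j => ?_) h1
    have h2 := hlip j (k (t0 + Ts) j) (N j - k (t0 + Ts) j) (by have := hkN (t0 + Ts) j; omega)
    rw [Nat.add_sub_cancel' (hkN _ _), Nat.cast_sub (hkN _ _), norm_sub_rev, sub_mul] at h2
    have h3 := norm_sub_le_norm_sub_add_norm_sub (p j (k (t0 + Ts) j)) (p j (N j)) x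
    linarith [hpN j]
  rw [← hx0, ← hx1]
  refine reach_of_path (by linarith [hTs.1]) γ ?_
    (C := (2 * K + 1).toNNReal) (LipschitzOnWith.of_dist_le_mul fun r hr s hs => ?_)
  · intro ε hε
    obtain ⟨δ, hδ, hu⟩ := h.uc (ε / 5) (by positivity)
    have hL := h.L0
    set X := L * (2 * K + ε / 5) + 1 with hX
    have hX0 : 0 < X := by positivity
    set δ' := min δ (ε / 5 / X) with hδ'
    have hδ'0 : 0 < δ' := lt_min hδ (by positivity)
    refine ⟨δ' / 2, by positivity, ?_⟩
    intro s hs r hr hsr hrs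
    have hd := hdiff s hs r hr hsr
    have e1 : ∀ᶠ j in (U : Filter ℕ), ((k r j - k s j : ℕ) : ℝ) * (n j : ℝ)⁻¹ < δ' :=
      hd.eventually_lt_const (by linarith)
    have e2 : ∀ᶠ j : ℕ in (U : Filter ℕ), 1 / ((j:ℝ) + 1) < ε / 5 :=
      hη0.eventually_lt_const (by positivity)
    have hpair : Tendsto (fun j => (t0 + (k s j : ℝ) * (n j : ℝ)⁻¹, p j (k s j))) U
        (nhds (s, γ s)) := by
      have := ((hk s hs).const_add t0).prodMk_nhds (hγ s)
      simpa using this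
    have hv := (h.contv.1.tendsto (s, γ s)).comp hpair
    have hc := (h.contv.2.tendsto (s, γ s)).comp hpair
    refine le_of_tendsto_of_tendsto (((hγ r).sub (hγ s)).sub (hd.smul hv)).norm
      (hd.mul (hc.add_const ε)) ?_
    filter_upwards [e1, e2] with j h1 h2
    have hks := hmono s r hsr j
    have := h.disc_est (t0 := t0) (δ := δ') (ε := ε / 5) (η := 1 / ((j:ℝ) + 1)) (hni j).le
      (by positivity) h2.le
      (fun t t' htt => hu t t' (htt.trans (min_le_left _ _))) (by
        have : δ' ≤ ε / 5 / X := min_le_right _ _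
        rw [le_div_iff₀ hX0, hX] at this
        nlinarith) (p := p j) (k := k s j) (m := k r j - k s j)
      (fun i hi hi' => hst j i (by have := hkN r j; omega)) h1.le
    rw [Nat.add_sub_cancel' hks] at this
    have e : 5 * (ε / 5) = ε := by ring
    rw [e] at this
    exact this
  · wlog hsr : s ≤ r generalizing r s
    · rw [dist_comm, dist_comm r s]
      exact this s hs r hr (le_of_not_ge hsr)
    rw [Real.coe_toNNReal _ (by positivity), dist_eq_norm, Real.dist_eq, abs_of_nonneg (by linarith),
      mul_comm]
    refine le_of_tendsto_of_tendsto ((hγ r).sub (hγ s)).norm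
      ((hdiff s hs r hr hsr).mul_const _) (Eventually.of_forall fun j => ?_)
    have hks := hmono s r hsr j
    have h2 := hlip j (k s j) (k r j - k s j) (by have := hkN r j; omega)
    rw [Nat.add_sub_cancel' hks] at h2
    exact h2

theorem Reachable.sub {d : ℕ} {c : ℝ → Euc d → ℝ} {v : ℝ → Euc d → Euc d} {t0 t1 : ℝ}
    {x0 x1 : Euc d} (h : Reachable c v t0 x0 t1 x1) : ∃ γ : ℝ → Euc d, γ t0 = x0 ∧ γ t1 = x1 ∧
      ∀ s ∈ Set.Icc t0 t1, ∀ r ∈ Set.Icc t0 t1, s ≤ r → Reachable c v s (γ s) r (γ r) := by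
  obtain ⟨h01, γ, g, hg, hγ, hx1, hae⟩ := h
  refine ⟨γ, by simp [hγ t0 ⟨le_rfl, h01⟩], hx1, fun s hs r hr hsr => ⟨hsr, γ, g, ?_, ?_, rfl, ?_⟩⟩
  · refine hg.mono_set ?_
    rw [Set.uIcc_of_le hsr, Set.uIcc_of_le h01]
    exact Set.Icc_subset_Icc hs.1 hr.2
  · intro t ht
    have i1 : ∀ u ∈ Set.Icc t0 t1, IntervalIntegrable g volume t0 u := fun u hu =>
      hg.mono_set (Set.uIcc_subset_uIcc_left (by rw [Set.uIcc_of_le h01]; exact hu))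
    have ht' : t ∈ Set.Icc t0 t1 := ⟨hs.1.trans ht.1, ht.2.trans hr.2⟩
    rw [hγ t ht', hγ s hs, add_assoc, ← intervalIntegral.integral_add_adjacent_intervals (i1 s hs)
      ((i1 s hs).symm.trans (i1 t ht'))]
  · exact ae_restrict_of_ae_restrict_of_subset (Set.Icc_subset_Icc hs.1 hr.2) hae

theorem Reg.reach_est {d : ℕ} {K L : ℝ} {c : ℝ → Euc d → ℝ} {v : ℝ → Euc d → Euc d}
    (h : Reg K L c v) {s r ε δ : ℝ} {y z : Euc d}
    (hδ : ∀ t t' : ℝ, |t - t'| ≤ δ → ∀ x, |c t x - c t' x| ≤ ε ∧ ‖v t x - v t' x‖ ≤ ε)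
    (hδ2 : L * (2 * K * δ) ≤ ε) (hsr : r - s ≤ δ) (hR : Reachable c v s y r z) :
    ‖z - y - (r - s) • v s y‖ ≤ (r - s) * (c s y + 4 * ε) := by
  obtain ⟨hle, γ, g, hg, hγ, hx1, hae⟩ := id hR
  obtain ⟨hK, hL⟩ := And.intro h.K0 h.L0
  have hsp : ∀ t ∈ Set.Icc s r, ‖γ t - y‖ ≤ 2 * K * (t - s) := by
    intro t ht
    have : Reachable c v s y t (γ t) := by
      refine ⟨ht.1, γ, g, hg.mono_set ?_, fun u hu => hγ u ⟨hu.1, hu.2.trans ht.2⟩, rfl,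
        ae_restrict_of_ae_restrict_of_subset (Set.Icc_subset_Icc le_rfl ht.2) hae⟩
      exact Set.uIcc_subset_uIcc_left (by rw [Set.uIcc_of_le hle]; exact ht)
    exact this.speed h.cK h.vK
  have e : z - y - (r - s) • v s y = ∫ t in s..r, (g t - v s y) := by
    rw [intervalIntegral.integral_sub hg intervalIntegrable_const, intervalIntegral.integral_const,
      ← hx1, hγ r ⟨hle, le_rfl⟩, add_sub_cancel_left]
  rw [e]
  have := intervalIntegral.norm_integral_le_of_norm_le_const_ae (a := s) (b := r)
    (f := fun t => g t - v s y) (C := c s y + 4 * ε) ?_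
  · rw [abs_of_nonneg (by linarith)] at this
    linarith
  rw [ae_restrict_iff' measurableSet_Icc] at hae
  filter_upwards [hae] with t ht hm
  rw [Set.uIoc_of_le hle] at hm
  have htm : t ∈ Set.Icc s r := ⟨hm.1.le, hm.2⟩
  have h1 := ht htm
  have hts : |t - s| ≤ δ := by rw [abs_of_nonneg (by linarith [hm.1])]; linarith [hm.2]
  have h2 := hδ t s hts (γ t)
  have h3 : L * ‖γ t - y‖ ≤ ε := by
    refine le_trans (mul_le_mul_of_nonneg_left ((hsp t htm).trans ?_) hL) hδ2
    gcongr
    linarith [hm.2]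
  have h4 := (h.vL s (γ t) y).trans h3
  have h5 := (h.cL s (γ t) y).trans h3
  have h6 := norm_sub_le_norm_sub_add_norm_sub (g t) (v t (γ t)) (v s y)
  have h7 := norm_sub_le_norm_sub_add_norm_sub (v t (γ t)) (v s (γ t)) (v s y)
  have h8 := (abs_le.1 h2.1).2
  have h9 := (abs_le.1 h5).2
  linarith [h2.2]

def ChainP {d : ℕ} (q : ℕ → Euc d) (c : ℝ → Euc d → ℝ) (v : ℝ → Euc d → Euc d) (t0 : ℝ)
    (x0 x : Euc d) (j n N : ℕ) (f : ℕ →₀ ℕ) : Prop :=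
  ‖q (f 0) - x0‖ ≤ 1 / ((j:ℝ) + 1) ∧ ‖q (f N) - x‖ ≤ 1 / ((j:ℝ) + 1) ∧
    ∀ k < N, ‖q (f (k + 1)) - q (f k) - (n:ℝ)⁻¹ • v (t0 + k * (n:ℝ)⁻¹) (q (f k))‖
      ≤ (n:ℝ)⁻¹ * (c (t0 + k * (n:ℝ)⁻¹) (q (f k)) + 1 / ((j:ℝ) + 1))

theorem Reg.chains_of_hit {d : ℕ} {K L : ℝ} {c : ℝ → Euc d → ℝ} {v : ℝ → Euc d → Euc d}
    (h : Reg K L c v) {q : ℕ → Euc d} (hq : DenseRange q) {t0 t T : ℝ} (ht : t ∈ Set.Icc 0 T)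
    {x0 x : Euc d} (hR : Reachable c v t0 x0 (t0 + t) x) (j : ℕ) :
    ∃ n : ℕ, j + 1 ≤ n ∧ ∃ N : ℕ, (N:ℝ) ≤ T * n ∧ ∃ f : ℕ →₀ ℕ, ChainP q c v t0 x0 x j n N f := by
  obtain ⟨hK, hL⟩ := And.intro h.K0 h.L0
  set ε : ℝ := 1 / ((j:ℝ) + 1) with hε
  have hε0 : 0 < ε := by positivity
  obtain ⟨δ, hδ, hu⟩ := h.uc (ε / 8) (by positivity)
  set X := (L + 8) * (2 * K) + 1 with hX
  have hX0 : 0 < X := by positivity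
  set δ' := min δ (ε / 8 / X) with hδ'
  have hδ'0 : 0 < δ' := lt_min hδ (by positivity)
  have hδ'X : δ' * X ≤ ε / 8 := by rw [← le_div_iff₀ hX0]; exact min_le_right _ _
  have hA : L * (2 * K * δ') ≤ ε / 8 := by
    refine le_trans ?_ hδ'X
    rw [hX]; nlinarith [mul_nonneg hK hδ'0.le, mul_nonneg hL (mul_nonneg hK hδ'0.le)]
  have hB : 2 * K * δ' ≤ ε / 8 := by
    refine le_trans ?_ hδ'X
    rw [hX]; nlinarith [mul_nonneg hK hδ'0.le, mul_nonneg hL (mul_nonneg hK hδ'0.le)]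
  obtain ⟨n0, hn0⟩ := exists_nat_gt (1 / δ')
  set n := max (j + 1) n0 with hn
  have hnj : j + 1 ≤ n := le_max_left _ _
  have hnpos : (0:ℝ) < n := by exact_mod_cast (by omega : 0 < n)
  have hτδ : (n:ℝ)⁻¹ ≤ δ' := by
    rw [inv_le_comm₀ hnpos hδ'0, ← one_div]
    refine hn0.le.trans ?_
    exact_mod_cast le_max_right _ _
  set τ := (n:ℝ)⁻¹ with hτ
  have hτ0 : 0 < τ := inv_pos.2 hnpos
  have hτ1 : τ ≤ 1 := inv_le_one_of_one_le₀ (by exact_mod_cast (by omega : 1 ≤ n))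
  have hτn : τ * n = 1 := inv_mul_cancel₀ hnpos.ne'
  set N := ⌊t * n⌋₊ with hN
  have hNle : (N:ℝ) ≤ t * n := Nat.floor_le (mul_nonneg ht.1 hnpos.le)
  have hNlt : t * n < N + 1 := Nat.lt_floor_add_one _
  have hNτ : N * τ ≤ t := by
    have := mul_le_mul_of_nonneg_right hNle hτ0.le
    nlinarith
  have hNτ' : t - N * τ ≤ τ := by
    have := mul_le_mul_of_nonneg_right hNlt.le hτ0.le
    nlinarith
  obtain ⟨γ, hγ0, hγ1, hγ⟩ := hR.sub
  set η := τ * ε / (4 * (1 + L)) with hη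
  have hη0 : 0 < η := by positivity
  have hηX : η * (1 + L) = τ * ε / 4 := by rw [hη]; field_simp
  have hηε : η ≤ ε / 4 := by nlinarith [mul_nonneg hη0.le hL]
  choose i hi using fun y : Euc d => hq.exists_dist_lt y hη0
  let f : ℕ →₀ ℕ := Finsupp.onFinset (Finset.range (N + 1))
    (fun k => if k ≤ N then i (γ (t0 + k * τ)) else 0) (by
      intro k hk
      rw [Finset.mem_range]
      by_contra hc
      exact hk (if_neg (by omega)))
  have hf : ∀ k ≤ N, ‖q (f k) - γ (t0 + k * τ)‖ ≤ η := by
    intro k hk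
    have : f k = i (γ (t0 + k * τ)) := by simp [f, hk]
    rw [this, ← dist_eq_norm, dist_comm]
    exact (hi _).le
  have hmem : ∀ k ≤ N, t0 + k * τ ∈ Set.Icc t0 (t0 + t) := by
    intro k hk
    have : (k:ℝ) * τ ≤ N * τ := mul_le_mul_of_nonneg_right (by exact_mod_cast hk) hτ0.le
    exact ⟨by linarith [mul_nonneg (Nat.cast_nonneg (α := ℝ) k) hτ0.le], by linarith⟩
  refine ⟨n, hnj, N, hNle.trans (mul_le_mul_of_nonneg_right ht.2 hnpos.le), f, ?_, ?_, ?_⟩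
  · have := hf 0 (Nat.zero_le _)
    simp only [Nat.cast_zero, zero_mul, add_zero, hγ0] at this
    linarith
  · have h1 := hf N le_rfl
    have h2 := (hγ _ (hmem N le_rfl) (t0 + t) ⟨by linarith [ht.1], le_rfl⟩ (hmem N le_rfl).2).speed
      h.cK h.vK
    rw [hγ1, norm_sub_rev] at h2
    have h3 := norm_sub_le_norm_sub_add_norm_sub (q (f N)) (γ (t0 + N * τ)) x
    have h4 : 2 * K * (t0 + t - (t0 + N * τ)) ≤ 2 * K * δ' := by
      gcongr; linarith
    linarith
  · intro k hk
    have hk1 : t0 + k * τ ≤ t0 + (k + 1 : ℕ) * τ := by push_cast; nlinarith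
    have hd1 : t0 + (k + 1 : ℕ) * τ - (t0 + k * τ) = τ := by push_cast; ring
    have h1 := h.reach_est (δ := δ') (ε := ε / 8)
      (fun t t' htt => hu t t' (htt.trans (min_le_left _ _))) hA (by rw [hd1]; exact hτδ)
      (hγ _ (hmem k hk.le) _ (hmem (k + 1) hk) hk1)
    rw [hd1] at h1
    have h2 := hf k hk.le
    have h3 := hf (k + 1) hk
    set y := γ (t0 + k * τ)
    set z := γ (t0 + (k + 1 : ℕ) * τ)
    set y' := q (f k)
    set z' := q (f (k + 1))
    have h4 := h.vL (t0 + k * τ) y y'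
    have h5 := h.cL (t0 + k * τ) y y'
    rw [norm_sub_rev] at h2
    have h6 : L * ‖y - y'‖ ≤ L * η := mul_le_mul_of_nonneg_left h2 hL
    have e : z' - y' - τ • v (t0 + k * τ) y' = (z' - z) + (y - y') +
        ((z - y - τ • v (t0 + k * τ) y) + τ • (v (t0 + k * τ) y - v (t0 + k * τ) y')) := by
      rw [smul_sub]; abel
    rw [e]
    have h7 : ‖τ • (v (t0 + k * τ) y - v (t0 + k * τ) y')‖ ≤ τ * (L * η) := by
      rw [norm_smul, Real.norm_eq_abs, abs_of_pos hτ0]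
      exact mul_le_mul_of_nonneg_left (h4.trans h6) hτ0.le
    have h8 : c (t0 + k * τ) y ≤ c (t0 + k * τ) y' + L * η := by linarith [(abs_le.1 h5).2]
    have h9 : τ * (c (t0 + k * τ) y + 4 * (ε / 8)) ≤ τ * (c (t0 + k * τ) y' + L * η + 4 * (ε / 8)) :=
      mul_le_mul_of_nonneg_left (by linarith) hτ0.le
    have h10 : τ * (L * η) ≤ 1 * (L * η) := mul_le_mul_of_nonneg_right hτ1 (by positivity)
    refine (norm_add_le _ _).trans ((add_le_add (norm_add_le _ _) (norm_add_le _ _)).trans ?_)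
    nlinarith


def hitEv {d : ℕ} {Ω : Type*} (c : ℝ → Euc d → Ω → ℝ) (v : ℝ → Euc d → Ω → Euc d)
    (t0 : ℝ) (x0 x : Euc d) (T : ℝ) : Set Ω :=
  {ω | ∃ t ∈ Set.Icc 0 T, Reachable (fun a b => c a b ω) (fun a b => v a b ω) t0 x0 (t0 + t) x}

theorem norm_le_meas {d : ℕ} {Ω : Type*} [m : MeasurableSpace Ω] {f : Ω → ℝ} {g : Ω → Euc d}
    (hg : Measurable g) (hf : Measurable f) (y : Euc d) (a b e : ℝ) :
    MeasurableSet {ω | ‖y - a • g ω‖ ≤ b * (f ω + e)} := by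
  have h3 : Measurable (fun z : Euc d => ‖y - a • z‖) := by
    apply Continuous.measurable; fun_prop
  have h4 : Measurable (fun z : ℝ => b * (z + e)) := by
    apply Continuous.measurable; fun_prop
  exact measurableSet_le (h3.comp hg) (h4.comp hf)

theorem chainP_meas {d : ℕ} {Ω : Type*} [m : MeasurableSpace Ω] {c : ℝ → Euc d → Ω → ℝ}
    {v : ℝ → Euc d → Ω → Euc d} {t0 T : ℝ}
    (hc : ∀ s ∈ Set.Icc t0 (t0 + T), ∀ x, Measurable (c s x))
    (hv : ∀ s ∈ Set.Icc t0 (t0 + T), ∀ x, Measurable (v s x)) (q : ℕ → Euc d) (x0 x : Euc d)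
    (j n N : ℕ) (f : ℕ →₀ ℕ) (hn : j + 1 ≤ n) (hN : (N:ℝ) ≤ T * n) :
    MeasurableSet {ω | ChainP q (fun a b => c a b ω) (fun a b => v a b ω) t0 x0 x j n N f} := by
  have hn0 : (0:ℝ) < n := by exact_mod_cast (by omega : 0 < n)
  unfold ChainP
  rw [Set.ofPred_and, Set.ofPred_and]
  refine (MeasurableSet.const _).inter ((MeasurableSet.const _).inter ?_)
  rw [Set.ofPred_forall]
  refine MeasurableSet.iInter fun k => ?_
  rw [Set.ofPred_forall]
  refine MeasurableSet.iInter fun hk => ?_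
  have hmem : t0 + k * (n:ℝ)⁻¹ ∈ Set.Icc t0 (t0 + T) := by
    refine ⟨by have := inv_pos.2 hn0; linarith [mul_nonneg (Nat.cast_nonneg (α := ℝ) k) this.le], ?_⟩
    have h1 : (k:ℝ) ≤ T * n := le_trans (by exact_mod_cast hk.le) hN
    rw [← div_le_iff₀ hn0, div_eq_mul_inv] at h1
    linarith
  have h1 := hv _ hmem (q (f k))
  have h2 := hc _ hmem (q (f k))
  exact norm_le_meas h1 h2 _ _ _ _

theorem hitEv_meas {d : ℕ} {Ω : Type*} {c : ℝ → Euc d → Ω → ℝ} {v : ℝ → Euc d → Ω → Euc d}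
    {K L : ℝ} (h : ∀ ω, Reg K L (fun a b => c a b ω) (fun a b => v a b ω))
    (m : MeasurableSpace Ω) {t0 T : ℝ}
    (hc : ∀ s ∈ Set.Icc t0 (t0 + T), ∀ x, Measurable[m] (c s x))
    (hv : ∀ s ∈ Set.Icc t0 (t0 + T), ∀ x, Measurable[m] (v s x)) (x0 x : Euc d) :
    MeasurableSet[m] (hitEv c v t0 x0 x T) := by
  obtain ⟨q, hq⟩ : ∃ q : ℕ → Euc d, DenseRange q := ⟨_, TopologicalSpace.denseRange_denseSeq (Euc d)⟩
  have e : hitEv c v t0 x0 x T = ⋂ j : ℕ, ⋃ n : ℕ, ⋃ _ : j + 1 ≤ n, ⋃ N : ℕ, ⋃ _ : (N:ℝ) ≤ T * n,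
      ⋃ f : ℕ →₀ ℕ, {ω | ChainP q (fun a b => c a b ω) (fun a b => v a b ω) t0 x0 x j n N f} := by
    ext ω
    simp only [Set.mem_iInter, Set.mem_iUnion, Set.mem_ofPred_eq, exists_prop]
    constructor
    · rintro ⟨t, ht, hR⟩ j
      exact (h ω).chains_of_hit hq ht hR j
    · intro hj
      refine (h ω).hit_of_chains fun j => ?_
      obtain ⟨n, hn, N, hN, f, hf⟩ := hj j
      exact ⟨n, hn, N, hN, fun k => q (f k), hf⟩
  rw [e]
  exact MeasurableSet.iInter fun j => MeasurableSet.iUnion fun n => MeasurableSet.iUnion fun hn =>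
    MeasurableSet.iUnion fun N => MeasurableSet.iUnion fun hN => MeasurableSet.iUnion fun f =>
      chainP_meas (m := m) hc hv q x0 x j n N f hn hN

theorem sigmaPlus_meas {d : ℕ} {Ω : Type*} [MeasurableSpace Ω] {c : ℝ → Euc d → Ω → ℝ}
    {v : ℝ → Euc d → Ω → Euc d} {t s : ℝ} (hs : t ≤ s) (x : Euc d) :
    Measurable[sigmaPlus c v t] (fun ω => (c s x ω, v s x ω)) := by
  rw [measurable_iff_comap_le]
  exact le_iSup_of_le s (le_iSup_of_le hs (le_iSup_of_le x le_rfl))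

theorem sigmaMinus_meas {d : ℕ} {Ω : Type*} [MeasurableSpace Ω] {c : ℝ → Euc d → Ω → ℝ}
    {v : ℝ → Euc d → Ω → Euc d} {t s : ℝ} (hs : s ≤ t) (x : Euc d) :
    Measurable[sigmaMinus c v t] (fun ω => (c s x ω, v s x ω)) := by
  rw [measurable_iff_comap_le]
  exact le_iSup_of_le s (le_iSup_of_le hs (le_iSup_of_le x le_rfl))

theorem sigmaMinus_mono {d : ℕ} {Ω : Type*} [MeasurableSpace Ω] {c : ℝ → Euc d → Ω → ℝ}
    {v : ℝ → Euc d → Ω → Euc d} {s t : ℝ} (hs : s ≤ t) : sigmaMinus c v s ≤ sigmaMinus c v t :=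
  iSup_mono fun _ => iSup_mono' fun h => ⟨h.trans hs, le_rfl⟩

/-- strict hitting event -/
def hitLt {d : ℕ} {Ω : Type*} (c : ℝ → Euc d → Ω → ℝ) (v : ℝ → Euc d → Ω → Euc d)
    (t0 : ℝ) (x0 x : Euc d) (T : ℝ) : Set Ω :=
  {ω | ∃ t, 0 ≤ t ∧ t < T ∧
    Reachable (fun a b => c a b ω) (fun a b => v a b ω) t0 x0 (t0 + t) x}

theorem hitLt_eq {d : ℕ} {Ω : Type*} (c : ℝ → Euc d → Ω → ℝ) (v : ℝ → Euc d → Ω → Euc d)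
    (t0 : ℝ) (x0 x : Euc d) (T : ℝ) :
    hitLt c v t0 x0 x T = ⋃ i : ℕ, hitEv c v t0 x0 x (T - 1 / ((i:ℝ) + 1)) := by
  ext ω
  simp only [hitLt, hitEv, Set.mem_iUnion, Set.mem_ofPred_eq]
  constructor
  · rintro ⟨t, h0, hT, hR⟩
    obtain ⟨i, hi⟩ := exists_nat_one_div_lt (sub_pos.2 hT)
    exact ⟨i, t, ⟨h0, by linarith⟩, hR⟩
  · rintro ⟨i, t, ⟨h0, hT⟩, hR⟩
    have : 0 < 1 / ((i:ℝ) + 1) := by positivity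
    exact ⟨t, h0, by linarith, hR⟩

theorem hitLt_plus {d : ℕ} {Ω : Type*} [MeasurableSpace Ω] {c : ℝ → Euc d → Ω → ℝ}
    {v : ℝ → Euc d → Ω → Euc d}
    {K L : ℝ} (h : ∀ ω, Reg K L (fun a b => c a b ω) (fun a b => v a b ω)) (t0 : ℝ) (x0 x : Euc d)
    (T : ℝ) : MeasurableSet[sigmaPlus c v t0] (hitLt c v t0 x0 x T) := by
  rw [hitLt_eq]
  exact MeasurableSet.iUnion fun i => hitEv_meas h _
    (fun s hs x => measurable_fst.comp (sigmaPlus_meas hs.1 x))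
    (fun s hs x => measurable_snd.comp (sigmaPlus_meas hs.1 x)) _ _

theorem hitLt_minus {d : ℕ} {Ω : Type*} [MeasurableSpace Ω] {c : ℝ → Euc d → Ω → ℝ}
    {v : ℝ → Euc d → Ω → Euc d}
    {K L : ℝ} (h : ∀ ω, Reg K L (fun a b => c a b ω) (fun a b => v a b ω)) (t0 : ℝ) (x0 x : Euc d)
    (T : ℝ) : MeasurableSet[sigmaMinus c v (t0 + T)] (hitLt c v t0 x0 x T) := by
  rw [hitLt_eq]
  refine MeasurableSet.iUnion fun i => ?_
  have : 0 < 1 / ((i:ℝ) + 1) := by positivity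
  exact hitEv_meas h _
    (fun s hs x => measurable_fst.comp (sigmaMinus_meas (hs.2.trans (by linarith)) x))
    (fun s hs x => measurable_snd.comp (sigmaMinus_meas (hs.2.trans (by linarith)) x)) _ _

theorem hitLt_tt {d : ℕ} {Ω : Type*} {c : ℝ → Euc d → Ω → ℝ}
    {v : ℝ → Euc d → Ω → Euc d} {t0 : ℝ} {x0 x : Euc d}
    (hne : ∀ ω, ∃ t, 0 ≤ t ∧ Reachable (fun a b => c a b ω) (fun a b => v a b ω) t0 x0 (t0 + t) x)
    (T : ℝ) : hitLt c v t0 x0 x T =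
      {ω | travelTime (fun a b => c a b ω) (fun a b => v a b ω) t0 x0 x < T} := by
  ext ω
  simp only [hitLt, travelTime, reachSet, Set.mem_ofPred_eq]
  rw [csInf_lt_iff]
  · simp only [Set.mem_ofPred_eq]
    exact ⟨fun ⟨t, a, b, e⟩ => ⟨t, ⟨a, e⟩, b⟩, fun ⟨t, ⟨a, e⟩, b⟩ => ⟨t, a, b, e⟩⟩
  · exact ⟨0, fun t ht => ht.1⟩
  · exact hne ω

theorem lln_step {Ω : Type*} [MeasurableSpace Ω] (P : Measure Ω) [IsProbabilityMeasure P]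
    {B : Set Ω} (hB : MeasurableSet B) {D : Ω → ℕ} (hD : Measurable D) {A : ℕ} (hA : ∀ ω, D ω ≤ A)
    {β l : ℝ} (hl : 0 ≤ l) (hlA : l * A ≤ 1)
    (hmix : P.real B * β ≤ ∑ n ∈ Finset.Icc 1 A, P.real ({ω | n ≤ D ω} ∩ B)) :
    ∫ ω in B, Real.exp (-(l * D ω)) ∂P ≤ P.real B * (1 - l * β + l ^ 2 * A ^ 2) := by
  have hDi : IntegrableOn (fun ω => (D ω : ℝ)) B P := by
    have h2 : Measurable fun n : ℕ => (n:ℝ) := measurable_from_top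
    exact Integrable.of_bound (h2.comp hD).aestronglyMeasurable A (Eventually.of_forall fun ω => by
      simpa using hA ω)
  have h1 : ∫ ω in B, (D ω : ℝ) ∂P = ∑ n ∈ Finset.Icc 1 A, P.real ({ω | n ≤ D ω} ∩ B) := by
    have : ∀ ω, (D ω : ℝ) = ∑ n ∈ Finset.Icc 1 A, ({ω | n ≤ D ω}).indicator (fun _ => (1:ℝ)) ω := by
      intro ω
      simp only [Set.indicator_apply, Set.mem_ofPred_eq]
      rw [← Finset.sum_filter, Finset.sum_const, nsmul_eq_mul, mul_one]
      have : Finset.filter (fun n => n ≤ D ω) (Finset.Icc 1 A) = Finset.Icc 1 (D ω) := by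
        ext n; have := hA ω; simp only [Finset.mem_filter, Finset.mem_Icc]; omega
      rw [this]; simp
    simp_rw [this]
    rw [integral_finsetSum]
    · refine Finset.sum_congr rfl fun n _ => ?_
      have hm : MeasurableSet {ω | n ≤ D ω} := hD measurableSet_Ici
      rw [integral_indicator hm]
      simp [Measure.real, Measure.restrict_apply hm]
    · intro n _
      exact (integrable_const _).indicator (hD measurableSet_Ici)
  have h2 : ∫ ω in B, Real.exp (-(l * D ω)) ∂P ≤
      ∫ ω in B, ((1 + l ^ 2 * A ^ 2) - l * (D ω : ℝ)) ∂P := by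
    refine integral_mono_of_nonneg (Eventually.of_forall fun ω => (Real.exp_pos _).le) ?_ ?_
    · exact (integrable_const _).sub (hDi.const_mul _)
    · refine Eventually.of_forall fun ω => ?_
      have hd : (D ω : ℝ) ≤ A := by exact_mod_cast hA ω
      have h3 : l * D ω ≤ l * A := mul_le_mul_of_nonneg_left hd hl
      have h0 : 0 ≤ l * D ω := by positivity
      have h4 := (abs_le.1 (Real.abs_exp_sub_one_sub_id_le (x := -(l * D ω))
        (by rw [abs_neg, abs_of_nonneg h0]; linarith))).2
      have h5 : (l * D ω) ^ 2 ≤ (l * A) ^ 2 := pow_le_pow_left₀ h0 h3 2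
      simp only
      rw [← mul_pow]
      linarith [neg_sq (l * (D ω : ℝ))]
  refine h2.trans ?_
  rw [integral_sub (integrable_const _) (hDi.const_mul _), integral_const_mul, h1]
  simp only [integral_const, smul_eq_mul, measureReal_restrict_apply_univ]
  have := mul_le_mul_of_nonneg_left hmix hl
  linarith

theorem lln_exp {Ω : Type*} [MeasurableSpace Ω] (P : Measure Ω) [IsProbabilityMeasure P]
    {S : ℕ → Ω → ℕ} {D : ℕ → ℕ → Ω → ℕ} {A : ℕ} (hS0 : ∀ ω, S 0 ω = 0)
    (hS : ∀ k ω, S (k + 1) ω = S k ω + D k (S k ω) ω) (hD : ∀ k m, Measurable (D k m))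
    (hSm : ∀ k, Measurable (S k)) (hA : ∀ k m ω, D k m ω ≤ A) {β l : ℝ} (hl : 0 ≤ l)
    (hlA : l * A ≤ 1)
    (hmix : ∀ k m, P.real {ω | S k ω = m} * β ≤
      ∑ n ∈ Finset.Icc 1 A, P.real ({ω | n ≤ D k m ω} ∩ {ω | S k ω = m})) (k : ℕ) :
    ∫ ω, Real.exp (-(l * S k ω)) ∂P ≤ Real.exp (k * (-(l * β) + l ^ 2 * A ^ 2)) := by
  have hSle : ∀ k ω, S k ω ≤ k * A := by
    intro k ω
    induction k with
    | zero => simp [hS0]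
    | succ k ih => rw [hS, Nat.succ_mul]; exact add_le_add ih (hA _ _ _)
  have hdec : ∀ (k : ℕ) (F : ℕ → Ω → ℝ), (∀ m, Measurable (F m)) → (∀ m ω, |F m ω| ≤ 1) →
      ∫ ω, F (S k ω) ω ∂P = ∑ m ∈ Finset.range (k * A + 1), ∫ ω in {ω | S k ω = m}, F m ω ∂P := by
    intro k F hF hF1
    have hm : ∀ m, MeasurableSet {ω | S k ω = m} := fun m => hSm k (measurableSet_singleton m)
    have e : ∀ ω, F (S k ω) ω = ∑ m ∈ Finset.range (k * A + 1),
        ({ω | S k ω = m}).indicator (F m) ω := by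
      intro ω
      rw [Finset.sum_eq_single (S k ω)]
      · simp
      · intro m _ hne; simp [Set.indicator_apply, hne.symm]
      · intro h; exact absurd (Finset.mem_range.2 (Nat.lt_succ_of_le (hSle k ω))) h
    simp_rw [e]
    rw [integral_finsetSum]
    · exact Finset.sum_congr rfl fun m _ => integral_indicator (hm m)
    · intro m _
      refine Integrable.indicator ?_ (hm m)
      exact Integrable.of_bound (hF m).aestronglyMeasurable 1 (Eventually.of_forall (hF1 m))
  have hexp : ∀ x : ℝ, 0 ≤ x → |Real.exp (-x)| ≤ 1 := fun x hx => by
    rw [abs_of_pos (Real.exp_pos _)]; exact Real.exp_le_one_iff.2 (by linarith)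
  induction k with
  | zero => simp [hS0]
  | succ k ih =>
    have hρ := Real.add_one_le_exp (-(l * β) + l ^ 2 * A ^ 2)
    set ρ := Real.exp (-(l * β) + l ^ 2 * A ^ 2)
    have e1 : ∫ ω, Real.exp (-(l * S (k + 1) ω)) ∂P = ∑ m ∈ Finset.range (k * A + 1),
        Real.exp (-(l * m)) * ∫ ω in {ω | S k ω = m}, Real.exp (-(l * D k m ω)) ∂P := by
      have := hdec k (fun m ω => Real.exp (-(l * ((m : ℝ) + D k m ω)))) (fun m => by
        have := hD k m
        have h2 : Measurable fun n : ℕ => Real.exp (-(l * ((m : ℝ) + n))) := measurable_from_top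
        exact h2.comp this) (fun m ω => hexp _ (by positivity))
      simp only [hS, Nat.cast_add] 
      rw [this]
      refine Finset.sum_congr rfl fun m _ => ?_
      rw [← integral_const_mul]
      congr 1
      ext ω
      rw [← Real.exp_add]; congr 1; ring
    have e2 := hdec k (fun m ω => Real.exp (-(l * (m : ℝ)))) (fun m => measurable_const)
      (fun m ω => hexp _ (by positivity))
    rw [e1]
    calc _ ≤ ∑ m ∈ Finset.range (k * A + 1), (Real.exp (-(l * m)) * P.real {ω | S k ω = m}) * ρ := by
          refine Finset.sum_le_sum fun m _ => ?_
          rw [mul_assoc]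
          refine mul_le_mul_of_nonneg_left ?_ (Real.exp_pos _).le
          refine (lln_step P (hSm k (measurableSet_singleton m)) (hD k m) (hA k m) hl hlA
            (hmix k m)).trans ?_
          exact mul_le_mul_of_nonneg_left (by linarith) measureReal_nonneg
      _ = (∫ ω, Real.exp (-(l * S k ω)) ∂P) * ρ := by
          rw [e2, Finset.sum_mul]
          refine Finset.sum_congr rfl fun m _ => ?_
          simp [mul_comm]
      _ ≤ Real.exp (k * (-(l * β) + l ^ 2 * A ^ 2)) * ρ :=
          mul_le_mul_of_nonneg_right ih (Real.exp_pos _).le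
      _ = _ := by rw [← Real.exp_add]; congr 1; push_cast; ring

theorem lln_tendsto {Ω : Type*} [MeasurableSpace Ω] (P : Measure Ω) [IsProbabilityMeasure P]
    {S : ℕ → Ω → ℕ} {D : ℕ → ℕ → Ω → ℕ} {A : ℕ} (hS0 : ∀ ω, S 0 ω = 0)
    (hS : ∀ k ω, S (k + 1) ω = S k ω + D k (S k ω) ω) (hD : ∀ k m, Measurable (D k m))
    (hSm : ∀ k, Measurable (S k)) (hA : ∀ k m ω, D k m ω ≤ A) {β ε : ℝ} (hε : 0 < ε)
    (hmix : ∀ k m, P.real {ω | S k ω = m} * β ≤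
      ∑ n ∈ Finset.Icc 1 A, P.real ({ω | n ≤ D k m ω} ∩ {ω | S k ω = m})) :
    Tendsto (fun N : ℕ => P.real {ω | (S N ω : ℝ) ≤ N * (β - ε)}) atTop (nhds 0) := by
  set l : ℝ := min (1 / ((A:ℝ) + 1)) (ε / (2 * ((A:ℝ) + 1) ^ 2)) with hld
  have hA1 : (0:ℝ) < A + 1 := by positivity
  have hl : 0 < l := lt_min (by positivity) (by positivity)
  have hlA : l * A ≤ 1 := by
    have : l * (A + 1) ≤ 1 := by rw [← le_div_iff₀ hA1]; exact min_le_left _ _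
    linarith
  have hlA2 : l * A ^ 2 ≤ ε / 2 := by
    have : l * (2 * ((A:ℝ) + 1) ^ 2) ≤ ε := by
      rw [← le_div_iff₀ (by positivity)]; exact min_le_right _ _
    have h2 : (A:ℝ) ^ 2 ≤ (A + 1) ^ 2 := by gcongr; linarith
    have := mul_le_mul_of_nonneg_left h2 hl.le
    linarith
  have hb : ∀ N : ℕ, P.real {ω | (S N ω : ℝ) ≤ N * (β - ε)} ≤ Real.exp (-(l * ε / 2)) ^ N := by
    intro N
    have h1 := lln_exp P hS0 hS hD hSm hA hl.le hlA hmix N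
    have h2 := mul_meas_ge_le_integral_of_nonneg (μ := P) (f := fun ω => Real.exp (-(l * S N ω)))
      (Eventually.of_forall fun ω => (Real.exp_pos _).le)
      (Integrable.of_bound (by
        have h2 : Measurable fun n : ℕ => Real.exp (-(l * (n:ℝ))) := measurable_from_top
        exact (h2.comp (hSm N)).aestronglyMeasurable) 1 (Eventually.of_forall fun ω => by
          rw [Real.norm_eq_abs, abs_of_pos (Real.exp_pos _)]
          exact Real.exp_le_one_iff.2 (by have : 0 ≤ l * (S N ω : ℝ) := by positivity
                                          linarith))) (Real.exp (-(l * (N * (β - ε)))))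
    have h3 : {ω | (S N ω : ℝ) ≤ N * (β - ε)} ⊆
        {ω | Real.exp (-(l * (N * (β - ε)))) ≤ Real.exp (-(l * S N ω))} := by
      intro ω hω
      exact Real.exp_le_exp.2 (neg_le_neg (mul_le_mul_of_nonneg_left hω hl.le))
    have h4 := measureReal_mono h3 (μ := P)
    have h5 := (mul_le_mul_of_nonneg_left h4 (Real.exp_pos (-(l * (N * (β - ε))))).le).trans
      (h2.trans h1)
    rw [mul_comm, ← le_div_iff₀ (Real.exp_pos _), ← Real.exp_sub] at h5
    refine h5.trans ?_
    rw [← Real.exp_nat_mul]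
    refine Real.exp_le_exp.2 ?_
    have h6 : (N:ℝ) * (l * (l * A ^ 2)) ≤ N * (l * (ε / 2)) :=
      mul_le_mul_of_nonneg_left (mul_le_mul_of_nonneg_left hlA2 hl.le) (Nat.cast_nonneg _)
    linarith
  refine squeeze_zero (fun _ => measureReal_nonneg) hb ?_
  exact tendsto_pow_atTop_nhds_zero_of_lt_one (Real.exp_pos _).le
    (Real.exp_lt_one_iff.2 (neg_lt_zero.2 (by positivity)))

def hit {d : ℕ} {Ω : Type*} (R : Ω → ℝ → Euc d → ℝ → Euc d → Prop)
    (t0 : ℝ) (x0 x : Euc d) (T : ℝ) : Set Ω :=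
  {ω | ∃ t, 0 ≤ t ∧ t < T ∧ R ω t0 x0 (t0 + t) x}

structure Mdl {d : ℕ} {Ω : Type*} [mΩ : MeasurableSpace Ω] (P : Measure Ω)
    (R : Ω → ℝ → Euc d → ℝ → Euc d → Prop) (C0 V : ℝ) (φ : ℝ → ℝ) (mm mp : ℝ → MeasurableSpace Ω)
    (Υ : ℝ × Euc d → Ω → Ω) : Prop where
  refl : ∀ ω t x, R ω t x t x
  trans : ∀ ω t x s y r z, R ω t x s y → R ω s y r z → R ω t x r z
  C1 : 1 ≤ C0
  V0 : 0 < V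
  fish : ∀ ω s x t y, C0 * (1 + ‖y - x‖) ≤ t - s → R ω s x t y
  speed : ∀ ω s x t y, R ω s x t y → ‖y - x‖ ≤ V * (t - s)
  le : ∀ ω s x t y, R ω s x t y → s ≤ t
  shift : ∀ s y ω t0 x0 t1 x1, R (Υ (s, y) ω) t0 x0 t1 x1 ↔ R ω (t0 + s) (x0 + y) (t1 + s) (x1 + y)
  inv : ∀ p A, P (Υ p ⁻¹' A) = P A
  mmono : Monotone mm
  mmle : ∀ t, mm t ≤ mΩ
  mple : ∀ t, mp t ≤ mΩ
  hitm : ∀ t0 x0 x T, MeasurableSet[mm (t0 + T)] (hit R t0 x0 x T)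
  hitp : ∀ t0 x0 x T, MeasurableSet[mp t0] (hit R t0 x0 x T)
  mix : ∀ t s E F, MeasurableSet[mm t] E → MeasurableSet[mp (t + s)] F →
    P.real F * P.real E - φ s * P.real E ≤ P.real (F ∩ E)
  φ0 : Tendsto φ atTop (nhds 0)

open Classical in
def DD {d : ℕ} {Ω : Type*} (R : Ω → ℝ → Euc d → ℝ → Euc d → Prop) (p : Euc d) (T : ℝ) (A : ℕ)
    (t0 : ℝ) (m : ℕ) (ω : Ω) : ℕ :=
  Nat.findGreatest (fun n => ω ∈ hit R t0 ((m:ℝ) • p) (((m + n : ℕ) : ℝ) • p) T) A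

open Classical in
theorem DD_le {d : ℕ} {Ω : Type*} (R : Ω → ℝ → Euc d → ℝ → Euc d → Prop) (p : Euc d) (T : ℝ)
    (A : ℕ) (t0 : ℝ) (m : ℕ) (ω : Ω) : DD R p T A t0 m ω ≤ A := Nat.findGreatest_le _

open Classical in
theorem le_DD {d : ℕ} {Ω : Type*} {R : Ω → ℝ → Euc d → ℝ → Euc d → Prop} {p : Euc d} {T : ℝ}
    {A : ℕ} {t0 : ℝ} {m : ℕ} {ω : Ω} {n : ℕ} : n ≤ DD R p T A t0 m ω ↔
      n = 0 ∨ ∃ j, n ≤ j ∧ j ≤ A ∧ ω ∈ hit R t0 ((m:ℝ) • p) (((m + j : ℕ) : ℝ) • p) T := by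
  unfold DD
  constructor
  · intro h
    rcases Nat.eq_zero_or_pos n with h0 | h0
    · exact Or.inl h0
    · right
      refine ⟨_, h, Nat.findGreatest_le _, ?_⟩
      exact Nat.findGreatest_of_ne_zero (P := fun n => ω ∈ hit R t0 ((m:ℝ) • p)
        (((m + n : ℕ) : ℝ) • p) T) rfl (by omega)
  · rintro (h | ⟨j, h1, h2, h3⟩)
    · omega
    · exact h1.trans (Nat.le_findGreatest h2 h3)

theorem DD_meas {d : ℕ} {Ω : Type*} {R : Ω → ℝ → Euc d → ℝ → Euc d → Prop} (p : Euc d) (T : ℝ)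
    (A : ℕ) (t0 : ℝ) (m : ℕ) (M : MeasurableSpace Ω)
    (h : ∀ x0 x, MeasurableSet[M] (hit R t0 x0 x T)) : Measurable[M] (DD R p T A t0 m) := by
  refine measurable_of_Ici fun n => ?_
  have : DD R p T A t0 m ⁻¹' Set.Ici n = {_ω : Ω | n = 0} ∪ ⋃ j : ℕ, ⋃ _ : n ≤ j, ⋃ _ : j ≤ A,
      hit R t0 ((m:ℝ) • p) (((m + j : ℕ) : ℝ) • p) T := by
    ext ω
    simp only [Set.mem_preimage, Set.mem_Ici, le_DD, Set.mem_union, Set.mem_iUnion, exists_prop,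
      Set.mem_ofPred_eq]
  rw [this]
  exact (MeasurableSet.const _).union (MeasurableSet.iUnion fun j => MeasurableSet.iUnion fun _ =>
    MeasurableSet.iUnion fun _ => h _ _)

def SS {d : ℕ} {Ω : Type*} (R : Ω → ℝ → Euc d → ℝ → Euc d → Prop) (p : Euc d) (T s : ℝ) (A : ℕ) :
    ℕ → Ω → ℕ
  | 0 => fun _ => 0
  | k + 1 => fun ω => SS R p T s A k ω + DD R p T A (k * (T + s)) (SS R p T s A k ω) ω

section
variable {d : ℕ} {Ω : Type*} [mΩ : MeasurableSpace Ω] {P : Measure Ω}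
    {R : Ω → ℝ → Euc d → ℝ → Euc d → Prop} {C0 V : ℝ} {φ : ℝ → ℝ} {mm mp : ℝ → MeasurableSpace Ω}
    {Υ : ℝ × Euc d → Ω → Ω}

theorem Mdl.SS_meas (h : Mdl P R C0 V φ mm mp Υ) (p : Euc d) {T s : ℝ} (hs : 0 ≤ s) (hT : 0 ≤ T)
    (A k m : ℕ) : MeasurableSet[mm (k * (T + s) - s)] {ω | SS R p T s A k ω = m} := by
  induction k generalizing m with
  | zero => exact @MeasurableSet.const _ (mm _) (0 = m)
  | succ k ih =>
    have : {ω | SS R p T s A (k + 1) ω = m} = ⋃ j : ℕ, ⋃ _ : j ≤ m, {ω | SS R p T s A k ω = j} ∩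
        {ω | DD R p T A (k * (T + s)) j ω = m - j} := by
      ext ω
      simp only [SS, Set.mem_iUnion, Set.mem_inter_iff, Set.mem_ofPred_eq, exists_prop]
      constructor
      · intro hm
        exact ⟨_, by omega, rfl, by omega⟩
      · rintro ⟨j, h1, h2, h3⟩
        rw [h2, h3]; omega
    rw [this]
    have e : ((k + 1 : ℕ) : ℝ) * (T + s) - s = k * (T + s) + T := by push_cast; ring
    rw [e]
    refine MeasurableSet.iUnion fun j => MeasurableSet.iUnion fun _ => MeasurableSet.inter ?_ ?_
    · exact h.mmono (by linarith) _ (ih j)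
    · exact DD_meas p T A _ j _ (fun x0 x => h.hitm _ x0 x T) (measurableSet_singleton _)

theorem Mdl.SS_reach (h : Mdl P R C0 V φ mm mp Υ) (p : Euc d) {T s : ℝ} (hs : C0 ≤ s) (hT : 0 < T)
    (A k : ℕ) (ω : Ω) : R ω 0 0 (k * (T + s)) ((SS R p T s A k ω : ℝ) • p) := by
  induction k with
  | zero => simpa [SS] using h.refl ω 0 0
  | succ k ih =>
    set m := SS R p T s A k ω
    have hh : ω ∈ hit R (k * (T + s)) ((m:ℝ) • p)
        (((m + DD R p T A (k * (T + s)) m ω : ℕ) : ℝ) • p) T := by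
      rcases Nat.eq_zero_or_pos (DD R p T A (k * (T + s)) m ω) with h0 | h0
      · exact ⟨0, le_rfl, hT, by rw [h0]; simpa using h.refl ω _ _⟩
      · rcases le_DD.1 (le_refl (DD R p T A (k * (T + s)) m ω)) with h1 | ⟨j, h1, h2, h3⟩
        · omega
        · have h4 := le_DD.2 (Or.inr ⟨j, le_rfl, h2, h3⟩)
          rwa [le_antisymm h1 h4]
    obtain ⟨t, ht0, htT, hR⟩ := hh
    refine h.trans _ _ _ _ _ _ _ ih (h.trans _ _ _ _ _ _ _ hR (h.fish _ _ _ _ _ ?_))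
    have e : SS R p T s A (k + 1) ω = m + DD R p T A (k * (T + s)) m ω := rfl
    rw [e, sub_self]
    push_cast
    rw [norm_zero]
    linarith

/-- stationarity of D -/
theorem Mdl.DD_stat (h : Mdl P R C0 V φ mm mp Υ) (p : Euc d) (T : ℝ) (A : ℕ) (t0 : ℝ) (m n : ℕ) :
    P {ω | n ≤ DD R p T A t0 m ω} = P {ω | n ≤ DD R p T A 0 0 ω} := by
  rw [← h.inv (t0, (m:ℝ) • p) {ω | n ≤ DD R p T A 0 0 ω}]
  congr 1
  ext ω
  simp only [Set.mem_preimage, Set.mem_ofPred_eq, le_DD, hit, h.shift]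
  have e : ∀ j : ℕ, (j : ℝ) • p + (m:ℝ) • p = ((m + j : ℕ) : ℝ) • p := fun j => by
    rw [← add_smul]; congr 1; push_cast; ring
  simp only [e, Nat.cast_zero, zero_smul, zero_add, add_comm _ t0, add_zero]

def muT (P : Measure Ω) (R : Ω → ℝ → Euc d → ℝ → Euc d → Prop) (V : ℝ) (p : Euc d) (T : ℝ) : ℝ :=
  ∑ n ∈ Finset.Icc 1 ⌊V * T / ‖p‖⌋₊, P.real {ω | n ≤ DD R p T ⌊V * T / ‖p‖⌋₊ 0 0 ω}

theorem Mdl.walk [IsProbabilityMeasure P] (h : Mdl P R C0 V φ mm mp Υ) (p : Euc d) {T s : ℝ}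
    (hs : C0 ≤ s) (hT : 0 < T) {ε : ℝ} (hε : 0 < ε) :
    Tendsto (fun N : ℕ => P.real {ω | (SS R p T s ⌊V * T / ‖p‖⌋₊ N ω : ℝ) ≤
      N * (muT P R V p T - φ s * ⌊V * T / ‖p‖⌋₊ - ε)}) atTop (nhds 0) := by
  have hs0 : 0 ≤ s := by linarith [h.C1]
  set A := ⌊V * T / ‖p‖⌋₊ with hA
  refine lln_tendsto P (D := fun k m => DD R p T A (k * (T + s)) m) (A := A) (fun ω => rfl)
    (fun k ω => rfl) (fun k m => DD_meas p T A _ m _ fun x0 x => h.mmle _ _ (h.hitm _ x0 x T))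
    (fun k => ?_) (fun k m ω => DD_le _ _ _ _ _ _ _) hε fun k m => ?_
  · refine measurable_to_nat fun ω => ?_
    exact h.mmle _ _ (h.SS_meas p hs0 hT.le A k _)
  · have h1 : ∀ n : ℕ, P.real {ω | n ≤ DD R p T A 0 0 ω} * P.real {ω | SS R p T s A k ω = m}
        - φ s * P.real {ω | SS R p T s A k ω = m} ≤
        P.real ({ω | n ≤ DD R p T A (k * (T + s)) m ω} ∩ {ω | SS R p T s A k ω = m}) := by
      intro n
      have := h.mix (k * (T + s) - s) s {ω | SS R p T s A k ω = m}
        {ω | n ≤ DD R p T A (k * (T + s)) m ω} (h.SS_meas p hs0 hT.le A k m) (by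
          rw [sub_add_cancel]
          exact DD_meas p T A _ m _ (fun x0 x => h.hitp _ x0 x T) measurableSet_Ici)
      rwa [measureReal_def, h.DD_stat, ← measureReal_def] at this
    refine le_trans (le_of_eq ?_) (Finset.sum_le_sum fun n _ => h1 n)
    rw [Finset.sum_sub_distrib, ← Finset.sum_mul, Finset.sum_const, Nat.card_Icc, nsmul_eq_mul, muT,
      ← hA]
    push_cast
    ring
end

section
variable {d : ℕ} {Ω : Type*} [mΩ : MeasurableSpace Ω] {P : Measure Ω}
    {R : Ω → ℝ → Euc d → ℝ → Euc d → Prop} {C0 V : ℝ} {φ : ℝ → ℝ} {mm mp : ℝ → MeasurableSpace Ω}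
    {Υ : ℝ × Euc d → Ω → Ω}

def Good (P : Measure Ω) (R : Ω → ℝ → Euc d → ℝ → Euc d → Prop) (x : Euc d) : Prop :=
  Tendsto (fun t : ℝ => P.real {ω | ¬ R ω 0 0 t (t • x)}) atTop (nhds 0)

def Bad (P : Measure Ω) (R : Ω → ℝ → Euc d → ℝ → Euc d → Prop) (x : Euc d) : Prop :=
  Tendsto (fun t : ℝ => P.real {ω | R ω 0 0 t (t • x)}) atTop (nhds 0)

theorem Mdl.good_ball (h : Mdl P R C0 V φ mm mp Υ) {x : Euc d} (hx : C0 * ‖x‖ ≤ 1 / 2) :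
    Good P R x := by
  refine tendsto_const_nhds.congr' ?_
  filter_upwards [eventually_ge_atTop (2 * C0), eventually_ge_atTop 0] with t ht h0
  have : {ω | ¬ R ω 0 0 t (t • x)} = ∅ := by
    ext ω
    simp only [Set.mem_ofPred_eq, Set.mem_empty_iff_false, not_not, iff_false]
    refine h.fish _ _ _ _ _ ?_
    rw [sub_zero, norm_smul, Real.norm_eq_abs, abs_of_nonneg h0]
    have := mul_le_mul_of_nonneg_left hx h0
    linarith
  rw [this]; simp

theorem Mdl.good_of_rate [IsProbabilityMeasure P] (h : Mdl P R C0 V φ mm mp Υ) {p : Euc d}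
    (hp : p ≠ 0) {ρ r : ℝ} (hρ : 0 < ρ) (hr : ρ < r)
    (hW : ∃ᶠ T in atTop, r * T ≤ muT P R V p T) : Good P R (ρ • p) := by
  have hp0 : 0 < ‖p‖ := norm_pos_iff.2 hp
  have hV := h.V0
  set B := V / ‖p‖ with hB
  have hB0 : 0 < B := div_pos hV hp0
  set ε := (r - ρ) / 4 with hε
  have hε0 : 0 < ε := by rw [hε]; linarith
  obtain ⟨s, hs, hsφ⟩ : ∃ s, C0 ≤ s ∧ φ s ≤ ε / B :=
    ((eventually_ge_atTop C0).and (h.φ0.eventually_le_const (div_pos hε0 hB0))).exists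
  obtain ⟨T, hTμ, hT1, hTs⟩ := (hW.and_eventually ((eventually_ge_atTop 1).and
    (eventually_ge_atTop (ρ * s / ε)))).exists
  have hT0 : 0 < T := by linarith
  rw [div_le_iff₀ hε0] at hTs
  have hs0 : 0 < s := by linarith [h.C1]
  have hwalk := h.walk p hs hT0 (ε := ε * T) (by positivity)
  set A := ⌊V * T / ‖p‖⌋₊ with hA
  have hAB : (A:ℝ) ≤ B * T := by
    refine (Nat.floor_le (by positivity)).trans (le_of_eq ?_)
    rw [hB]; ring
  set β := muT P R V p T - φ s * A - ε * T with hβ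
  have hβ1 : (ρ + 2 * ε) * T ≤ β := by
    have h1 : φ s * A ≤ ε * T := by
      calc φ s * A ≤ ε / B * A := mul_le_mul_of_nonneg_right hsφ (Nat.cast_nonneg _)
        _ ≤ ε / B * (B * T) := mul_le_mul_of_nonneg_left hAB (by positivity)
        _ = ε * T := by field_simp
    have h2 : r = ρ + 4 * ε := by rw [hε]; ring
    rw [h2] at hTμ
    rw [hβ]
    linarith
  have hβ0 : 0 < β := lt_of_lt_of_le (by positivity) hβ1
  set θ := (ρ + ε) / (ρ + 2 * ε) with hθ
  have hθ0 : 0 < θ := by positivity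
  have hθ1 : θ < 1 := by rw [hθ, div_lt_one (by positivity)]; linarith
  have hθβ : ρ * (T + s) ≤ θ * β := by
    have h1 : θ * ((ρ + 2 * ε) * T) = (ρ + ε) * T := by rw [hθ]; field_simp
    have := mul_le_mul_of_nonneg_left hβ1 hθ0.le
    linarith
  have hN : Tendsto (fun t : ℝ => ⌈ρ * t / β⌉₊) atTop atTop :=
    tendsto_nat_ceil_atTop.comp
      (Tendsto.atTop_div_const hβ0 (Tendsto.const_mul_atTop hρ tendsto_id))
  have hlim := hwalk.comp hN
  refine tendsto_of_tendsto_of_tendsto_of_le_of_le' tendsto_const_nhds hlim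
    (Eventually.of_forall fun _ => measureReal_nonneg) ?_
  filter_upwards [eventually_gt_atTop 0,
    eventually_ge_atTop ((C0 * (1 + A * ‖p‖) + (T + s)) / (1 - θ))] with t ht htb
  rw [div_le_iff₀ (by linarith)] at htb
  refine measureReal_mono ?_
  intro ω hω
  simp only [Set.mem_ofPred_eq] at hω ⊢
  by_contra hcon
  push Not at hcon
  apply hω
  set N := ⌈ρ * t / β⌉₊ with hNd
  have hN1 : ρ * t ≤ N * β := by
    rw [← div_le_iff₀ hβ0]; exact Nat.le_ceil _
  have hN2 : (N:ℝ) < ρ * t / β + 1 := Nat.ceil_lt_add_one (by positivity)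
  have hex : ∃ k, ρ * t ≤ (SS R p T s A k ω : ℝ) := ⟨N, hN1.trans hcon.le⟩
  classical
  set k := Nat.find hex with hk
  have hk1 : ρ * t ≤ (SS R p T s A k ω : ℝ) := Nat.find_spec hex
  have hkN : k ≤ N := Nat.find_min' hex (hN1.trans hcon.le)
  have hk2 : (SS R p T s A k ω : ℝ) ≤ ρ * t + A := by
    rcases hkk : k with _ | j
    · simp only [SS, Nat.cast_zero]; positivity
    · have h1 : ¬ ρ * t ≤ (SS R p T s A j ω : ℝ) := Nat.find_min hex (by omega)
      have h2 : SS R p T s A (j + 1) ω ≤ SS R p T s A j ω + A :=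
        Nat.add_le_add_left (DD_le _ _ _ _ _ _ _) _
      have h3 : (SS R p T s A (j + 1) ω : ℝ) ≤ SS R p T s A j ω + A := by exact_mod_cast h2
      linarith
  refine h.trans _ _ _ _ _ _ _ (h.SS_reach p hs hT0 A k ω) (h.fish _ _ _ _ _ ?_)
  rw [smul_smul, ← sub_smul, norm_smul, Real.norm_eq_abs]
  have h1 : |t * ρ - (SS R p T s A k ω : ℝ)| ≤ A := by
    rw [abs_le]; constructor <;> linarith
  have h2 : (k:ℝ) * (T + s) ≤ θ * t + (T + s) := by
    have h3 : (k:ℝ) ≤ ρ * t / β + 1 := le_trans (by exact_mod_cast hkN) hN2.le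
    have h4 := mul_le_mul_of_nonneg_right h3 (show 0 ≤ T + s by linarith)
    have h5 : ρ * t / β * (T + s) ≤ θ * t := by
      rw [div_mul_eq_mul_div, div_le_iff₀ hβ0]
      have := mul_le_mul_of_nonneg_right hθβ ht.le
      linarith
    linarith
  have h3 : C0 * (1 + |t * ρ - (SS R p T s A k ω : ℝ)| * ‖p‖) ≤ C0 * (1 + A * ‖p‖) := by
    have := h.C1
    gcongr
  linarith

theorem Mdl.muT_ge [IsProbabilityMeasure P] (h : Mdl P R C0 V φ mm mp Υ) {p : Euc d}
    (hp : p ≠ 0) {ρ r η κ t : ℝ} (hρ : 0 ≤ ρ) (hρr : ρ ≤ r) (ht : 0 ≤ t) (hη : 0 < η)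
    (hκ1 : κ ≤ 1)
    (h1 : P.real {ω | ¬ R ω 0 0 t (t • ρ • p)} ≤ κ) (h2 : η ≤ P.real {ω | R ω 0 0 t (t • r • p)}) :
    (ρ * t - 1) * (1 - κ) + (r * t - 1 - ρ * t) * η ≤ muT P R V p (t + C0 * (1 + ‖p‖) + 1) := by
  have hp0 : 0 < ‖p‖ := norm_pos_iff.2 hp
  have hC := h.C1
  set T := t + C0 * (1 + ‖p‖) + 1 with hT
  unfold muT
  set A := ⌊V * T / ‖p‖⌋₊ with hA
  have key : ∀ σ, 0 ≤ σ → ∀ ω, R ω 0 0 t (t • σ • p) → ⌊σ * t⌋₊ ≤ DD R p T A 0 0 ω := by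
    intro σ hσ ω hR
    have hn1 : (⌊σ * t⌋₊ : ℝ) ≤ σ * t := Nat.floor_le (by positivity)
    have hn2 : σ * t < ⌊σ * t⌋₊ + 1 := Nat.lt_floor_add_one _
    set n := ⌊σ * t⌋₊
    have hR2 : R ω 0 0 (t + C0 * (1 + ‖p‖)) ((n:ℝ) • p) := by
      refine h.trans _ _ _ _ _ _ _ hR (h.fish _ _ _ _ _ ?_)
      rw [smul_smul, ← sub_smul, norm_smul, Real.norm_eq_abs]
      have : |(n:ℝ) - t * σ| ≤ 1 := by rw [abs_le]; constructor <;> linarith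
      have : C0 * (1 + |(n:ℝ) - t * σ| * ‖p‖) ≤ C0 * (1 + 1 * ‖p‖) := by gcongr
      linarith
    refine le_DD.2 (Or.inr ⟨n, le_rfl, ?_, t + C0 * (1 + ‖p‖), by positivity, by linarith, ?_⟩)
    · refine Nat.le_floor ?_
      rw [le_div_iff₀ hp0]
      have := h.speed _ _ _ _ _ hR2
      rw [sub_zero, sub_zero, norm_smul, Real.norm_eq_abs, abs_of_nonneg (Nat.cast_nonneg _)] at this
      refine this.trans (mul_le_mul_of_nonneg_left (by linarith) h.V0.le)
    · simpa using hR2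
  set n1 := ⌊ρ * t⌋₊ with hn1
  set n2 := ⌊r * t⌋₊ with hn2
  have hn12 : n1 ≤ n2 := Nat.floor_mono (mul_le_mul_of_nonneg_right hρr ht)
  have hn2A : n2 ≤ A := by
    have : ({ω | R ω 0 0 t (t • r • p)}).Nonempty := by
      by_contra hne
      rw [Set.not_nonempty_iff_eq_empty] at hne
      rw [hne] at h2; simp at h2; linarith
    obtain ⟨ω, hω⟩ := this
    exact (key r (hρ.trans hρr) ω hω).trans (DD_le _ _ _ _ _ _ _)
  set f : ℕ → ℝ := fun n => P.real {ω | n ≤ DD R p T A 0 0 ω} with hf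
  have hf0 : ∀ n, 0 ≤ f n := fun n => measureReal_nonneg
  have hf1 : ∀ n ≤ n1, 1 - κ ≤ f n := by
    intro n hn
    have h3 : P.real {ω | R ω 0 0 t (t • ρ • p)} ≤ f n :=
      measureReal_mono fun ω hω => hn.trans (key ρ hρ ω hω)
    have h4 := measureReal_union_le (μ := P) {ω | R ω 0 0 t (t • ρ • p)}
      {ω | ¬ R ω 0 0 t (t • ρ • p)}
    have h5 : {ω | R ω 0 0 t (t • ρ • p)} ∪ {ω | ¬ R ω 0 0 t (t • ρ • p)} = Set.univ := by
      ext ω; simp only [Set.mem_union, Set.mem_ofPred_eq, Set.mem_univ, iff_true]; exact em _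
    rw [h5, probReal_univ] at h4
    linarith
  have hf2 : ∀ n ≤ n2, η ≤ f n := fun n hn =>
    h2.trans (measureReal_mono fun ω hω => hn.trans (key r (hρ.trans hρr) ω hω))
  have e0 : Finset.Icc 1 A = Finset.Ioc 0 A := by ext; simp [Nat.succ_le_iff]
  change _ ≤ ∑ n ∈ Finset.Icc 1 A, f n
  rw [e0, ← Finset.sum_Ioc_consecutive f (Nat.zero_le n2) hn2A,
    ← Finset.sum_Ioc_consecutive f (Nat.zero_le n1) hn12]
  have s1 : (n1:ℝ) * (1 - κ) ≤ ∑ n ∈ Finset.Ioc 0 n1, f n := by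
    have := Finset.card_nsmul_le_sum (Finset.Ioc 0 n1) f (1 - κ)
      (fun n hn => hf1 n (Finset.mem_Ioc.1 hn).2)
    simpa using this
  have s2 : ((n2:ℝ) - n1) * η ≤ ∑ n ∈ Finset.Ioc n1 n2, f n := by
    have := Finset.card_nsmul_le_sum (Finset.Ioc n1 n2) f η
      (fun n hn => hf2 n (Finset.mem_Ioc.1 hn).2)
    rwa [Nat.card_Ioc, nsmul_eq_mul, Nat.cast_sub hn12] at this
  have s3 : 0 ≤ ∑ n ∈ Finset.Ioc n2 A, f n := Finset.sum_nonneg fun n _ => hf0 n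
  have a1 : (n1:ℝ) ≤ ρ * t := Nat.floor_le (by positivity)
  have a2 : ρ * t < n1 + 1 := Nat.lt_floor_add_one _
  have a3 : r * t < n2 + 1 := Nat.lt_floor_add_one _
  have b1 : (ρ * t - 1) * (1 - κ) ≤ n1 * (1 - κ) :=
    mul_le_mul_of_nonneg_right (by linarith) (by linarith)
  have b2 : (r * t - 1 - ρ * t) * η ≤ ((n2:ℝ) - n1) * η :=
    mul_le_mul_of_nonneg_right (by linarith) hη.le
  linarith

theorem Mdl.bad_of_rate [IsProbabilityMeasure P] (h : Mdl P R C0 V φ mm mp Υ) {p : Euc d}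
    (hp : p ≠ 0) {w r : ℝ} (hw0 : 0 ≤ w) (hr : w < r)
    (hw : ∀ ξ > 0, ∀ᶠ T in atTop, muT P R V p T < (w + ξ) * T)
    (hg : ∀ ρ, 0 ≤ ρ → (ρ < w ∨ ρ = 0) → Good P R (ρ • p)) : Bad P R (r • p) := by
  refine tendsto_order.2 ⟨fun a ha => Eventually.of_forall fun _ => ha.trans_le measureReal_nonneg,
    fun η hη => ?_⟩
  by_contra hcon
  have hfr : ∃ᶠ t in atTop, η ≤ P.real {ω | R ω 0 0 t (t • r • p)} := by
    refine fun hh => hcon (hh.mono fun t ht => not_le.1 ht)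
  have hη1 : η ≤ 1 := by
    obtain ⟨t, ht⟩ := hfr.exists
    exact ht.trans measureReal_le_one
  set ξ := η * (r - w) / 8 with hξ
  have hξ0 : 0 < ξ := by have := sub_pos.2 hr; positivity
  set ρ := max 0 (w - 2 * ξ) with hρ
  have hρ0 : 0 ≤ ρ := le_max_left _ _
  have hρw : ρ ≤ w := max_le hw0 (by linarith)
  have hρw2 : w - 2 * ξ ≤ ρ := le_max_right _ _
  have hgρ := hg ρ hρ0 (by
    rcases le_total 0 (w - 2 * ξ) with h1 | h1
    · left; rw [hρ, max_eq_right h1]; linarith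
    · right; rw [hρ, max_eq_left h1])
  set κ := min 1 (ξ / (w + 1)) with hκ
  have hκ0 : 0 < κ := lt_min one_pos (by positivity)
  have hκ1 : κ ≤ 1 := min_le_left _ _
  have hκ2 : κ * (w + 1) ≤ ξ := by rw [← le_div_iff₀ (by positivity)]; exact min_le_right _ _
  set a := C0 * (1 + ‖p‖) + 1 with ha
  have ha0 : 0 ≤ a := by have := h.C1; positivity
  have htend : Tendsto (fun t : ℝ => t + a) atTop atTop := tendsto_atTop_add_const_right _ _ tendsto_id
  obtain ⟨t, htη, htκ, htμ, ht1, ht2, ht3⟩ := (hfr.and_eventually ((hgρ.eventually_le_const hκ0).and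
    ((htend.eventually (hw ξ hξ0)).and ((eventually_ge_atTop 1).and
    ((eventually_ge_atTop (2 / ξ)).and (eventually_ge_atTop (a * (w + ξ) / ξ))))))).exists
  have ht0 : 0 < t := by linarith
  have hm := h.muT_ge hp hρ0 (hρw.trans hr.le) ht0.le hη hκ1 htκ htη
  rw [add_assoc, ← ha] at hm
  rw [div_le_iff₀ hξ0] at ht2 ht3
  have e1 : ρ * κ ≤ ξ := by
    have : ρ * κ ≤ (w + 1) * κ := mul_le_mul_of_nonneg_right (by linarith) hκ0.le
    linarith
  have e2 : 8 * ξ ≤ (r - ρ) * η := by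
    have : (r - w) * η ≤ (r - ρ) * η := mul_le_mul_of_nonneg_right (by linarith) hη.le
    rw [hξ]; linarith
  have e3 : t * (ρ * κ) ≤ t * ξ := mul_le_mul_of_nonneg_left e1 ht0.le
  have e4 : t * (8 * ξ) ≤ t * ((r - ρ) * η) := mul_le_mul_of_nonneg_left e2 ht0.le
  have e5 : t * (w - 2 * ξ) ≤ t * ρ := mul_le_mul_of_nonneg_left hρw2 ht0.le
  have e6 : 0 < t * ξ := by positivity
  linarith

theorem Mdl.dichotomy [IsProbabilityMeasure P] (h : Mdl P R C0 V φ mm mp Υ) (p : Euc d) :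
    Good P R p ∨ ∀ r : ℝ, 1 < r → Bad P R (r • p) := by
  have hz : Good P R (0 : Euc d) := h.good_ball (by simp)
  by_cases hp : p = 0
  · left; rw [hp]; exact hz
  have hp0 : 0 < ‖p‖ := norm_pos_iff.2 hp
  set W : Set ℝ := {r | ∃ᶠ T in atTop, r * T ≤ muT P R V p T} with hW
  have hbd : ∀ r ∈ W, r ≤ V / ‖p‖ := by
    intro r hr
    obtain ⟨T, hT, hT0⟩ := (Frequently.and_eventually hr (eventually_gt_atTop 0)).exists
    have h1 : muT P R V p T ≤ V * T / ‖p‖ := by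
      have hV := h.V0
      refine le_trans ?_ (Nat.floor_le (by positivity))
      unfold muT
      refine (Finset.sum_le_card_nsmul _ _ 1 fun n _ => measureReal_le_one).trans ?_
      simp
    have h2 : r * T ≤ V / ‖p‖ * T := by rw [div_mul_eq_mul_div]; linarith
    exact le_of_mul_le_mul_right h2 hT0
  have hbdd : BddAbove W := ⟨_, hbd⟩
  have h0W : (0:ℝ) ∈ W := by
    refine Eventually.frequently (Eventually.of_forall fun T => ?_)
    rw [zero_mul]
    exact Finset.sum_nonneg fun _ _ => measureReal_nonneg
  have hw0 : 0 ≤ sSup W := le_csSup hbdd h0W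
  have hgood : ∀ ρ, 0 ≤ ρ → (ρ < sSup W ∨ ρ = 0) → Good P R (ρ • p) := by
    intro ρ hρ hc
    rcases hρ.eq_or_lt with h1 | h1
    · rw [← h1, zero_smul]; exact hz
    · rcases hc with hc | hc
      · obtain ⟨r, hr, hρr⟩ := exists_lt_of_lt_csSup ⟨0, h0W⟩ hc
        exact h.good_of_rate hp h1 hρr hr
      · linarith
  rcases lt_or_ge 1 (sSup W) with h1 | h1
  · left
    simpa using hgood 1 zero_le_one (Or.inl h1)
  · right
    intro r hr
    have hb : ∀ ξ > 0, ∀ᶠ T in atTop, muT P R V p T < (sSup W + ξ) * T := ?_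
    · exact h.bad_of_rate hp hw0 (h1.trans_lt hr) hb hgood
    intro ξ hξ
    have hn : ¬ ∃ᶠ T in atTop, (sSup W + ξ) * T ≤ muT P R V p T := fun hm => by
      have := le_csSup hbdd (Set.mem_ofPred_eq ▸ hm : sSup W + ξ ∈ W)
      linarith
    rw [not_frequently] at hn
    filter_upwards [hn] with T hT
    exact not_le.1 hT
end

section
variable {d : ℕ} {Ω : Type*} [mΩ : MeasurableSpace Ω] {P : Measure Ω}
    {R : Ω → ℝ → Euc d → ℝ → Euc d → Prop} {C0 V : ℝ} {φ : ℝ → ℝ} {mm mp : ℝ → MeasurableSpace Ω}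
    {Υ : ℝ × Euc d → Ω → Ω}

theorem Mdl.shiftR (h : Mdl P R C0 V φ mm mp Υ) (s t : ℝ) (y z : Euc d) :
    P.real {ω | R ω s y (s + t) (y + z)} = P.real {ω | R ω 0 0 t z} := by
  rw [measureReal_def, measureReal_def, ← h.inv (s, y) {ω | R ω 0 0 t z}]
  congr 2
  ext ω
  simp only [Set.mem_preimage, Set.mem_ofPred_eq, h.shift, zero_add, add_comm, add_zero]

theorem Mdl.shiftN (h : Mdl P R C0 V φ mm mp Υ) (s t : ℝ) (y z : Euc d) :
    P.real {ω | ¬ R ω s y (s + t) (y + z)} = P.real {ω | ¬ R ω 0 0 t z} := by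
  rw [measureReal_def, measureReal_def, ← h.inv (s, y) {ω | ¬ R ω 0 0 t z}]
  congr 2
  ext ω
  simp only [Set.mem_preimage, Set.mem_ofPred_eq, h.shift, zero_add, add_comm, add_zero]

theorem Mdl.good_convex [IsProbabilityMeasure P] (h : Mdl P R C0 V φ mm mp Υ) :
    Convex ℝ {x | Good P R x} := by
  rw [convex_iff_forall_pos]
  intro x hx y hy a b ha hb hab
  have hx' : Tendsto (fun t : ℝ => P.real {ω | ¬ R ω 0 0 t (t • x)}) atTop (nhds 0) := hx
  have hy' : Tendsto (fun t : ℝ => P.real {ω | ¬ R ω 0 0 t (t • y)}) atTop (nhds 0) := hy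
  have h1 : Tendsto (fun t : ℝ => P.real {ω | ¬ R ω 0 0 (a * t) ((a * t) • x)} +
      P.real {ω | ¬ R ω 0 0 (b * t) ((b * t) • y)}) atTop (nhds (0 + 0)) :=
    (hx'.comp (Tendsto.const_mul_atTop ha tendsto_id)).add
      (hy'.comp (Tendsto.const_mul_atTop hb tendsto_id))
  rw [add_zero] at h1
  change Tendsto (fun t : ℝ => P.real {ω | ¬ R ω 0 0 t (t • (a • x + b • y))}) atTop (nhds 0)
  refine squeeze_zero (fun _ => measureReal_nonneg) (fun t => ?_) h1
  rw [← h.shiftN (a * t) (b * t) ((a * t) • x) ((b * t) • y)]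
  refine (measureReal_mono ?_ (measure_ne_top _ _)).trans (measureReal_union_le _ _)
  intro ω hω
  simp only [Set.mem_union, Set.mem_ofPred_eq] at hω ⊢
  by_contra hcon
  push Not at hcon
  have := h.trans _ _ _ _ _ _ _ hcon.1 hcon.2
  apply hω
  convert this using 1
  · rw [← add_mul, hab, one_mul]
  · rw [smul_add, smul_smul, smul_smul, mul_comm t a, mul_comm t b]

theorem Mdl.good_bdd [IsProbabilityMeasure P] (h : Mdl P R C0 V φ mm mp Υ) {x : Euc d}
    (hx : Good P R x) : ‖x‖ ≤ V := by
  by_contra hcon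
  push Not at hcon
  have h1 : Tendsto (fun t : ℝ => P.real {ω | ¬ R ω 0 0 t (t • x)}) atTop (nhds 1) := by
    refine tendsto_const_nhds.congr' ?_
    filter_upwards [eventually_gt_atTop 0] with t ht
    have : {ω | ¬ R ω 0 0 t (t • x)} = Set.univ := by
      ext ω
      simp only [Set.mem_ofPred_eq, Set.mem_univ, iff_true]
      intro hR
      have := h.speed _ _ _ _ _ hR
      rw [sub_zero, sub_zero, norm_smul, Real.norm_eq_abs, abs_of_pos ht] at this
      have := mul_lt_mul_of_pos_left hcon ht
      linarith
    rw [this, probReal_univ]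
  exact zero_ne_one (tendsto_nhds_unique hx h1)

theorem Mdl.ball_good (h : Mdl P R C0 V φ mm mp Υ) :
    Metric.ball (0 : Euc d) (2 * C0)⁻¹ ⊆ {x | Good P R x} := by
  intro x hx
  have hC := h.C1
  refine h.good_ball ?_
  rw [mem_ball_zero_iff] at hx
  have := mul_le_mul_of_nonneg_left hx.le (show 0 ≤ C0 by linarith)
  refine this.trans (le_of_eq ?_)
  field_simp

theorem Mdl.zero_int (h : Mdl P R C0 V φ mm mp Υ) : (0 : Euc d) ∈ interior {x | Good P R x} := by
  have hC := h.C1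
  refine interior_maximal h.ball_good isOpen_ball ?_
  exact mem_ball_self (by positivity)

theorem Mdl.bad_of_notMem [IsProbabilityMeasure P] (h : Mdl P R C0 V φ mm mp Υ) {q : Euc d}
    (hq : q ∉ interior {x | Good P R x}) {ρ : ℝ} (hρ : 1 < ρ) : Bad P R (ρ • q) := by
  set r := (1 + ρ) / 2 with hr
  have hr1 : 1 < r := by rw [hr]; linarith
  have hrρ : r < ρ := by rw [hr]; linarith
  have hr0 : 0 < r := by linarith
  rcases h.dichotomy (r • q) with hg | hb
  · exfalso
    apply hq
    have h1 := h.good_convex.openSegment_interior_self_subset_interior h.zero_int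
      (show r • q ∈ {x | Good P R x} from hg)
    apply h1
    refine ⟨1 - r⁻¹, r⁻¹, sub_pos.2 (inv_lt_one_of_one_lt₀ hr1), inv_pos.2 hr0, by ring, ?_⟩
    rw [smul_zero, zero_add, smul_smul, inv_mul_cancel₀ hr0.ne', one_smul]
  · have := hb (ρ / r) ((one_lt_div hr0).2 hrρ)
    rwa [smul_smul, div_mul_cancel₀ _ hr0.ne'] at this

theorem union0 [IsFiniteMeasure P] {ι : Type*} (I : Finset ι) (E : ι → ℝ → Set Ω) (F : ℝ → Set Ω)
    (hE : ∀ i ∈ I, Tendsto (fun t => P.real (E i t)) atTop (nhds 0))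
    (hF : ∀ᶠ t in atTop, F t ⊆ ⋃ i ∈ I, E i t) : Tendsto (fun t => P.real (F t)) atTop (nhds 0) := by
  have h1 : Tendsto (fun t => ∑ i ∈ I, P.real (E i t)) atTop (nhds (∑ i ∈ I, 0)) :=
    tendsto_finsetSum I hE
  rw [Finset.sum_const_zero] at h1
  refine tendsto_of_tendsto_of_tendsto_of_le_of_le' tendsto_const_nhds h1
    (Eventually.of_forall fun _ => measureReal_nonneg) ?_
  filter_upwards [hF] with t ht
  exact (measureReal_mono ht (measure_ne_top _ _)).trans (measureReal_biUnion_finset_le _ _)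

theorem euc_net {s : Set (Euc d)} {B : ℝ} (hs : ∀ x ∈ s, ‖x‖ ≤ B) {ε : ℝ} (hε : 0 < ε) :
    ∃ X : Finset (Euc d), (∀ x ∈ X, x ∈ s) ∧ ∀ x ∈ s, ∃ y ∈ X, ‖x - y‖ ≤ ε := by
  have hb : TotallyBounded s :=
    ((isCompact_closedBall (0 : Euc d) B).totallyBounded).subset fun x hx =>
      mem_closedBall_zero_iff.2 (hs x hx)
  obtain ⟨X, hXs, hXf, hX⟩ := Metric.finite_approx_of_totallyBounded hb ε hε
  refine ⟨hXf.toFinset, fun x hx => hXs (hXf.mem_toFinset.1 hx), fun x hx => ?_⟩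
  obtain ⟨y, hy, hxy⟩ := Set.mem_iUnion₂.1 (hX hx)
  exact ⟨y, hXf.mem_toFinset.2 hy, by rw [← dist_eq_norm]; exact (mem_ball.1 hxy).le⟩

theorem Mdl.lower [IsProbabilityMeasure P] (h : Mdl P R C0 V φ mm mp Υ) {R0 δ : ℝ} (hR0 : 0 < R0)
    (hδ : 0 < δ) (hδ1 : δ < 1) :
    Tendsto (fun t : ℝ => P.real {ω | ∃ s ∈ Set.Icc (t / R0) (R0 * t), ∃ x0 : Euc d, ‖x0‖ ≤ R0 * t ∧
      ∃ p, Good P R p ∧ ¬ R ω 0 x0 s (x0 + ((1 - δ) * s) • p)}) atTop (nhds 0) := by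
  have hC := h.C1
  have hC0 : 0 < C0 := by linarith
  set ε := δ / (6 * R0) with hε
  have hε0 : 0 < ε := by positivity
  have h3ε : 3 * ε = δ / (2 * R0) := by rw [hε]; field_simp; norm_num
  obtain ⟨X, hX1, hX2⟩ := euc_net (s := closedBall (0 : Euc d) R0) (B := R0)
    (fun x hx => mem_closedBall_zero_iff.1 hx) (ε := ε / (4 * C0)) (by positivity)
  obtain ⟨Y, hY1, hY2⟩ := euc_net (s := {x : Euc d | Good P R x}) (B := V)
    (fun x hx => h.good_bdd hx) (ε := ε / (4 * C0 * R0)) (by positivity)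
  set I := ((Finset.range (⌊R0 / ε⌋₊ + 1)).filter (fun n : ℕ => 0 < ε * n - 2 * ε)) ×ˢ X ×ˢ Y with hI
  refine union0 I (fun i t => {ω | ¬ R ω (ε * t) (t • i.2.1) (ε * t + (ε * i.1 - 2 * ε) * t)
    (t • i.2.1 + ((ε * i.1 - 2 * ε) * t) • i.2.2)}) _ ?_ ?_
  · rintro ⟨n, x, y⟩ hi
    simp only [hI, Finset.mem_product, Finset.mem_filter] at hi
    simp only [h.shiftN]
    have hy' : Tendsto (fun t : ℝ => P.real {ω | ¬ R ω 0 0 t (t • y)}) atTop (nhds 0) :=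
      hY1 y hi.2.2
    exact hy'.comp (Tendsto.const_mul_atTop hi.1.2 tendsto_id)
  · filter_upwards [eventually_gt_atTop 0, eventually_ge_atTop (2 * C0 / ε)] with t ht htb
    rw [div_le_iff₀ hε0] at htb
    rintro ω ⟨s, hs, x0, hx0, p, hp, hnR⟩
    obtain ⟨x, hxX, hx⟩ := hX2 (t⁻¹ • x0) (by
      rw [mem_closedBall_zero_iff, norm_smul, Real.norm_eq_abs, abs_of_pos (inv_pos.2 ht),
        inv_mul_le_iff₀ ht]
      linarith)
    set s' := s / t with hs'
    have hst : s = s' * t := by rw [hs']; field_simp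
    have hs1 : 1 / R0 ≤ s' := by
      rw [hs', le_div_iff₀ ht]; refine le_trans (le_of_eq ?_) hs.1; ring
    have hs2 : s' ≤ R0 := by rw [hs', div_le_iff₀ ht]; exact hs.2
    have hs'0 : 0 < s' := lt_of_lt_of_le (by positivity) hs1
    have hn1 : (⌊s' / ε⌋₊ : ℝ) ≤ s' / ε := Nat.floor_le (by positivity)
    have hn2 : s' / ε < ⌊s' / ε⌋₊ + 1 := Nat.lt_floor_add_one _
    have hnN : ⌊s' / ε⌋₊ ≤ ⌊R0 / ε⌋₊ := Nat.floor_mono (by gcongr)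
    set n := ⌊s' / ε⌋₊
    rw [le_div_iff₀ hε0] at hn1
    rw [div_lt_iff₀ hε0] at hn2
    set σ := ε * n - 2 * ε with hσ
    have hσ1 : s' - 3 * ε < σ := by rw [hσ]; linarith
    have hσ2 : σ ≤ s' - 2 * ε := by rw [hσ]; linarith
    have h3s : 3 * ε ≤ δ * s' := by
      have : δ * (1 / R0) ≤ δ * s' := mul_le_mul_of_nonneg_left hs1 hδ.le
      rw [h3ε]
      refine le_trans ?_ this
      rw [mul_one_div]
      exact div_le_div_of_nonneg_left hδ.le hR0 (by linarith)
    have hσ3 : (1 - δ) * s' ≤ σ := by linarith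
    have hσ0 : 0 < σ := lt_of_lt_of_le (mul_pos (by linarith) hs'0) hσ3
    set l := (1 - δ) * s' / σ with hl
    have hl0 : 0 ≤ l := div_nonneg (mul_nonneg (by linarith) hs'0.le) hσ0.le
    have hl1 : l ≤ 1 := (div_le_one hσ0).2 hσ3
    have hlσ : σ * l = (1 - δ) * s' := by rw [hl]; field_simp
    obtain ⟨y, hyY, hy⟩ := hY2 (l • p) (by
      have h0 : (0 : Euc d) ∈ {x | Good P R x} := interior_subset h.zero_int
      have := h.good_convex h0 (show p ∈ {x | Good P R x} from hp) (sub_nonneg.2 hl1) hl0 (by ring)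
      rwa [smul_zero, zero_add] at this)
    refine Set.mem_iUnion₂.2 ⟨(n, x, y), ?_, ?_⟩
    · simp only [hI, Finset.mem_product, Finset.mem_filter, Finset.mem_range]
      exact ⟨⟨by omega, hσ0⟩, hxX, hyY⟩
    · simp only [Set.mem_ofPred_eq]
      intro hR
      apply hnR
      have hxt : ‖t • x - x0‖ ≤ t * (ε / (4 * C0)) := by
        have e : t • x - x0 = -(t • (t⁻¹ • x0 - x)) := by
          rw [smul_sub, smul_smul, mul_inv_cancel₀ ht.ne', one_smul]; abel
        rw [e, norm_neg, norm_smul, Real.norm_eq_abs, abs_of_pos ht]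
        exact mul_le_mul_of_nonneg_left hx ht.le
      have hCC : C0 * (t * (ε / (4 * C0))) = ε * t / 4 := by field_simp
      refine h.trans _ _ _ _ _ _ _ (h.fish _ _ _ _ _ ?_)
        (h.trans _ _ _ _ _ _ _ hR (h.fish _ _ _ _ _ ?_))
      · have := mul_le_mul_of_nonneg_left hxt hC0.le
        have : 0 < ε * t := by positivity
        linarith
      · have e : x0 + ((1 - δ) * s) • p - (t • x + (σ * t) • y) =
            -(t • x - x0) + (σ * t) • (l • p - y) := by
          have : (1 - δ) * s = σ * t * l := by rw [hst]; linear_combination -t * hlσ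
          rw [this, smul_sub, smul_smul]; abel
        have h1 : ‖x0 + ((1 - δ) * s) • p - (t • x + (σ * t) • y)‖ ≤
            t * (ε / (4 * C0)) + t * (ε / (4 * C0)) := by
          rw [e]
          refine (norm_add_le _ _).trans (add_le_add (by rwa [norm_neg]) ?_)
          rw [norm_smul, Real.norm_eq_abs, abs_of_pos (by positivity)]
          calc σ * t * ‖l • p - y‖ ≤ R0 * t * (ε / (4 * C0 * R0)) := by
                gcongr
                linarith
            _ = _ := by field_simp
        have h2 := mul_le_mul_of_nonneg_left h1 hC0.le
        have h3 := mul_le_mul_of_nonneg_right hσ2 ht.le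
        linarith

theorem Mdl.upper [IsProbabilityMeasure P] (h : Mdl P R C0 V φ mm mp Υ) {R0 δ : ℝ} (hR0 : 0 < R0)
    (hδ : 0 < δ) (hδ1 : δ < 1) :
    Tendsto (fun t : ℝ => P.real {ω | ∃ s ∈ Set.Icc (t / R0) (R0 * t), ∃ x0 : Euc d, ‖x0‖ ≤ R0 * t ∧
      ∃ q, q ∉ interior {x | Good P R x} ∧ R ω 0 x0 s (x0 + ((1 + δ) * s) • q)}) atTop (nhds 0) := by
  have hC := h.C1
  have hV := h.V0
  have hC0 : 0 < C0 := by linarith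
  set ε := δ / (6 * R0) with hε
  have hε0 : 0 < ε := by positivity
  have h3ε : 3 * ε = δ / (2 * R0) := by rw [hε]; field_simp; norm_num
  obtain ⟨X, hX1, hX2⟩ := euc_net (s := closedBall (0 : Euc d) R0) (B := R0)
    (fun x hx => mem_closedBall_zero_iff.1 hx) (ε := ε / (4 * C0)) (by positivity)
  obtain ⟨Y, hY1, hY2⟩ := euc_net (s := {x : Euc d | ‖x‖ ≤ V ∧ Bad P R x}) (B := V)
    (fun x hx => hx.1) (ε := ε / (8 * C0 * R0)) (by positivity)
  set I := (Finset.range (⌊R0 / ε⌋₊ + 1)) ×ˢ X ×ˢ Y with hI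
  refine union0 I (fun i t => {ω | R ω (-ε * t) (t • i.2.1) (-ε * t + (ε * i.1 + 3 * ε) * t)
    (t • i.2.1 + ((ε * i.1 + 3 * ε) * t) • i.2.2)}) _ ?_ ?_
  · rintro ⟨n, x, y⟩ hi
    simp only [hI, Finset.mem_product] at hi
    simp only [h.shiftR]
    have hy' : Tendsto (fun t : ℝ => P.real {ω | R ω 0 0 t (t • y)}) atTop (nhds 0) :=
      (hY1 y hi.2.2).2
    have hp : 0 < ε * (n : ℝ) + 3 * ε := by positivity
    exact hy'.comp (Tendsto.const_mul_atTop hp tendsto_id)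
  · filter_upwards [eventually_gt_atTop 0, eventually_ge_atTop (2 * C0 / ε)] with t ht htb
    rw [div_le_iff₀ hε0] at htb
    rintro ω ⟨s, hs, x0, hx0, q, hq, hR⟩
    obtain ⟨x, hxX, hx⟩ := hX2 (t⁻¹ • x0) (by
      rw [mem_closedBall_zero_iff, norm_smul, Real.norm_eq_abs, abs_of_pos (inv_pos.2 ht),
        inv_mul_le_iff₀ ht]
      linarith)
    set s' := s / t with hs'
    have hst : s = s' * t := by rw [hs']; field_simp
    have hs1 : 1 / R0 ≤ s' := by
      rw [hs', le_div_iff₀ ht]; refine le_trans (le_of_eq ?_) hs.1; ring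
    have hs2 : s' ≤ R0 := by rw [hs', div_le_iff₀ ht]; exact hs.2
    have hs'0 : 0 < s' := lt_of_lt_of_le (by positivity) hs1
    have hn1 : (⌊s' / ε⌋₊ : ℝ) ≤ s' / ε := Nat.floor_le (by positivity)
    have hn2 : s' / ε < ⌊s' / ε⌋₊ + 1 := Nat.lt_floor_add_one _
    have hnN : ⌊s' / ε⌋₊ ≤ ⌊R0 / ε⌋₊ := Nat.floor_mono (by gcongr)
    set n := ⌊s' / ε⌋₊
    rw [le_div_iff₀ hε0] at hn1
    rw [div_lt_iff₀ hε0] at hn2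
    set σ := ε * n + 3 * ε with hσ
    have hσ1 : s' + 2 * ε ≤ σ := by rw [hσ]; linarith
    have hσ2 : σ ≤ s' + 3 * ε := by rw [hσ]; linarith
    have h3s : 3 * ε < δ * s' := by
      have : δ * (1 / R0) ≤ δ * s' := mul_le_mul_of_nonneg_left hs1 hδ.le
      rw [h3ε]
      refine lt_of_lt_of_le ?_ this
      rw [mul_one_div]
      exact div_lt_div_of_pos_left hδ hR0 (by linarith)
    have hσ3 : σ < (1 + δ) * s' := by linarith
    have hσ0 : 0 < σ := by linarith
    have hσR : σ ≤ 2 * R0 := by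
      have : δ * s' ≤ 1 * s' := mul_le_mul_of_nonneg_right hδ1.le hs'0.le
      linarith
    set l := (1 + δ) * s' / σ with hl
    have hl1 : 1 < l := (one_lt_div hσ0).2 hσ3
    have hlσ : σ * l = (1 + δ) * s' := by rw [hl]; field_simp
    have hsl : (1 + δ) * s = σ * t * l := by rw [hst]; linear_combination -t * hlσ
    obtain ⟨y, hyY, hy⟩ := hY2 (l • q) (by
      refine ⟨?_, h.bad_of_notMem hq hl1⟩
      have h1 := h.speed _ _ _ _ _ hR
      rw [add_sub_cancel_left, sub_zero, hsl, mul_smul, norm_smul, Real.norm_eq_abs,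
        abs_of_pos (by positivity)] at h1
      have h2 : V * s ≤ V * (σ * t) := by
        rw [hst]; gcongr; linarith
      have h3 : σ * t * ‖l • q‖ ≤ σ * t * V := by linarith
      exact le_of_mul_le_mul_left h3 (by positivity))
    refine Set.mem_iUnion₂.2 ⟨(n, x, y), ?_, ?_⟩
    · simp only [hI, Finset.mem_product, Finset.mem_range]
      exact ⟨by omega, hxX, hyY⟩
    · simp only [Set.mem_ofPred_eq]
      have hxt : ‖t • x - x0‖ ≤ t * (ε / (4 * C0)) := by
        have e : t • x - x0 = -(t • (t⁻¹ • x0 - x)) := by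
          rw [smul_sub, smul_smul, mul_inv_cancel₀ ht.ne', one_smul]; abel
        rw [e, norm_neg, norm_smul, Real.norm_eq_abs, abs_of_pos ht]
        exact mul_le_mul_of_nonneg_left hx ht.le
      have hCC : C0 * (t * (ε / (4 * C0))) = ε * t / 4 := by field_simp
      refine h.trans _ _ _ _ _ _ _ (h.fish _ _ _ _ _ ?_)
        (h.trans _ _ _ _ _ _ _ hR (h.fish _ _ _ _ _ ?_))
      · rw [norm_sub_rev]
        have := mul_le_mul_of_nonneg_left hxt hC0.le
        have : 0 < ε * t := by positivity
        linarith
      · have e : t • x + (σ * t) • y - (x0 + ((1 + δ) * s) • q) =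
            (t • x - x0) + -((σ * t) • (l • q - y)) := by
          rw [hsl, smul_sub, smul_smul]; abel
        have h1 : ‖t • x + (σ * t) • y - (x0 + ((1 + δ) * s) • q)‖ ≤
            t * (ε / (4 * C0)) + t * (ε / (4 * C0)) := by
          rw [e]
          refine (norm_add_le _ _).trans (add_le_add hxt ?_)
          rw [norm_neg, norm_smul, Real.norm_eq_abs, abs_of_pos (by positivity)]
          calc σ * t * ‖l • q - y‖ ≤ 2 * R0 * t * (ε / (8 * C0 * R0)) := by gcongr
            _ = _ := by field_simp; norm_num
        have h2 := mul_le_mul_of_nonneg_left h1 hC0.le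
        have h3 := mul_le_mul_of_nonneg_right hσ1 ht.le
        linarith
end

section
variable {d : ℕ} {Ω : Type*} [mΩ : MeasurableSpace Ω] {P : Measure Ω}
    {R : Ω → ℝ → Euc d → ℝ → Euc d → Prop} {C0 V : ℝ} {φ : ℝ → ℝ} {mm mp : ℝ → MeasurableSpace Ω}
    {Υ : ℝ × Euc d → Ω → Ω}

theorem Mdl.shape [IsProbabilityMeasure P] (h : Mdl P R C0 V φ mm mp Υ) :
    ∃ M : ℝ, 1 ≤ M ∧ ∃ S : Set (Euc d), Convex ℝ S ∧ IsOpen S ∧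
      Metric.ball 0 M⁻¹ ⊆ S ∧ S ⊆ Metric.ball 0 M ∧
      ∀ R0 : ℝ, 0 < R0 → ∀ δ ∈ Set.Ioo (0:ℝ) 1,
        Tendsto (fun t : ℝ => P {ω | ∀ s ∈ Set.Icc (t / R0) (R0 * t),
            ∀ x0 ∈ Metric.ball (0 : Euc d) (R0 * t),
              (fun p : Euc d => x0 + ((1 - δ) * s) • p) '' S ⊆ {x | R ω 0 x0 (0 + s) x} ∧
                {x | R ω 0 x0 (0 + s) x} ⊆ (fun p : Euc d => x0 + ((1 + δ) * s) • p) '' S})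
          atTop (nhds 1) := by
  have hC := h.C1
  have hV := h.V0
  refine ⟨max (2 * C0) (V + 1), le_max_of_le_left (by linarith), interior {x | Good P R x},
    h.good_convex.interior, isOpen_interior, ?_, ?_, ?_⟩
  · refine (ball_subset_ball ?_).trans (interior_maximal h.ball_good isOpen_ball)
    exact inv_anti₀ (by linarith) (le_max_left _ _)
  · intro x hx
    rw [mem_ball_zero_iff]
    have := h.good_bdd (interior_subset hx)
    exact lt_of_lt_of_le (by linarith) (le_max_right _ _)
  · intro R0 hR0 δ hδ
    have hl := h.lower hR0 hδ.1 hδ.2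
    have hu := h.upper hR0 hδ.1 hδ.2
    have h1 := (hl.add hu).const_sub 1
    rw [add_zero, sub_zero] at h1
    rw [← ENNReal.tendsto_toReal_iff (fun _ => measure_ne_top _ _) ENNReal.one_ne_top,
      ENNReal.toReal_one]
    refine tendsto_of_tendsto_of_tendsto_of_le_of_le' h1 tendsto_const_nhds ?_
      (Eventually.of_forall fun t => measureReal_le_one)
    filter_upwards [eventually_gt_atTop 0] with t ht
    rw [sub_le_iff_le_add, ← measureReal_def]
    refine le_trans (probReal_univ (μ := P)).ge (le_trans ?_ ((measureReal_union_le _ _).trans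
      (add_le_add_right (measureReal_union_le _ _) _)))
    refine measureReal_mono ?_ (measure_ne_top _ _)
    intro ω _
    by_contra hcon
    simp only [Set.mem_union, not_or] at hcon
    obtain ⟨hA, hL, hU⟩ := hcon
    apply hA
    intro s hs x0 hx0
    have hx0' : ‖x0‖ ≤ R0 * t := (mem_ball_zero_iff.1 hx0).le
    have hs0 : 0 < s := lt_of_lt_of_le (by positivity) hs.1
    rw [zero_add]
    constructor
    · rintro _ ⟨p, hp, rfl⟩
      by_contra hn
      exact hL ⟨s, hs, x0, hx0', p, interior_subset hp, hn⟩
    · intro z hz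
      have hk : 0 < (1 + δ) * s := mul_pos (by linarith [hδ.1]) hs0
      have e : x0 + ((1 + δ) * s) • (((1 + δ) * s)⁻¹ • (z - x0)) = z := by
        rw [smul_smul, mul_inv_cancel₀ hk.ne', one_smul, add_sub_cancel]
      refine ⟨((1 + δ) * s)⁻¹ • (z - x0), ?_, e⟩
      by_contra hn
      refine hU ⟨s, hs, x0, hx0', _, hn, ?_⟩
      rw [e]
      exact hz
end

theorem reach_shift_iff {d : ℕ} {c c' : ℝ → Euc d → ℝ} {v v' : ℝ → Euc d → Euc d} {s : ℝ} {y : Euc d}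
    (hc : ∀ t x, c' t x = c (t + s) (x + y)) (hv : ∀ t x, v' t x = v (t + s) (x + y))
    {t0 t1 : ℝ} {x0 x1 : Euc d} :
    Reachable c' v' t0 x0 t1 x1 ↔ Reachable c v (t0 + s) (x0 + y) (t1 + s) (x1 + y) := by
  obtain rfl : c' = fun t x => c (t + s) (x + y) := funext fun t => funext fun x => hc t x
  obtain rfl : v' = fun t x => v (t + s) (x + y) := funext fun t => funext fun x => hv t x
  refine ⟨fun h => h.shift, fun h => ?_⟩
  have h' : Reachable (fun t x => c (t + s + -s) (x + y + -y)) (fun t x => v (t + s + -s) (x + y + -y))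
      (t0 + s) (x0 + y) (t1 + s) (x1 + y) := by
    simpa only [add_neg_cancel_right] using h
  have h2 := Reachable.shift (c := fun t x => c (t + s) (x + y)) (v := fun t x => v (t + s) (x + y))
    (s := -s) (y := -y) (t0 := t0 + s) (x0 := x0 + y) (t1 := t1 + s) (x1 := x1 + y)
    (by simpa only [neg_add_cancel_right] using h)
  simpa only [add_neg_cancel_right] using h2

theorem inv_all {d : ℕ} {Ω : Type*} [MeasurableSpace Ω] {P : Measure Ω} {Υ : ℝ × Euc d → Ω → Ω}
    (hmp : ∀ p, MeasurePreserving (Υ p) P P) (hid : Υ 0 = id)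
    (hgrp : ∀ p q, Υ p ∘ Υ q = Υ (p + q)) (p : ℝ × Euc d) (A : Set Ω) : P (Υ p ⁻¹' A) = P A := by
  have h1 : ∀ ω, Υ (-p) (Υ p ω) = ω := fun ω => by
    have := congrFun (hgrp (-p) p) ω
    rwa [neg_add_cancel, hid] at this
  have h2 : ∀ ω, Υ p (Υ (-p) ω) = ω := fun ω => by
    have := congrFun (hgrp p (-p)) ω
    rwa [add_neg_cancel, hid] at this
  let e : Ω ≃ᵐ Ω := ⟨⟨Υ p, Υ (-p), h1, h2⟩, (hmp p).measurable, (hmp (-p)).measurable⟩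
  exact MeasurePreserving.measure_preimage_equiv (f := e) (hmp p) A

theorem mix_ineq {d : ℕ} {Ω : Type*} [MeasurableSpace Ω] {P : Measure Ω} [IsProbabilityMeasure P]
    {c : ℝ → Euc d → Ω → ℝ} {v : ℝ → Euc d → Ω → Euc d} (t s : ℝ) (E F : Set Ω)
    (hE : MeasurableSet[sigmaMinus c v t] E) (hF : MeasurableSet[sigmaPlus c v (t + s)] F) :
    P.real F * P.real E - phiH P c v s * P.real E ≤ P.real (F ∩ E) := by
  rcases eq_or_ne (P E) 0 with h0 | h0
  · have : P.real E = 0 := by rw [measureReal_def, h0, ENNReal.toReal_zero]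
    rw [this, mul_zero, mul_zero, sub_zero]
    exact measureReal_nonneg
  · have hpos : 0 < P.real E := ENNReal.toReal_pos h0 (measure_ne_top _ _)
    have hle : |P.real (F ∩ E) / P.real E - P.real F| ≤ phiH P c v s := by
      refine le_csSup ⟨1, ?_⟩ ⟨t, E, F, hE, hF, pos_iff_ne_zero.2 h0, rfl⟩
      rintro _ ⟨t', E', F', -, -, -, rfl⟩
      have q1 : (P (F' ∩ E')).toReal / (P E').toReal ≤ 1 :=
        div_le_one_of_le₀ (measureReal_mono Set.inter_subset_right (measure_ne_top _ _))
          ENNReal.toReal_nonneg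
      have q2 : 0 ≤ (P (F' ∩ E')).toReal / (P E').toReal :=
        div_nonneg ENNReal.toReal_nonneg ENNReal.toReal_nonneg
      have q3 : (P F').toReal ≤ 1 := measureReal_le_one
      have q4 : 0 ≤ (P F').toReal := ENNReal.toReal_nonneg
      rw [abs_le]
      constructor <;> linarith
    have h1 := (abs_le.1 hle).1
    have h2 := mul_le_mul_of_nonneg_right h1 hpos.le
    rw [sub_mul, div_mul_cancel₀ _ hpos.ne'] at h2
    linarith

/-- **Wulff shape in probability for reachable sets of the G-equation.**
Under the G-equation hypotheses and decay of `φ_H`, there are `M ≥ 1` and a convex bounded open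
set `S` with `B_{1/M}(0) ⊆ S ⊆ B_M(0)` such that for every `R > 0` and `δ ∈ (0,1)`, the
probability that `(1−δ)sS ⊆ Γ(s,·;0,x₀) − x₀ ⊆ (1+δ)sS` for all `s ∈ [t/R, Rt]` and all
`|x₀| < Rt` tends to `1` as `t → ∞`. -/
theorem gequation_wulff_shape_in_probability
    {d : ℕ} {Ω : Type*} [MeasurableSpace Ω] (P : Measure Ω) [IsProbabilityMeasure P]
    (c : ℝ → Euc d → Ω → ℝ) (v : ℝ → Euc d → Ω → Euc d)
    -- `c` is positive, `(c,v)` are bounded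
    (hc_pos : ∀ t x ω, 0 < c t x ω)
    (hbdd : ∃ K : ℝ, ∀ t x ω, c t x ω ≤ K ∧ ‖v t x ω‖ ≤ K)
    -- uniform continuity in `t`, uniformly in `(x,ω)`
    (huct : ∀ ε : ℝ, 0 < ε → ∃ δ : ℝ, 0 < δ ∧ ∀ t t' : ℝ, |t - t'| ≤ δ → ∀ x ω,
      |c t x ω - c t' x ω| ≤ ε ∧ ‖v t x ω - v t' x ω‖ ≤ ε)
    -- uniform Lipschitz continuity in `x`
    (hlip : ∃ L : ℝ, ∀ t : ℝ, ∀ x x' : Euc d, ∀ ω,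
      |c t x ω - c t x' ω| ≤ L * ‖x - x'‖ ∧ ‖v t x ω - v t x' ω‖ ≤ L * ‖x - x'‖)
    -- `v(t,·,ω)` is divergence-free (a.e. vanishing trace of the a.e. derivative)
    (hdiv : ∀ t : ℝ, ∀ ω, ∀ᵐ x ∂(volume : Measure (Euc d)),
      LinearMap.trace ℝ (Euc d) (fderiv ℝ (fun y => v t y ω) x).toLinearMap = 0)
    -- the averaged smallness condition (1.14): inf_L sup |avg of v over L-boxes| < inf c
    (hGc4 : ∃ L : ℝ, 0 < L ∧ ∃ a b : ℝ, a < b ∧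
      (∀ t x ω,
        ‖(L ^ d)⁻¹ • ∫ y in {y : Euc d | ∀ i, y i ∈ Set.Icc (0:ℝ) L}, v t (x + y) ω‖ ≤ a) ∧
      (∀ t x ω, b ≤ c t x ω))
    -- space-time stationarity with respect to a measure-preserving group
    (Υ : ℝ × Euc d → Ω → Ω)
    (hmp : ∀ p, MeasurePreserving (Υ p) P P)
    (hid : Υ 0 = id)
    (hgrp : ∀ p q, Υ p ∘ Υ q = Υ (p + q))
    (hstat : ∀ t s : ℝ, ∀ x y : Euc d, ∀ ω,
      c t x (Υ (s, y) ω) = c (t + s) (x + y) ω ∧ v t x (Υ (s, y) ω) = v (t + s) (x + y) ω)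
    -- measurability in ω of the travel times
    (hτmeas : ∀ t0 : ℝ, ∀ x0 x : Euc d,
      Measurable fun ω => travelTime (fun a b => c a b ω) (fun a b => v a b ω) t0 x0 x)
    -- decay of the mixing coefficient
    (hmix : Tendsto (phiH P c v) atTop (nhds 0)) :
    ∃ M : ℝ, 1 ≤ M ∧ ∃ S : Set (Euc d), Convex ℝ S ∧ IsOpen S ∧
      Metric.ball 0 M⁻¹ ⊆ S ∧ S ⊆ Metric.ball 0 M ∧
      ∀ R : ℝ, 0 < R → ∀ δ ∈ Set.Ioo (0:ℝ) 1,
        Tendsto (fun t : ℝ => P {ω | ∀ s ∈ Set.Icc (t / R) (R * t),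
            ∀ x0 ∈ Metric.ball (0 : Euc d) (R * t),
              (fun p : Euc d => x0 + ((1 - δ) * s) • p) '' S
                  ⊆ reachSet (fun a b => c a b ω) (fun a b => v a b ω) s 0 x0 ∧
                reachSet (fun a b => c a b ω) (fun a b => v a b ω) s 0 x0
                  ⊆ (fun p : Euc d => x0 + ((1 + δ) * s) • p) '' S})
          atTop (nhds 1) := by
  obtain ⟨K', hK'⟩ := hbdd
  obtain ⟨L', hL'⟩ := hlip
  obtain ⟨L0, hL0, a, b, hab, havg, hb⟩ := hGc4
  have hne : Nonempty Ω := nonempty_of_isProbabilityMeasure P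
  obtain ⟨ω0⟩ := hne
  have ha : 0 ≤ a := (norm_nonneg _).trans (havg 0 0 ω0)
  obtain ⟨δ0, hδ0, hδ⟩ := huct ((b - a) / 6) (by linarith)
  set K := max K' 1 with hKdef
  set L : NNReal := L'.toNNReal with hLdef
  have hK1 : 1 ≤ K := le_max_right _ _
  have hKc : ∀ t x ω, c t x ω ≤ K := fun t x ω => (hK' t x ω).1.trans (le_max_left _ _)
  have hKv : ∀ t x ω, ‖v t x ω‖ ≤ K := fun t x ω => (hK' t x ω).2.trans (le_max_left _ _)
  have hLL : L' ≤ (L : ℝ) := Real.le_coe_toNNReal L'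
  have hLc : ∀ t x x' ω, |c t x ω - c t x' ω| ≤ L * ‖x - x'‖ := fun t x x' ω =>
    (hL' t x x' ω).1.trans (mul_le_mul_of_nonneg_right hLL (norm_nonneg _))
  have hLv : ∀ t x x' ω, ‖v t x ω - v t x' ω‖ ≤ L * ‖x - x'‖ := fun t x x' ω =>
    (hL' t x x' ω).2.trans (mul_le_mul_of_nonneg_right hLL (norm_nonneg _))
  have hF : ∀ ω, Fld K L a b L0 δ0 (fun a b => c a b ω) (fun a b => v a b ω) := fun ω =>
    { hK := fun t x => hKv t x ω
      ht := fun t t' x h => (hδ t t' h x ω).2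
      hL := fun t => LipschitzWith.of_dist_le_mul fun x y => by
        rw [dist_eq_norm, dist_eq_norm]; exact hLv t x y ω
      hdiv := fun t => hdiv t ω
      havg := fun t x => havg t x ω
      hb := fun t x => hb t x ω }
  have hReg : ∀ ω, Reg K (L : ℝ) (fun a b => c a b ω) (fun a b => v a b ω) := fun ω =>
    { K0 := by linarith
      L0 := L.2
      c0 := fun t x => hc_pos t x ω
      cK := fun t x => hKc t x ω
      vK := fun t x => hKv t x ω
      cL := fun t x x' => hLc t x x' ω
      vL := fun t x x' => hLv t x x' ω
      uc := fun ε hε => by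
        obtain ⟨δ, h1, h2⟩ := huct ε hε
        exact ⟨δ, h1, fun t t' h x => h2 t t' h x ω⟩ }
  obtain ⟨C0, hC0, hfish⟩ := fish (d := d) L (show 0 ≤ K by linarith) ha hab hL0 hδ0
  have hhit : ∀ t0 x0 x T, MeasurableSet (hitLt c v t0 x0 x T) := by
    intro t0 x0 x T
    rw [hitLt_tt (fun ω => ⟨C0 * (1 + ‖x - x0‖), by positivity,
      hfish _ _ (hF ω) _ _ _ _ (by linarith)⟩)]
    exact measurableSet_lt (hτmeas t0 x0 x) measurable_const
  have hmdl : Mdl P (fun ω => Reachable (fun a b => c a b ω) (fun a b => v a b ω)) C0 (2 * K)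
      (phiH P c v) (fun t => sigmaMinus c v t ⊓ ‹MeasurableSpace Ω›)
      (fun t => sigmaPlus c v t ⊓ ‹MeasurableSpace Ω›) Υ :=
    { refl := fun ω t x => Reachable.refl t x
      trans := fun ω t x s y r z h1 h2 => h1.trans h2
      C1 := hC0
      V0 := by linarith
      fish := fun ω s x t y h => hfish _ _ (hF ω) _ _ _ _ h
      speed := fun ω s x t y h => Reachable.speed (fun t x => hKc t x ω) (fun t x => hKv t x ω) h
      le := fun ω s x t y h => h.1
      shift := fun s y ω t0 x0 t1 x1 => reach_shift_iff (fun t x => (hstat t s x y ω).1)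
        (fun t x => (hstat t s x y ω).2)
      inv := inv_all hmp hid hgrp
      mmono := fun s t h => inf_le_inf_right _ (sigmaMinus_mono h)
      mmle := fun t => inf_le_right
      mple := fun t => inf_le_right
      hitm := fun t0 x0 x T => MeasurableSpace.measurableSet_inf.2
        ⟨hitLt_minus hReg t0 x0 x T, hhit t0 x0 x T⟩
      hitp := fun t0 x0 x T => MeasurableSpace.measurableSet_inf.2
        ⟨hitLt_plus hReg t0 x0 x T, hhit t0 x0 x T⟩
      mix := fun t s E F hE hF => mix_ineq t s E F (MeasurableSpace.measurableSet_inf.1 hE).1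
        (MeasurableSpace.measurableSet_inf.1 hF).1
      φ0 := hmix }
  exact hmdl.shape
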